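/- Let α∈(0,1) and θ∈ℝ with α+θ>0, and let (K_n,(K_{r,n})_{r≥1}) be the Ewens–Pitman block-counting chain with parameters (α,θ). For each n≥1 the sequence (√(K_n)(P_{r,n}−p_α(r)))_{r≥1} is a random element of ℓ²(ℕ), and as n→∞ it converges in distribution, with respect to the norm topology of ℓ², to a centered Gaussian random element G of ℓ² whose covariance is given, for all x,y∈ℓ², by E[⟨x,G⟩⟨y,G⟩] = ∑_{r≥1} p_α(r)x_r y_r − (∑_{r≥1} p_α(r)x_r)(∑_{r≥1} p_α(r)y_r); equivalently, the covariance matrix is Γ_α = diag(p_α) − p_α p_α^T. -/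

import Mathlib

open MeasureTheory ProbabilityTheory Filter Topology

noncomputable section

/-- Rising factorial `(a)^(m) = a (a+1) ⋯ (a+m-1)` of a real number. -/
def risingFactorial (a : ℝ) : ℕ → ℝ
  | 0 => 1
  | m + 1 => risingFactorial a m * (a + m)

/-- Sibuya probabilities `p_α(r) = α (1-α)^(r-1) / r!` for `r ≥ 1`. -/
def sibuya (α : ℝ) (r : ℕ) : ℝ :=
  α * risingFactorial (1 - α) (r - 1) / (Nat.factorial r : ℝ)

/-- The Ewens–Pitman block-counting chain with parameters `(α, θ)` on a probability space
`(Ω, μ)` with filtration `F`: for `n ≥ 1`, `K n` is the number of blocks and `B r n` the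
number of blocks of size `r` of the Ewens–Pitman random partition of `{1,…,n}`.
It starts from `K 1 = 1`, `B 1 1 = 1`, `B r 1 = 0` for `r ≥ 2`, and the transition from
time `n` to `n+1` creates a new block with conditional probability `(α K n + θ)/(n + θ)`,
and grows a block of size `r` to size `r+1` with conditional probability
`(r - α) B r n / (n + θ)`. -/
structure IsEwensPitman (α θ : ℝ) {Ω : Type*} {mΩ : MeasurableSpace Ω}
    (μ : Measure Ω) (F : Filtration ℕ mΩ) (K : ℕ → Ω → ℕ) (B : ℕ → ℕ → Ω → ℕ) :
    Prop where
  prob : IsProbabilityMeasure μ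
  meas_K : ∀ n, Measurable[F n] (K n)
  meas_B : ∀ r n, Measurable[F n] (B r n)
  init_K : ∀ᵐ ω ∂μ, K 1 ω = 1
  init_B1 : ∀ᵐ ω ∂μ, B 1 1 ω = 1
  init_B : ∀ r, 2 ≤ r → ∀ᵐ ω ∂μ, B r 1 ω = 0
  B_eq_zero : ∀ r n, n < r → ∀ᵐ ω ∂μ, B r n ω = 0
  sum_blocks : ∀ n, 1 ≤ n → ∀ᵐ ω ∂μ, K n ω = ∑ r ∈ Finset.Icc 1 n, B r n ω
  sum_sizes : ∀ n, 1 ≤ n → ∀ᵐ ω ∂μ, n = ∑ r ∈ Finset.Icc 1 n, r * B r n ω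
  trans_new : ∀ n, 1 ≤ n →
    μ[Set.indicator {ω | K (n+1) ω = K n ω + 1 ∧ B 1 (n+1) ω = B 1 n ω + 1 ∧
        ∀ s, 2 ≤ s → B s (n+1) ω = B s n ω} (fun _ => (1:ℝ)) | F n]
      =ᵐ[μ] fun ω => (α * (K n ω : ℝ) + θ) / ((n : ℝ) + θ)
  trans_grow : ∀ n, 1 ≤ n → ∀ r, 1 ≤ r →
    μ[Set.indicator {ω | K (n+1) ω = K n ω ∧ B r (n+1) ω + 1 = B r n ω ∧
        B (r+1) (n+1) ω = B (r+1) n ω + 1 ∧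
        ∀ s, 1 ≤ s → s ≠ r → s ≠ r + 1 → B s (n+1) ω = B s n ω} (fun _ => (1:ℝ)) | F n]
      =ᵐ[μ] fun ω => (((r : ℝ) - α) * (B r n ω : ℝ)) / ((n : ℝ) + θ)

open scoped RealInnerProductSpace

/-- The sequence space `ℓ²(ℕ)`. -/
abbrev ellTwo : Type := lp (fun _ : ℕ => ℝ) 2

instance : MeasurableSpace ellTwo := borel _

instance : BorelSpace ellTwo := ⟨rfl⟩

set_option linter.unusedSectionVars false
set_option linter.unusedSimpArgs false
set_option linter.unusedVariables false

namespace EP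

/-- move one unit from `r` to `r+1` -/
def TT (r : ℕ) (b : ℕ → ℝ) : ℕ → ℝ :=
  fun s => b s + (if s = r + 1 then 1 else 0) - (if s = r then 1 else 0)

def bb (α θ : ℝ) {Ω : Type*} (K : ℕ → Ω → ℕ) (B : ℕ → ℕ → Ω → ℕ) (n : ℕ) (ω : Ω) : ℕ → ℝ :=
  fun r => if r = 0 then -((K n ω : ℝ) + θ / α) else (B r n ω : ℝ)

/-- transition weight -/
def pw (α θ : ℝ) (n r : ℕ) (b : ℕ → ℝ) : ℝ := ((r : ℝ) - α) * b r / ((n : ℝ) + θ)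

structure Good (α θ : ℝ) (n : ℕ) (b : ℕ → ℝ) : Prop where
  k : ∃ k : ℕ, 1 ≤ k ∧ k ≤ n ∧ b 0 = -((k : ℝ) + θ / α) ∧ ∑ r ∈ Finset.Icc 1 n, b r = k
  nn : ∀ r, 1 ≤ r → 0 ≤ b r
  le : ∀ r, 1 ≤ r → b r ≤ n
  z : ∀ r, n < r → b r = 0
  tot : ∑ r ∈ Finset.range (n + 1), pw α θ n r b = 1

structure Chain (α θ : ℝ) (m : ℕ → Measure (ℕ → ℝ)) : Prop where
  prob : ∀ n, IsProbabilityMeasure (m n)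
  good : ∀ n, 1 ≤ n → ∀ᵐ b ∂ m n, Good α θ n b
  fin : ∀ n, 1 ≤ n → ∃ S : Set (ℕ → ℝ), S.Finite ∧ ∀ᵐ b ∂ m n, b ∈ S
  init : ∀ᵐ b ∂ m 1, b = fun r => if r = 0 then -(1 + θ / α) else if r = 1 then 1 else 0
  step : ∀ n, 1 ≤ n → ∀ H : (ℕ → ℝ) → ℂ, Measurable H →
    ∫ b, H b ∂ m (n + 1) = ∫ b, ∑ r ∈ Finset.range (n + 1), (pw α θ n r b : ℂ) * H (TT r b) ∂ m n

theorem integrable_of_fin {X E : Type*} [MeasurableSpace X] [MeasurableSingletonClass X]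
    [NormedAddCommGroup E] {m : Measure X} [IsFiniteMeasure m] {S : Set X} (hS : S.Finite)
    (h : ∀ᵐ b ∂ m, b ∈ S) (f : X → E) : Integrable f m := by
  have h1 : IntegrableOn f S m := IntegrableOn.of_finite hS
  have : m.restrict S = m := Measure.restrict_eq_self_of_ae_mem h
  rwa [IntegrableOn, this] at h1

theorem measurable_TT (r : ℕ) : Measurable (TT r) := by
  unfold TT
  refine measurable_pi_lambda _ fun s => ?_
  fun_prop

theorem measurable_pw (α θ : ℝ) (n r : ℕ) : Measurable (pw α θ n r) := by
  unfold pw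
  fun_prop

section chain
variable {α θ : ℝ} {Ω : Type*} [mΩ : MeasurableSpace Ω] {μ : Measure Ω}
  {F : Filtration ℕ mΩ} {K : ℕ → Ω → ℕ} {B : ℕ → ℕ → Ω → ℕ}

theorem meas_bb (hEP : IsEwensPitman α θ μ F K B) (n : ℕ) : Measurable[F n] (bb α θ K B n) := by
  have hK := hEP.meas_K n
  have hB := fun r => hEP.meas_B r n
  unfold bb
  refine @measurable_pi_lambda _ _ _ (F n) _ _ fun r => ?_
  by_cases hr : r = 0
  · simp only [hr, if_true]
    have h2 : @Measurable _ _ (F n) _ fun ω => (K n ω : ℝ) :=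
      Measurable.comp (measurable_from_top (f := fun k : ℕ => (k:ℝ))) hK
    exact (h2.add_const _).neg
  · simp only [hr, if_false]
    exact Measurable.comp (measurable_from_top (f := fun k : ℕ => (k:ℝ))) (hB r)

theorem meas_bb' (hEP : IsEwensPitman α θ μ F K B) (n : ℕ) : Measurable (bb α θ K B n) :=
  (meas_bb hEP n).mono (F.le n) le_rfl

theorem bb_zero (n : ℕ) (ω : Ω) : bb α θ K B n ω 0 = -((K n ω : ℝ) + θ / α) := by simp [bb]

theorem bb_pos {r : ℕ} (hr : 1 ≤ r) (n : ℕ) (ω : Ω) : bb α θ K B n ω r = (B r n ω : ℝ) := by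
  simp [bb, show r ≠ 0 by omega]

theorem TT_inj {r s : ℕ} {b : ℕ → ℝ} (h : TT r b = TT s b) : r = s := by
  have h1 := congrFun h r
  simp only [TT] at h1
  by_contra hne
  simp [hne] at h1
  split_ifs at h1 <;> linarith

theorem ev_new (n : ℕ) : {ω | K (n+1) ω = K n ω + 1 ∧ B 1 (n+1) ω = B 1 n ω + 1 ∧
        ∀ s, 2 ≤ s → B s (n+1) ω = B s n ω} =
    {ω | bb α θ K B (n+1) ω = TT 0 (bb α θ K B n ω)} := by
  ext ω
  simp only [Set.mem_ofPred_eq]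
  constructor
  · rintro ⟨h1, h2, h3⟩
    funext s
    rcases s with _ | _ | s
    · simp [bb, TT, h1]; ring
    · simp [bb, TT, h2]
    · simp [bb, TT, h3 (s+2) (by omega)]
  · intro h
    refine ⟨?_, ?_, ?_⟩
    · have := congrFun h 0
      simp [bb, TT] at this
      have h' : ((K (n+1) ω : ℕ):ℝ) = ((K n ω + 1 : ℕ):ℝ) := by push_cast; linarith
      exact_mod_cast h'
    · have := congrFun h 1
      simp [bb, TT] at this
      exact_mod_cast this
    · intro s hs
      have := congrFun h s
      simp [bb, TT, show s ≠ 0 by omega, show s ≠ 1 by omega] at this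
      exact_mod_cast this

theorem ev_grow (n r : ℕ) (hr : 1 ≤ r) : {ω | K (n+1) ω = K n ω ∧ B r (n+1) ω + 1 = B r n ω ∧
        B (r+1) (n+1) ω = B (r+1) n ω + 1 ∧
        ∀ s, 1 ≤ s → s ≠ r → s ≠ r + 1 → B s (n+1) ω = B s n ω} =
    {ω | bb α θ K B (n+1) ω = TT r (bb α θ K B n ω)} := by
  ext ω
  simp only [Set.mem_ofPred_eq]
  constructor
  · rintro ⟨h1, h2, h3, h4⟩
    funext s
    by_cases s0 : s = 0
    · subst s0
      simp [bb, TT, h1, show 0 ≠ r by omega]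
    · by_cases sr : s = r
      · subst sr
        simp [bb, TT, s0, ← h2]
      · by_cases sr' : s = r + 1
        · subst sr'
          simp [bb, TT, h3]
        · simp [bb, TT, s0, sr, sr', h4 s (by omega) sr sr']
  · intro h
    refine ⟨?_, ?_, ?_, ?_⟩
    · have := congrFun h 0
      simp [bb, TT, show 0 ≠ r by omega] at this
      exact_mod_cast this
    · have := congrFun h r
      simp [bb, TT, show r ≠ 0 by omega] at this
      have h' : ((B r (n+1) ω + 1 : ℕ):ℝ) = ((B r n ω : ℕ):ℝ) := by push_cast; linarith
      exact_mod_cast h'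
    · have := congrFun h (r+1)
      simp [bb, TT] at this
      exact_mod_cast this
    · intro s hs hs1 hs2
      have := congrFun h s
      simp [bb, TT, show s ≠ 0 by omega, hs1, hs2] at this
      exact_mod_cast this

theorem trans (hα0 : 0 < α) (hEP : IsEwensPitman α θ μ F K B) (n : ℕ) (hn : 1 ≤ n) (r : ℕ) :
    μ[Set.indicator {ω | bb α θ K B (n+1) ω = TT r (bb α θ K B n ω)} (fun _ => (1:ℝ)) | F n]
      =ᵐ[μ] fun ω => pw α θ n r (bb α θ K B n ω) := by
  rcases Nat.eq_zero_or_pos r with rfl | hr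
  · rw [← ev_new]
    filter_upwards [hEP.trans_new n hn] with ω hω
    rw [hω, pw, bb_zero]
    push_cast
    congr 1
    field_simp
    ring
  · rw [← ev_grow n r hr]
    filter_upwards [hEP.trans_grow n hn r hr] with ω hω
    rw [hω, pw, bb_pos hr]

theorem meas_ev (hEP : IsEwensPitman α θ μ F K B) (n r : ℕ) :
    MeasurableSet {ω | bb α θ K B (n+1) ω = TT r (bb α θ K B n ω)} :=
  measurableSet_eq_fun (meas_bb' hEP (n+1)) ((measurable_TT r).comp (meas_bb' hEP n))

theorem good_bb (hα0 : 0 < α) (hα1 : α < 1) (hθ : 0 < α + θ)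
    (hEP : IsEwensPitman α θ μ F K B) (n : ℕ) (hn : 1 ≤ n) :
    ∀ᵐ ω ∂μ, Good α θ n (bb α θ K B n ω) := by
  have hz : ∀ᵐ ω ∂μ, ∀ r, n < r → B r n ω = 0 := by
    rw [ae_all_iff]; intro r
    by_cases h : n < r
    · filter_upwards [hEP.B_eq_zero r n h] with ω hω _ using hω
    · exact Eventually.of_forall fun _ h' => absurd h' h
  filter_upwards [hz, hEP.sum_blocks n hn, hEP.sum_sizes n hn] with ω h1 h2 h3
  have hle : K n ω ≤ n := by
    rw [h2]
    conv_rhs => rw [h3]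
    refine Finset.sum_le_sum fun r hr => ?_
    have := (Finset.mem_Icc.1 hr).1
    nlinarith
  have hge : 1 ≤ K n ω := by
    by_contra h
    have h0 : K n ω = 0 := by omega
    rw [h0] at h2
    have := (Finset.sum_eq_zero_iff).1 h2.symm
    have : n = 0 := by
      conv_lhs => rw [h3]
      exact Finset.sum_eq_zero fun r hr => by rw [this r hr]; simp
    omega
  have hsum : ∑ r ∈ Finset.Icc 1 n, bb α θ K B n ω r = K n ω := by
    rw [h2]; push_cast
    exact Finset.sum_congr rfl fun r hr => bb_pos (Finset.mem_Icc.1 hr).1 n ω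
  refine ⟨⟨K n ω, hge, hle, bb_zero n ω, hsum⟩, ?_, ?_, ?_, ?_⟩
  · intro r hr; rw [bb_pos hr]; positivity
  · intro r hr; rw [bb_pos hr]
    by_cases h : r ≤ n
    · have : B r n ω ≤ K n ω := by
        rw [h2]
        exact Finset.single_le_sum (f := fun r => B r n ω) (fun _ _ => Nat.zero_le _)
          (Finset.mem_Icc.2 ⟨hr, h⟩)
      exact_mod_cast this.trans hle
    · rw [h1 r (by omega)]; simp
  · intro r hr; rw [bb_pos (by omega), h1 r hr]; simp
  · have hpos : (0:ℝ) < n + θ := by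
      have : (1:ℝ) ≤ n := by exact_mod_cast hn
      linarith
    have e1 : ∑ r ∈ Finset.Icc 1 n, ((r:ℝ) * bb α θ K B n ω r) = n := by
      have : (n:ℝ) = ((∑ r ∈ Finset.Icc 1 n, r * B r n ω : ℕ) : ℝ) := by exact_mod_cast h3
      rw [this]; push_cast
      exact Finset.sum_congr rfl fun r hr => by rw [bb_pos (Finset.mem_Icc.1 hr).1 n ω]
    have e2 : Finset.range (n+1) = insert 0 (Finset.Icc 1 n) := by
      ext x; simp; omega
    unfold pw
    rw [← Finset.sum_div, div_eq_one_iff_eq hpos.ne', e2, Finset.sum_insert (by simp), bb_zero]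
    simp only [sub_mul]
    rw [Finset.sum_sub_distrib, e1, ← Finset.mul_sum, hsum]
    push_cast
    field_simp
    ring

theorem fin_bb (hα0 : 0 < α) (hα1 : α < 1) (hθ : 0 < α + θ)
    (hEP : IsEwensPitman α θ μ F K B) (n : ℕ) (hn : 1 ≤ n) :
    ∃ S : Set (ℕ → ℝ), S.Finite ∧ ∀ᵐ ω ∂μ, bb α θ K B n ω ∈ S := by
  let f : (Fin (n+1) → Fin (n+1)) → ℕ → ℝ := fun v r =>
    if h : r < n + 1 then (if r = 0 then -((v ⟨r, h⟩ : ℕ) + θ/α) else ((v ⟨r, h⟩ : ℕ) : ℝ)) else 0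
  refine ⟨Set.range f, Set.finite_range f, ?_⟩
  filter_upwards [good_bb hα0 hα1 hθ hEP n hn] with ω hω
  have hb : ∀ r, 1 ≤ r → B r n ω ≤ n := fun r hr => by
    have := hω.le r hr
    rw [bb_pos hr] at this
    exact_mod_cast this
  have hk : K n ω ≤ n := by
    obtain ⟨k, h1, h2, h3, h4⟩ := hω.k
    rw [bb_zero] at h3
    have : (K n ω : ℝ) = k := by linarith
    have : K n ω = k := by exact_mod_cast this
    omega
  refine ⟨fun r => if h : (r:ℕ) = 0 then ⟨K n ω, by omega⟩ else
    ⟨B r n ω, Nat.lt_succ_of_le (hb r (by omega))⟩, ?_⟩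
  funext r
  simp only [f]
  by_cases hr : r < n + 1
  · by_cases h0 : r = 0
    · simp [h0, bb]
    · simp [h0, hr, bb]
  · simp only [hr, dif_neg, not_false_eq_true]
    rw [hω.z r (by omega)]

theorem one_event (hα0 : 0 < α) (hα1 : α < 1) (hθ : 0 < α + θ)
    (hEP : IsEwensPitman α θ μ F K B) (n : ℕ) (hn : 1 ≤ n) :
    ∀ᵐ ω ∂μ, ∑ r ∈ Finset.range (n+1),
      Set.indicator {ω | bb α θ K B (n+1) ω = TT r (bb α θ K B n ω)} (fun _ => (1:ℝ)) ω = 1 := by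
  have := hEP.prob
  set I : ℕ → Ω → ℝ := fun r =>
    Set.indicator {ω | bb α θ K B (n+1) ω = TT r (bb α θ K B n ω)} (fun _ => (1:ℝ)) with hI
  have hint : ∀ r, Integrable (I r) μ := fun r =>
    (integrable_const (1:ℝ)).indicator (meas_ev hEP n r)
  have hle : ∀ ω, ∑ r ∈ Finset.range (n+1), I r ω ≤ 1 := by
    intro ω
    by_cases h : ∃ r ∈ Finset.range (n+1), bb α θ K B (n+1) ω = TT r (bb α θ K B n ω)
    · obtain ⟨r, hr, h⟩ := h
      rw [Finset.sum_eq_single_of_mem r hr]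
      · simp [hI, Set.indicator, h]
      · intro s _ hs
        simp only [hI, Set.indicator, Set.mem_ofPred_eq]
        rw [if_neg]
        intro h2
        exact hs (TT_inj (h2.symm.trans h))
    · push Not at h
      rw [Finset.sum_eq_zero]
      · norm_num
      · intro s hs
        simp [hI, Set.indicator, h s hs]
  have hpint : ∀ r, Integrable (fun ω => pw α θ n r (bb α θ K B n ω)) μ := fun r =>
    (integrable_condExp (m := F n)).congr (trans hα0 hEP n hn r)
  have e1 : ∫ ω, (∑ r ∈ Finset.range (n+1), I r ω) ∂μ = 1 := by
    rw [integral_finsetSum _ fun r _ => hint r]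
    have : ∀ r, ∫ ω, I r ω ∂μ = ∫ ω, pw α θ n r (bb α θ K B n ω) ∂μ := by
      intro r
      rw [← integral_condExp (F.le n)]
      exact integral_congr_ae (trans hα0 hEP n hn r)
    simp_rw [this]
    rw [← integral_finsetSum _ fun r _ => hpint r]
    rw [integral_congr_ae (g := fun _ => (1:ℝ))]
    · simp
    · filter_upwards [good_bb hα0 hα1 hθ hEP n hn] with ω hω using hω.tot
  have e2 : ∫ ω, (1 - ∑ r ∈ Finset.range (n+1), I r ω) ∂μ = 0 := by
    rw [integral_sub (integrable_const _) (integrable_finsetSum _ fun r _ => hint r), e1]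
    simp
  have e3 := (integral_eq_zero_iff_of_nonneg (μ := μ)
    (f := fun ω => 1 - ∑ r ∈ Finset.range (n+1), I r ω)
    (fun ω => by simp only [Pi.zero_apply]; linarith [hle ω])
    ((integrable_const _).sub (integrable_finsetSum _ fun r _ => hint r))).1 e2
  filter_upwards [e3] with ω hω
  simp only [Pi.zero_apply] at hω
  linarith

theorem step_real (hα0 : 0 < α) (hα1 : α < 1) (hθ : 0 < α + θ)
    (hEP : IsEwensPitman α θ μ F K B) (n : ℕ) (hn : 1 ≤ n) (H : (ℕ → ℝ) → ℝ) (hH : Measurable H) :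
    ∫ ω, H (bb α θ K B (n+1) ω) ∂μ =
      ∫ ω, ∑ r ∈ Finset.range (n+1), pw α θ n r (bb α θ K B n ω) * H (TT r (bb α θ K B n ω)) ∂μ := by
  have := hEP.prob
  set I : ℕ → Ω → ℝ := fun r =>
    Set.indicator {ω | bb α θ K B (n+1) ω = TT r (bb α θ K B n ω)} (fun _ => (1:ℝ)) with hI
  have hint : ∀ r, Integrable (I r) μ := fun r =>
    (integrable_const (1:ℝ)).indicator (meas_ev hEP n r)
  have hfin : ∀ G : (ℕ → ℝ) → ℝ, Measurable G → ∃ C, ∀ᵐ ω ∂μ, ‖G (bb α θ K B n ω)‖ ≤ C := by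
    intro G _
    obtain ⟨S, hS, hSm⟩ := fin_bb hα0 hα1 hθ hEP n hn
    obtain ⟨C, hC⟩ := (hS.image fun b => ‖G b‖).bddAbove
    exact ⟨C, hSm.mono fun ω hω => hC ⟨_, hω, rfl⟩⟩
  have e1 : ∀ᵐ ω ∂μ, H (bb α θ K B (n+1) ω) =
      ∑ r ∈ Finset.range (n+1), H (TT r (bb α θ K B n ω)) * I r ω := by
    filter_upwards [one_event hα0 hα1 hθ hEP n hn] with ω hω
    rw [← mul_one (H _), ← hω, Finset.mul_sum]
    refine Finset.sum_congr rfl fun r _ => ?_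
    by_cases h : bb α θ K B (n+1) ω = TT r (bb α θ K B n ω)
    · simp only [hI]; rw [h]
    · simp [hI, Set.indicator, h]
  have hHm : ∀ r, Measurable fun b => H (TT r b) := fun r => hH.comp (measurable_TT r)
  have hi : ∀ r, Integrable (fun ω => H (TT r (bb α θ K B n ω)) * I r ω) μ := by
    intro r
    obtain ⟨C, hC⟩ := hfin _ (hHm r)
    exact (hint r).bdd_mul ((hHm r).comp (meas_bb' hEP n)).aestronglyMeasurable hC
  have hpint : ∀ r, Integrable (fun ω => pw α θ n r (bb α θ K B n ω)) μ := fun r =>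
    (integrable_condExp (m := F n)).congr (trans hα0 hEP n hn r)
  have hi2 : ∀ r, Integrable (fun ω => pw α θ n r (bb α θ K B n ω) * H (TT r (bb α θ K B n ω))) μ := by
    intro r
    obtain ⟨C, hC⟩ := hfin _ (hHm r)
    exact (hpint r).mul_bdd ((hHm r).comp (meas_bb' hEP n)).aestronglyMeasurable hC
  rw [integral_congr_ae e1, integral_finsetSum _ fun r _ => hi r,
    integral_finsetSum _ fun r _ => hi2 r]
  refine Finset.sum_congr rfl fun r _ => ?_
  have e3 := condExp_mul_of_stronglyMeasurable_left (m := F n) (μ := μ)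
    (f := fun ω => H (TT r (bb α θ K B n ω))) (g := I r)
    ((hHm r).comp (meas_bb hEP n)).stronglyMeasurable (hi r) (hint r)
  rw [← integral_condExp (F.le n)]
  refine integral_congr_ae ?_
  filter_upwards [e3, trans hα0 hEP n hn r] with ω h1 h2
  have h1' := h1
  simp only [Pi.mul_apply] at h1'
  rw [mul_comm, ← h2]
  exact h1'

theorem step_cplx (hα0 : 0 < α) (hα1 : α < 1) (hθ : 0 < α + θ)
    (hEP : IsEwensPitman α θ μ F K B) (n : ℕ) (hn : 1 ≤ n) (H : (ℕ → ℝ) → ℂ) (hH : Measurable H) :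
    ∫ ω, H (bb α θ K B (n+1) ω) ∂μ =
      ∫ ω, ∑ r ∈ Finset.range (n+1), (pw α θ n r (bb α θ K B n ω) : ℂ) *
        H (TT r (bb α θ K B n ω)) ∂μ := by
  have := hEP.prob
  have hfi : ∀ n, 1 ≤ n → ∀ G : (ℕ → ℝ) → ℂ, Measurable G →
      Integrable (fun ω => G (bb α θ K B n ω)) μ := by
    intro n hn G hG
    obtain ⟨S, hS, hSm⟩ := fin_bb hα0 hα1 hθ hEP n hn
    obtain ⟨C, hC⟩ := (hS.image fun b => ‖G b‖).bddAbove
    exact Integrable.of_bound (hG.comp (meas_bb' hEP n)).aestronglyMeasurable C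
      (hSm.mono fun ω hω => hC ⟨_, hω, rfl⟩)
  have hm2 : Measurable fun b => ∑ r ∈ Finset.range (n+1), (pw α θ n r b : ℂ) * H (TT r b) := by
    refine Finset.measurable_sum _ fun r _ => ?_
    exact (Complex.measurable_ofReal.comp (measurable_pw α θ n r)).mul (hH.comp (measurable_TT r))
  have hL := hfi (n+1) (by omega) H hH
  have hR := hfi n hn _ hm2
  rw [← integral_re_add_im hL, ← integral_re_add_im hR]
  have r1 := step_real hα0 hα1 hθ hEP n hn (fun b => (H b).re) (Complex.measurable_re.comp hH)
  have r2 := step_real hα0 hα1 hθ hEP n hn (fun b => (H b).im) (Complex.measurable_im.comp hH)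
  simp only [RCLike.re_eq_complex_re, RCLike.im_eq_complex_im, Complex.re_sum, Complex.im_sum,
    Complex.re_ofReal_mul, Complex.im_ofReal_mul]
  rw [r1, r2]

theorem chain_of (hα0 : 0 < α) (hα1 : α < 1) (hθ : 0 < α + θ)
    (hEP : IsEwensPitman α θ μ F K B) : Chain α θ (fun n => μ.map (bb α θ K B n)) := by
  have := hEP.prob
  have hm := meas_bb' hEP (α := α) (θ := θ)
  refine ⟨fun n => Measure.isProbabilityMeasure_map (hm n).aemeasurable, ?_, ?_, ?_, ?_⟩
  · intro n hn
    obtain ⟨S, hS, hSm⟩ := fin_bb hα0 hα1 hθ hEP n hn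
    have h1 : ∀ᵐ b ∂ μ.map (bb α θ K B n), b ∈ S ∩ {b | Good α θ n b} := by
      rw [ae_map_iff (hm n).aemeasurable]
      · filter_upwards [hSm, good_bb hα0 hα1 hθ hEP n hn] with ω h1 h2 using ⟨h1, h2⟩
      · exact (hS.inter_of_left _).measurableSet
    filter_upwards [h1] with b hb using hb.2
  · intro n hn
    obtain ⟨S, hS, hSm⟩ := fin_bb hα0 hα1 hθ hEP n hn
    refine ⟨S, hS, ?_⟩
    exact (ae_map_iff (p := fun b => b ∈ S) (hm n).aemeasurable hS.measurableSet).2 hSm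
  · refine (ae_map_iff (hm 1).aemeasurable (measurableSet_eq_fun measurable_id measurable_const)).2 ?_
    have : ∀ᵐ ω ∂μ, ∀ r, 2 ≤ r → B r 1 ω = 0 := by
      rw [ae_all_iff]; intro r
      by_cases h : 2 ≤ r
      · filter_upwards [hEP.init_B r h] with ω hω _ using hω
      · exact Eventually.of_forall fun _ h' => absurd h' h
    filter_upwards [this, hEP.init_K, hEP.init_B1] with ω h1 h2 h3
    funext r
    rcases r with _ | _ | r
    · simp [bb, h2]
    · simp [bb, h3]
    · simp [bb, h1 (r+2) (by omega)]
  · intro n hn H hH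
    rw [integral_map (hm _).aemeasurable hH.aestronglyMeasurable, integral_map (hm _).aemeasurable]
    · exact step_cplx hα0 hα1 hθ hEP n hn H hH
    · refine (Finset.measurable_sum _ fun r _ => ?_).aestronglyMeasurable
      exact (Complex.measurable_ofReal.comp (measurable_pw α θ n r)).mul (hH.comp (measurable_TT r))

end chain
end EP

namespace EP

def pp (α : ℝ) (r : ℕ) : ℝ := if r = 0 then -1 else sibuya α r

theorem pp_zero (α : ℝ) : pp α 0 = -1 := by simp [pp]

theorem pp_one (α : ℝ) : pp α 1 = α := by simp [pp, sibuya, risingFactorial]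

theorem pp_sib (α : ℝ) {r : ℕ} (hr : 1 ≤ r) : pp α r = sibuya α r := by
  simp [pp, show r ≠ 0 by omega]

theorem pp_succ (α : ℝ) (r : ℕ) : ((r : ℝ) + 1) * pp α (r + 1) = ((r : ℝ) - α) * pp α r := by
  rcases r with _ | r
  · simp [pp_zero, pp_one]
  · rw [pp_sib α (by omega), pp_sib α (by omega)]
    simp only [sibuya, Nat.add_sub_cancel, risingFactorial, Nat.factorial_succ (r+1)]
    have : ((r+1).factorial : ℝ) ≠ 0 := by positivity
    push_cast
    field_simp
    ring

theorem pp_pos {α : ℝ} (hα0 : 0 < α) (hα1 : α < 1) (r : ℕ) : 0 < pp α (r + 1) := by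
  induction r with
  | zero => simpa [pp_one] using hα0
  | succ r ih =>
    have h := pp_succ α (r + 1)
    push_cast at h
    have h2 : 0 < ((r:ℝ) + 1 - α) * pp α (r + 1) := by
      apply mul_pos _ ih
      have : (0:ℝ) ≤ r := by positivity
      linarith
    rw [← h] at h2
    exact pos_of_mul_pos_right h2 (by positivity)

/-- Moment factor. -/
def Tb (θ β : ℝ) (n j : ℕ) : ℝ :=
  (n.descFactorial j : ℝ) * risingFactorial β (n - j) / risingFactorial (θ + 1) (n - 1)

theorem rf_pos {a : ℝ} (ha : 0 < a) (n : ℕ) : 0 < risingFactorial a n := by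
  induction n with
  | zero => simp [risingFactorial]
  | succ n ih => simp only [risingFactorial]; positivity

theorem desc_rec (n j : ℕ) : (n+1).descFactorial (j+1) =
    n.descFactorial (j+1) + (j+1) * n.descFactorial j := by
  rw [Nat.succ_descFactorial_succ, Nat.descFactorial_succ]
  by_cases h : j ≤ n
  · have : n + 1 = (n - j) + (j + 1) := by omega
    conv_lhs => rw [this]
    ring
  · rw [Nat.descFactorial_eq_zero_iff_lt.2 (by omega : n < j)]; simp

theorem Tb_rec_zero {θ β : ℝ} (hθ : 0 < 1 + θ) (n : ℕ) (hn : 1 ≤ n) :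
    ((n:ℝ) + θ) * Tb θ β (n + 1) 0 = ((n:ℝ) + β) * Tb θ β n 0 := by
  obtain ⟨k, rfl⟩ : ∃ k, n = k + 1 := ⟨n - 1, by omega⟩
  have h1 := (rf_pos (a := θ + 1) (by linarith) k).ne'
  have h2 : (θ + 1 + (k:ℝ)) ≠ 0 := by
    have : (0:ℝ) ≤ k := by positivity
    linarith
  simp only [Tb, risingFactorial, Nat.add_sub_cancel, Nat.sub_zero, Nat.descFactorial_zero]
  push_cast
  field_simp
  ring

theorem Tb_rec_succ {θ β : ℝ} (hθ : 0 < 1 + θ) (n j : ℕ) (hn : 1 ≤ n) :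
    ((n:ℝ) + θ) * Tb θ β (n + 1) (j + 1) =
      ((n:ℝ) + β - (j + 1)) * Tb θ β n (j + 1) + (j + 1) * Tb θ β n j := by
  obtain ⟨k, rfl⟩ : ∃ k, n = k + 1 := ⟨n - 1, by omega⟩
  have h1 := (rf_pos (a := θ + 1) (by linarith) k).ne'
  have h2 : (θ + 1 + (k:ℝ)) ≠ 0 := by
    have : (0:ℝ) ≤ k := by positivity
    linarith
  have key : ((k+1+1).descFactorial (j+1) : ℝ) * risingFactorial β (k + 1 + 1 - (j + 1)) =
      ((k:ℝ) + 1 + β - (j + 1)) * ((k+1).descFactorial (j+1) * risingFactorial β (k + 1 - (j + 1)))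
      + (j + 1) * ((k+1).descFactorial j * risingFactorial β (k + 1 - j)) := by
    have e : k + 1 + 1 - (j + 1) = k + 1 - j := by omega
    rw [e, desc_rec]
    push_cast
    by_cases h : j ≤ k
    · have e2 : k + 1 - j = (k - j) + 1 := by omega
      rw [e2, risingFactorial, Nat.cast_sub h]
      ring
    · have : (k+1).descFactorial (j+1) = 0 := Nat.descFactorial_eq_zero_iff_lt.2 (by omega)
      rw [this]; push_cast; ring
  simp only [Tb, risingFactorial, Nat.add_sub_cancel]
  rw [key]
  push_cast
  field_simp
  ring

variable {α θ : ℝ} {m : ℕ → Measure (ℕ → ℝ)}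

theorem Chain.intg (h : Chain α θ m) {n : ℕ} (hn : 1 ≤ n) {E : Type*} [NormedAddCommGroup E]
    (f : (ℕ → ℝ) → E) : Integrable f (m n) := by
  have := h.prob n
  obtain ⟨S, hS, hSm⟩ := h.fin n hn
  exact integrable_of_fin hS hSm f

theorem exists_meas {X : Type*} [MeasurableSpace X] [MeasurableSingletonClass X] {U : Set X}
    (hU : U.Finite) (H : X → ℂ) : ∃ H' : X → ℂ, Measurable H' ∧ ∀ x ∈ U, H' x = H x := by
  classical
  refine ⟨fun x => ∑ u ∈ hU.toFinset, Set.indicator {u} (fun _ => H u) x, ?_, ?_⟩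
  · exact Finset.measurable_sum _ fun u _ => measurable_const.indicator (measurableSet_singleton u)
  · intro x hx
    beta_reduce
    rw [Finset.sum_eq_single_of_mem x (by simpa using hx)]
    · simp
    · intro u _ hu
      simp [Set.indicator, Ne.symm hu]

theorem Chain.stepC (h : Chain α θ m) {n : ℕ} (hn : 1 ≤ n) (H : (ℕ → ℝ) → ℂ) :
    ∫ b, H b ∂ m (n + 1) =
      ∫ b, ∑ r ∈ Finset.range (n + 1), (pw α θ n r b : ℂ) * H (TT r b) ∂ m n := by
  obtain ⟨S, hS, hSm⟩ := h.fin n hn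
  obtain ⟨S', hS', hSm'⟩ := h.fin (n+1) (by omega)
  have hU : (S' ∪ ⋃ r ∈ Finset.range (n+1), TT r '' S).Finite :=
    hS'.union (Set.Finite.biUnion (Finset.finite_toSet _) fun r _ => hS.image _)
  obtain ⟨H', hm, he⟩ := exists_meas hU H
  have := h.step n hn H' hm
  rw [integral_congr_ae (g := H'), this]
  · refine integral_congr_ae ?_
    filter_upwards [hSm] with b hb
    refine Finset.sum_congr rfl fun r hr => ?_
    rw [he]
    exact Or.inr (Set.mem_biUnion hr ⟨b, hb, rfl⟩)
  · filter_upwards [hSm'] with b hb using (he b (Or.inl hb)).symm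

theorem Chain.stepR (h : Chain α θ m) {n : ℕ} (hn : 1 ≤ n) (H : (ℕ → ℝ) → ℝ) :
    ∫ b, H b ∂ m (n + 1) =
      ∫ b, ∑ r ∈ Finset.range (n + 1), pw α θ n r b * H (TT r b) ∂ m n := by
  have := h.stepC hn (fun b => (H b : ℂ))
  rw [integral_complex_ofReal] at this
  have e : ∀ b, ∑ r ∈ Finset.range (n + 1), (pw α θ n r b : ℂ) * ((H (TT r b) : ℝ) : ℂ) =
    ((∑ r ∈ Finset.range (n + 1), pw α θ n r b * H (TT r b) : ℝ) : ℂ) := by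
    intro b; push_cast; rfl
  simp_rw [e] at this
  rw [integral_complex_ofReal] at this
  exact_mod_cast this

theorem Chain.driftR (h : Chain α θ m) {n : ℕ} (hn : 1 ≤ n) (H : (ℕ → ℝ) → ℝ) :
    ∫ b, H b ∂ m (n + 1) =
      ∫ b, H b ∂ m n +
      ∫ b, ∑ r ∈ Finset.range (n + 1), pw α θ n r b * (H (TT r b) - H b) ∂ m n := by
  rw [h.stepR hn, ← integral_add (h.intg hn _) (h.intg hn _)]
  refine integral_congr_ae ?_
  filter_upwards [h.good n hn] with b hb
  simp only [mul_sub]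
  rw [Finset.sum_sub_distrib, ← Finset.sum_mul, hb.tot]
  ring

def prv (α θ : ℝ) (n r : ℕ) (b : ℕ → ℝ) : ℝ :=
  match r with
  | 0 => 0
  | r + 1 => pw α θ n r b

theorem sum_pw_eq {n : ℕ} {b : ℕ → ℝ} (hb : Good α θ n b) (r : ℕ) :
    ∑ u ∈ Finset.range (n+1), pw α θ n u b * (if r = u then 1 else 0) = pw α θ n r b := by
  simp only [mul_ite, mul_one, mul_zero, Finset.sum_ite_eq, Finset.mem_range]
  split_ifs with h
  · rfl
  · rw [pw, hb.z r (by omega)]; simp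

theorem sum_pw_prv {n : ℕ} {b : ℕ → ℝ} (hb : Good α θ n b) (r : ℕ) :
    ∑ u ∈ Finset.range (n+1), pw α θ n u b * (if r = u + 1 then 1 else 0) = prv α θ n r b := by
  rcases r with _ | r
  · simp [prv]
  · simp only [Nat.add_right_cancel_iff, prv]
    exact sum_pw_eq hb r

theorem drift1 {n : ℕ} {b : ℕ → ℝ} (hb : Good α θ n b) (r : ℕ) :
    ∑ u ∈ Finset.range (n+1), pw α θ n u b * (TT u b r - b r) = prv α θ n r b - pw α θ n r b := by
  rw [← sum_pw_eq hb, ← sum_pw_prv hb, ← Finset.sum_sub_distrib]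
  refine Finset.sum_congr rfl fun u _ => ?_
  simp only [TT]; ring

theorem Chain.mom1 (h : Chain α θ m) (hα0 : 0 < α) (hα1 : α < 1) (hθ : 0 < α + θ) (n : ℕ)
    (hn : 1 ≤ n) : ∀ r, ∫ b, b r ∂ m n = pp α r * Tb θ (θ + α) n r / α := by
  induction n, hn using Nat.le_induction with
  | base =>
    intro r
    have := h.prob 1
    rw [integral_congr_ae (g := fun _ => if r = 0 then -(1 + θ / α) else if r = 1 then 1 else 0)]
    · simp only [integral_const, probReal_univ, one_smul]
      rcases r with _ | _ | r
      · simp [pp_zero, Tb, risingFactorial]; field_simp; ring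
      · simp [pp_one, Tb, risingFactorial]; field_simp
      · simp [Tb]
    · filter_upwards [h.init] with b hb using by rw [hb]
  | succ n hn ih =>
    intro r
    have hpos : (0:ℝ) < n + θ := by
      have : (1:ℝ) ≤ n := by exact_mod_cast hn
      linarith
    have e0 : ∫ b, ∑ u ∈ Finset.range (n+1), pw α θ n u b * (TT u b r - b r) ∂ m n =
        ∫ b, prv α θ n r b - pw α θ n r b ∂ m n := integral_congr_ae
      (by filter_upwards [h.good n hn] with b hb using drift1 hb r)
    rw [h.driftR hn, e0, integral_sub (h.intg hn _) (h.intg hn _)]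
    have e1 : ∀ r, ∫ b, pw α θ n r b ∂ m n = (r - α) / (n + θ) * (pp α r * Tb θ (θ + α) n r / α) := by
      intro r
      rw [← ih r, ← integral_const_mul]
      refine integral_congr_ae (Eventually.of_forall fun b => ?_)
      simp only [pw]; ring
    rw [e1 r, ih r]
    rcases r with _ | r
    · simp only [prv, integral_zero]
      have := Tb_rec_zero (θ := θ) (β := θ + α) (by linarith) n hn
      field_simp
      push_cast
      linear_combination (-pp α 0) * this
    · simp only [prv]
      rw [e1 r]
      have h1 := Tb_rec_succ (θ := θ) (β := θ + α) (by linarith) n r hn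
      have h2 := pp_succ α r
      field_simp
      push_cast
      linear_combination (-pp α (r+1)) * h1 - Tb θ (θ + α) n r * h2

def FF (r s : ℕ) (b : ℕ → ℝ) : ℝ := b r * b s - if r = s then b r else 0

theorem drift2 {n : ℕ} {b : ℕ → ℝ} (hb : Good α θ n b) (r s : ℕ) :
    ∑ u ∈ Finset.range (n+1), pw α θ n u b * (FF r s (TT u b) - FF r s b) =
      b r * (prv α θ n s b - pw α θ n s b) + b s * (prv α θ n r b - pw α θ n r b)
      + (if r = s then 2 * pw α θ n r b else 0) - (if s = r + 1 then pw α θ n r b else 0)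
      - (if r = s + 1 then pw α θ n s b else 0) := by
  have e : ∀ c : Prop, ∀ [Decidable c], ∀ x : ℝ, (if c then x else 0) = (if c then 1 else 0) * x := by
    intro c _ x; split_ifs <;> simp
  rw [e _ (2 * _), e (s = r + 1), e (r = s + 1)]
  rw [← sum_pw_eq hb, ← sum_pw_prv hb, ← sum_pw_eq hb, ← sum_pw_prv hb]
  simp only [← Finset.sum_sub_distrib, ← Finset.sum_add_distrib, Finset.mul_sum]
  refine Finset.sum_congr rfl fun u _ => ?_
  simp only [FF, TT]
  split_ifs <;> first | (exfalso; omega) | ring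

theorem drift2' (hα0 : 0 < α) (hθ : 0 < α + θ) {n : ℕ} (hpos : (0:ℝ) < n + θ) {b : ℕ → ℝ}
    (hb : Good α θ n b) (r s : ℕ) :
    ∑ u ∈ Finset.range (n+1), pw α θ n u b * (FF r s (TT u b) - FF r s b) =
      (1 / ((n:ℝ) + θ)) * ((if r = 0 then 0 else ((r:ℝ) - 1 - α) * FF (r - 1) s b)
        + (if s = 0 then 0 else ((s:ℝ) - 1 - α) * FF r (s - 1) b)
        - ((r:ℝ) + s - 2 * α) * FF r s b) := by
  rw [drift2 hb]
  rcases r with _ | r <;> rcases s with _ | s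
  · simp [prv, pw, FF]
    field_simp
    ring
  · by_cases h : s = 0
    · subst h
      simp [prv, pw, FF]
      field_simp
      ring
    · simp [prv, pw, FF, h, Ne.symm h]
      field_simp
      ring
  · by_cases h : r = 0
    · subst h
      simp [prv, pw, FF]
      field_simp
      ring
    · simp [prv, pw, FF, h, Ne.symm h]
      field_simp
      ring
  · simp only [prv, pw, FF, Nat.add_sub_cancel, Nat.succ_ne_zero, if_false,
      Nat.add_right_cancel_iff]
    by_cases h1 : r = s
    · subst h1
      simp
      field_simp
      ring
    · by_cases h2 : r = s + 1
      · subst h2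
        have q1 : ¬ (s = s + 1 + 1) := by omega
        have q2 : ¬ (s + 1 + 1 = s) := by omega
        simp [q1, q2]
        field_simp
        ring
      · by_cases h3 : s = r + 1
        · subst h3
          simp [h2]
          field_simp
          ring
        · have h3' : ¬ (r + 1 = s) := fun h => h3 h.symm
          simp [h1, h2, h3, h3']
          field_simp
          ring

theorem Chain.mom2 (h : Chain α θ m) (hα0 : 0 < α) (hα1 : α < 1) (hθ : 0 < α + θ) (n : ℕ)
    (hn : 1 ≤ n) : ∀ r s, ∫ b, FF r s b ∂ m n =
      (α + θ) / α ^ 2 * (pp α r * pp α s * Tb θ (θ + 2 * α) n (r + s)) := by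
  induction n, hn using Nat.le_induction with
  | base =>
    intro r s
    have := h.prob 1
    rw [integral_congr_ae (g := fun _ => FF r s
      (fun r => if r = 0 then -(1 + θ / α) else if r = 1 then 1 else 0))]
    · simp only [integral_const, probReal_univ, one_smul]
      rcases r with _ | _ | r <;> rcases s with _ | _ | s
      · simp [FF, pp_zero, Tb, risingFactorial]; field_simp; ring
      · simp [FF, pp_zero, pp_one, Tb, risingFactorial]; field_simp; ring
      · simp [FF, Tb]
      · simp [FF, pp_zero, pp_one, Tb, risingFactorial]; field_simp; ring
      · simp [FF, Tb]
      · have : Nat.descFactorial 1 (0 + 1 + (s + 1 + 1)) = 0 :=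
          Nat.descFactorial_eq_zero_iff_lt.2 (by omega)
        simp [FF, Tb, this]
      · simp [FF, Tb]
      · have : Nat.descFactorial 1 (r + 1 + 1 + (0 + 1)) = 0 :=
          Nat.descFactorial_eq_zero_iff_lt.2 (by omega)
        simp [FF, Tb, this]
      · have : Nat.descFactorial 1 (r + 1 + 1 + (s + 1 + 1)) = 0 :=
          Nat.descFactorial_eq_zero_iff_lt.2 (by omega)
        simp [FF, Tb, this]
    · filter_upwards [h.init] with b hb using by rw [hb]
  | succ n hn ih =>
    intro r s
    have hpos : (0:ℝ) < n + θ := by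
      have : (1:ℝ) ≤ n := by exact_mod_cast hn
      linarith
    have e0 : ∫ b, ∑ u ∈ Finset.range (n+1), pw α θ n u b * (FF r s (TT u b) - FF r s b) ∂ m n =
        ∫ b, (1 / ((n:ℝ) + θ)) * ((if r = 0 then 0 else ((r:ℝ) - 1 - α) * FF (r - 1) s b)
        + (if s = 0 then 0 else ((s:ℝ) - 1 - α) * FF r (s - 1) b)
        - ((r:ℝ) + s - 2 * α) * FF r s b) ∂ m n := integral_congr_ae
      (by filter_upwards [h.good n hn] with b hb using drift2' hα0 hθ hpos hb r s)
    rw [h.driftR hn, e0, integral_const_mul, integral_sub (h.intg hn _) (h.intg hn _),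
      integral_add (h.intg hn _) (h.intg hn _), integral_const_mul, ih]
    rcases r with _ | r <;> rcases s with _ | s
    · simp only [if_true, integral_zero, pp_zero]
      have := Tb_rec_zero (θ := θ) (β := θ + 2 * α) (by linarith) n hn
      simp only [Nat.add_zero]
      generalize Tb θ (θ + 2 * α) = T at this ⊢
      field_simp
      push_cast
      linear_combination (-(α+θ)) * this
    · simp only [if_true, integral_zero, Nat.succ_ne_zero, if_false, Nat.add_sub_cancel]
      rw [integral_const_mul, ih]
      have h1 := Tb_rec_succ (θ := θ) (β := θ + 2 * α) (by linarith) n s hn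
      have h2 := pp_succ α s
      simp only [Nat.zero_add]
      generalize Tb θ (θ + 2 * α) = T at h1 ⊢
      field_simp
      push_cast
      linear_combination (α + θ) * ((-pp α 0 * pp α (s+1)) * h1 - pp α 0 * T n s * h2)
    · simp only [if_true, integral_zero, Nat.succ_ne_zero, if_false, Nat.add_sub_cancel]
      rw [integral_const_mul, ih]
      have h1 := Tb_rec_succ (θ := θ) (β := θ + 2 * α) (by linarith) n r hn
      have h2 := pp_succ α r
      simp only [Nat.add_zero]
      generalize Tb θ (θ + 2 * α) = T at h1 ⊢
      field_simp
      push_cast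
      linear_combination (α + θ) * ((-pp α 0 * pp α (r+1)) * h1 - pp α 0 * T n r * h2)
    · simp only [Nat.succ_ne_zero, if_false, Nat.add_sub_cancel]
      rw [integral_const_mul, ih, integral_const_mul, ih]
      have h1 := Tb_rec_succ (θ := θ) (β := θ + 2 * α) (by linarith) n (r + 1 + s) hn
      have h2 := pp_succ α r
      have h3 := pp_succ α s
      have e1 : r + 1 + (s + 1) = r + 1 + s + 1 := by ring
      have e2 : r + (s + 1) = r + 1 + s := by ring
      rw [e1, e2]
      generalize Tb θ (θ + 2 * α) = T at h1 ⊢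
      field_simp
      push_cast at h1 ⊢
      linear_combination ((-pp α (r+1) * pp α (s+1)) * h1
        - pp α (s+1) * T n (r + 1 + s) * h2
        - pp α (r+1) * T n (r + 1 + s) * h3)

/-- centred count `D_r = B_r - p_r N` -/
def DD (α : ℝ) (r : ℕ) (b : ℕ → ℝ) : ℝ := b r + pp α r * b 0

theorem Chain.momD (h : Chain α θ m) (hα0 : 0 < α) (hα1 : α < 1) (hθ : 0 < α + θ) (n : ℕ)
    (hn : 1 ≤ n) (r : ℕ) : ∫ b, DD α (r+1) b ^ 2 ∂ m n =
      (α + θ) / α ^ 2 * pp α (r+1) ^ 2 * (Tb θ (θ + 2 * α) n (2 * (r + 1))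
        - 2 * Tb θ (θ + 2 * α) n (r + 1) + Tb θ (θ + 2 * α) n 0)
      + pp α (r+1) * Tb θ (θ + α) n (r+1) / α - pp α (r+1) ^ 2 * Tb θ (θ + α) n 0 / α := by
  have e : ∀ b, DD α (r+1) b ^ 2 = FF (r+1) (r+1) b + 2 * pp α (r+1) * FF 0 (r+1) b
      + pp α (r+1) ^ 2 * FF 0 0 b + b (r+1) + pp α (r+1) ^ 2 * b 0 := by
    intro b
    simp [DD, FF]; ring
  simp_rw [e]
  rw [integral_add (h.intg hn _) (h.intg hn _), integral_add (h.intg hn _) (h.intg hn _),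
    integral_add (h.intg hn _) (h.intg hn _), integral_add (h.intg hn _) (h.intg hn _),
    integral_const_mul, integral_const_mul, integral_const_mul, h.mom2 hα0 hα1 hθ n hn,
    h.mom2 hα0 hα1 hθ n hn, h.mom2 hα0 hα1 hθ n hn, h.mom1 hα0 hα1 hθ n hn,
    h.mom1 hα0 hα1 hθ n hn, pp_zero]
  simp only [Nat.zero_add, Nat.add_zero]
  rw [show r + 1 + (r + 1) = 2 * (r+1) by ring]
  ring

end EP

namespace EP

theorem rf_prod (s : ℝ) (n : ℕ) : risingFactorial s n = ∏ j ∈ Finset.range n, (s + j) := by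
  induction n with
  | zero => simp [risingFactorial]
  | succ n ih => rw [risingFactorial, ih, Finset.prod_range_succ]

theorem rf_gamma {s : ℝ} (hs : 0 < s) {n : ℕ} (hn : 1 ≤ n) :
    risingFactorial s n * (s + n) * Real.GammaSeq s n = (n:ℝ) ^ s * n.factorial := by
  have h : risingFactorial s n * (s + n) = ∏ j ∈ Finset.range (n+1), (s + j) := by
    rw [← rf_prod, risingFactorial]
  rw [h, Real.GammaSeq]
  have : (∏ j ∈ Finset.range (n+1), (s + (j:ℝ))) ≠ 0 := by
    rw [← rf_prod]; exact (rf_pos hs _).ne'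
  field_simp

theorem rf_le {s t : ℝ} (hs : 0 < s) (ht : 0 < t) :
    ∃ C > 0, ∀ n : ℕ, 1 ≤ n → risingFactorial s n ≤ C * (n:ℝ) ^ (s - t) * risingFactorial t n := by
  have h1 := Real.GammaSeq_tendsto_Gamma s
  have h2 := Real.GammaSeq_tendsto_Gamma t
  have hΓ : Real.Gamma s ≠ 0 := (Real.Gamma_pos_of_pos hs).ne'
  have h4 : ∀ x : ℝ, Tendsto (fun n : ℕ => x / n) atTop (𝓝 0) :=
    fun x => tendsto_const_div_atTop_nhds_zero_nat x
  have h5 : Tendsto (fun n : ℕ => Real.GammaSeq t n * (t / n + 1) / (Real.GammaSeq s n * (s / n + 1)))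
      atTop (𝓝 (Real.Gamma t * (0 + 1) / (Real.Gamma s * (0 + 1)))) := by
    refine Tendsto.div (h2.mul ((h4 t).add_const 1)) (h1.mul ((h4 s).add_const 1)) (by simpa using hΓ)
  obtain ⟨C, hC⟩ := h5.bddAbove_range
  refine ⟨max C 1, by positivity, fun n hn => ?_⟩
  have hn0 : (0:ℝ) < n := by exact_mod_cast hn
  have h6 := rf_gamma hs hn
  have h7 := rf_gamma ht hn
  have gs : 0 < Real.GammaSeq s n := by
    have : 0 < risingFactorial s n * (s + n) * Real.GammaSeq s n := by rw [h6]; positivity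
    exact pos_of_mul_pos_right this (mul_pos (rf_pos hs n) (by positivity)).le
  have gt : 0 < Real.GammaSeq t n := by
    have : 0 < risingFactorial t n * (t + n) * Real.GammaSeq t n := by rw [h7]; positivity
    exact pos_of_mul_pos_right this (mul_pos (rf_pos ht n) (by positivity)).le
  have h8 : Real.GammaSeq t n * (t / n + 1) / (Real.GammaSeq s n * (s / n + 1)) ≤ C := hC ⟨n, rfl⟩
  have h9 : risingFactorial s n = (Real.GammaSeq t n * (t / n + 1) / (Real.GammaSeq s n * (s / n + 1)))
      * (n:ℝ)^(s-t) * risingFactorial t n := by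
    rw [Real.rpow_sub hn0]
    have e1 : risingFactorial s n = (n:ℝ) ^ s * n.factorial / ((s + n) * Real.GammaSeq s n) := by
      rw [eq_div_iff (by positivity), ← h6]; ring
    have e2 : risingFactorial t n = (n:ℝ) ^ t * n.factorial / ((t + n) * Real.GammaSeq t n) := by
      rw [eq_div_iff (by positivity), ← h7]; ring
    rw [e1, e2]
    field_simp
  rw [h9]
  have := rf_pos ht n
  gcongr
  exact h8.trans (le_max_left _ _)

theorem Tb_nn {θ β : ℝ} (hθ : 0 < 1 + θ) (hβ : 0 < β) (n j : ℕ) : 0 ≤ Tb θ β n j := by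
  have h1 := rf_pos hβ (n - j)
  have h2 := rf_pos (a := θ + 1) (by linarith) (n - 1)
  unfold Tb; positivity

theorem Tb0_pos {θ β : ℝ} (hθ : 0 < 1 + θ) (hβ : 0 < β) (n : ℕ) : 0 < Tb θ β n 0 := by
  have h1 := rf_pos hβ (n - 0)
  have h2 := rf_pos (a := θ + 1) (by linarith) (n - 1)
  unfold Tb
  rw [Nat.descFactorial_zero]
  positivity

theorem Tb0_le {θ β : ℝ} (hθ : 0 < 1 + θ) (hβ : 0 < β) :
    ∃ C > 0, ∀ n : ℕ, 1 ≤ n → Tb θ β n 0 ≤ C * (n:ℝ) ^ (β - θ) := by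
  obtain ⟨C, hC, h⟩ := rf_le hβ (t := θ + 1) (by linarith)
  refine ⟨C * (1 + |θ|), by positivity, fun n hn => ?_⟩
  obtain ⟨k, rfl⟩ : ∃ k, n = k + 1 := ⟨n - 1, by omega⟩
  have h2 := rf_pos (a := θ + 1) (by linarith) k
  have h3 := h (k+1) hn
  simp only [Tb, Nat.descFactorial_zero, Nat.add_sub_cancel, Nat.sub_zero]
  rw [div_le_iff₀ h2, Nat.cast_one, one_mul]
  refine h3.trans ?_
  rw [risingFactorial]
  have hn0 : (0:ℝ) < ((k+1:ℕ):ℝ) := by positivity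
  have e : ((k+1:ℕ):ℝ) ^ (β - θ) = ((k+1:ℕ):ℝ) ^ (β - (θ + 1)) * ((k+1:ℕ):ℝ) := by
    rw [← Real.rpow_add_one hn0.ne']; congr 1; ring
  rw [e]
  have h4 : θ + 1 + k ≤ (1 + |θ|) * ((k+1:ℕ):ℝ) := by
    push_cast
    have := le_abs_self θ
    have := abs_nonneg θ
    have : (0:ℝ) ≤ k := by positivity
    nlinarith
  calc C * ((k+1:ℕ):ℝ) ^ (β - (θ+1)) * (risingFactorial (θ+1) k * (θ + 1 + k))
      ≤ C * ((k+1:ℕ):ℝ) ^ (β - (θ+1)) * (risingFactorial (θ+1) k * ((1 + |θ|) * ((k+1:ℕ):ℝ))) := by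
        gcongr
    _ = _ := by ring

theorem Tb_ratio {θ β : ℝ} (n j : ℕ) (hj : j < n) :
    Tb θ β n (j + 1) * (β + n - j - 1) = Tb θ β n j * (n - j) := by
  have e : n - j = (n - (j + 1)) + 1 := by omega
  unfold Tb
  rw [Nat.descFactorial_succ, e, risingFactorial, Nat.cast_mul, ← e, Nat.cast_sub hj.le,
    Nat.cast_sub (by omega : j + 1 ≤ n)]
  push_cast
  ring

theorem Tb_upper {θ β : ℝ} (hθ : 0 < 1 + θ) (hβ : 0 < β) (n j : ℕ) (hj : j ≤ n) :
    Tb θ β n j * (β + n - j) ≤ Tb θ β n 0 * (β + n) := by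
  induction j with
  | zero => simp
  | succ j ih =>
    have h1 := Tb_ratio (θ := θ) (β := β) n j (by omega)
    have h2 := ih (by omega)
    have h3 := Tb_nn hθ hβ n j
    push_cast
    nlinarith

theorem Tb_lower {θ β : ℝ} (hθ : 0 < 1 + θ) (hβ : 0 < β) (n j : ℕ) (hj : j ≤ n) :
    Tb θ β n 0 - Tb θ β n j ≤ Tb θ β n 0 * (j * β / (β + n - j)) := by
  have h0 := Tb0_pos hθ hβ n
  rcases le_total β 1 with hb | hb
  · have : Tb θ β n 0 ≤ Tb θ β n j := by
      induction j with
      | zero => simp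
      | succ j ih =>
        have h1 := Tb_ratio (θ := θ) (β := β) n j (by omega)
        refine (ih (by omega)).trans ?_
        have h3 := Tb_nn hθ hβ n j
        have h5 : ((j:ℝ)+1) ≤ n := by exact_mod_cast hj
        have h4 : 0 < β + n - j - 1 := by linarith
        by_contra hlt
        push Not at hlt
        nlinarith
    have h5 : (j:ℝ) ≤ n := by exact_mod_cast hj
    have : 0 ≤ Tb θ β n 0 * (j * β / (β + n - j)) := by
      have : 0 < β + n - j := by linarith
      positivity
    linarith
  · have hup : ∀ i ≤ n, Tb θ β n i ≤ Tb θ β n 0 := by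
      intro i hi
      induction i with
      | zero => simp
      | succ i ih =>
        have h1 := Tb_ratio (θ := θ) (β := β) n i (by omega)
        refine le_trans ?_ (ih (by omega))
        have h3 := Tb_nn hθ hβ n i
        have h5 : ((i:ℝ)+1) ≤ n := by exact_mod_cast hi
        have h4 : 0 < β + n - i - 1 := by linarith
        by_contra hlt
        push Not at hlt
        nlinarith
    induction j with
    | zero => simp
    | succ j ih =>
      have h1 := Tb_ratio (θ := θ) (β := β) n j (by omega)
      have h2 := ih (by omega)
      have h3 := hup j (by omega)
      have h5 : ((j:ℝ)+1) ≤ n := by exact_mod_cast hj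
      have h4 : 0 < β + n - j - 1 := by linarith
      have e1 : Tb θ β n (j+1) = Tb θ β n j * (n - j) / (β + n - j - 1) := by
        rw [eq_div_iff h4.ne', h1]
      have e2 : Tb θ β n j - Tb θ β n (j+1) = Tb θ β n j * (β - 1) / (β + n - j - 1) := by
        rw [e1]; field_simp; ring
      have e3 : Tb θ β n j * (β - 1) / (β + n - j - 1) ≤ Tb θ β n 0 * β / (β + n - j - 1) := by
        have := Tb_nn hθ hβ n j
        gcongr
        · linarith
      have e4 : (j:ℝ) * β / (β + n - j) ≤ j * β / (β + n - j - 1) :=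
        div_le_div_of_nonneg_left (by positivity) h4 (by linarith)
      calc Tb θ β n 0 - Tb θ β n (j+1) = (Tb θ β n 0 - Tb θ β n j) + (Tb θ β n j - Tb θ β n (j+1)) := by ring
        _ ≤ Tb θ β n 0 * (j * β / (β + n - j - 1)) + Tb θ β n 0 * β / (β + n - j - 1) := by
            refine add_le_add (h2.trans ?_) (e2.le.trans e3)
            gcongr
        _ = _ := by
            push_cast
            rw [show β + (n:ℝ) - (j + 1) = β + n - j - 1 by ring]
            ring

theorem Tb_tau {θ β : ℝ} (hθ : 0 < 1 + θ) (hβ : 0 < β) : ∃ C > 0, ∀ n j : ℕ, 1 ≤ n →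
    |Tb θ β n j - Tb θ β n 0| ≤ C * j * Tb θ β n 0 ∧
    |Tb θ β n j - Tb θ β n 0| ≤ C * (j ^ 2 / n) * Tb θ β n 0 := by
  set c := min β 1 with hc
  have hc0 : 0 < c := lt_min hβ one_pos
  have hcb : c ≤ β := min_le_left _ _
  have hc1 : c ≤ 1 := min_le_right _ _
  refine ⟨(1 + β) / c, by positivity, fun n j hn => ?_⟩
  have h0 := Tb0_pos hθ hβ n
  have hC : 1 ≤ (1 + β) / c := by rw [le_div_iff₀ hc0]; linarith
  have hn0 : (1:ℝ) ≤ n := by exact_mod_cast hn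
  rcases le_or_gt j n with hj | hj
  · have hj' : (j:ℝ) ≤ n := by exact_mod_cast hj
    have hd : 0 < β + n - j := by linarith
    have key : |Tb θ β n j - Tb θ β n 0| ≤ Tb θ β n 0 * ((1 + β) * (j / (β + n - j))) := by
      rw [abs_le]
      have h1 := Tb_upper hθ hβ n j hj
      have h2 := Tb_lower hθ hβ n j hj
      have hq : 0 ≤ (j:ℝ) / (β + n - j) := by positivity
      constructor
      · have : (j:ℝ) * β / (β + n - j) = β * (j / (β + n - j)) := by ring
        rw [this] at h2
        nlinarith
      · have h3 : Tb θ β n j ≤ Tb θ β n 0 * (1 + j / (β + n - j)) := by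
          have : 1 + (j:ℝ) / (β + n - j) = (β + n) / (β + n - j) := by field_simp; ring
          rw [this, ← mul_div_assoc, le_div_iff₀ hd]
          exact h1
        have : 0 ≤ Tb θ β n 0 * (β * (j / (β + n - j))) := by positivity
        nlinarith
    have k1 : (j:ℝ) / (β + n - j) ≤ j / c := by
      gcongr; linarith
    have k2 : (j:ℝ) / (β + n - j) ≤ (j^2 / n) / c := by
      rcases Nat.eq_zero_or_pos j with rfl | hjp
      · simp
      · have hjp' : (1:ℝ) ≤ j := by exact_mod_cast hjp
        rw [div_div, div_le_div_iff₀ hd (by positivity)]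
        have : (n:ℝ) * c ≤ j * (β + n - j) := by
          have a1 : c * (1 + n - j) ≤ β + n - j := by nlinarith
          have a2 : (n:ℝ) ≤ j * (1 + n - j) := by nlinarith
          nlinarith
        nlinarith
    constructor
    · refine key.trans ?_
      calc Tb θ β n 0 * ((1 + β) * (j / (β + n - j))) ≤ Tb θ β n 0 * ((1 + β) * (j / c)) := by gcongr
        _ = _ := by ring
    · refine key.trans ?_
      calc Tb θ β n 0 * ((1 + β) * (j / (β + n - j))) ≤ Tb θ β n 0 * ((1 + β) * ((j^2 / n) / c)) := by gcongr
        _ = _ := by ring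
  · have hz : Tb θ β n j = 0 := by
      unfold Tb; rw [Nat.descFactorial_eq_zero_iff_lt.2 hj]; simp
    have hj' : (n:ℝ) ≤ j := by exact_mod_cast hj.le
    rw [hz, zero_sub, abs_neg, abs_of_pos h0]
    have a1 : 1 ≤ (1 + β) / c * j := by nlinarith
    have a2 : 1 ≤ (1 + β) / c * (j^2 / n) := by
      have : 1 ≤ (j:ℝ)^2 / n := by rw [le_div_iff₀ (by linarith)]; nlinarith
      nlinarith
    constructor <;> nlinarith

theorem Tb_tau_delta {θ β δ : ℝ} (hθ : 0 < 1 + θ) (hβ : 0 < β) (hδ0 : 0 ≤ δ) (hδ1 : δ ≤ 1) :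
    ∃ C > 0, ∀ n j : ℕ, 1 ≤ n →
    |Tb θ β n j - Tb θ β n 0| ≤ C * ((j:ℝ) ^ (1 + δ) * (n:ℝ) ^ (-δ)) * Tb θ β n 0 := by
  obtain ⟨C, hC, h⟩ := Tb_tau hθ hβ
  refine ⟨C, hC, fun n j hn => ?_⟩
  obtain ⟨h1, h2⟩ := h n j hn
  have h0 := Tb0_pos hθ hβ n
  have hn0 : (0:ℝ) < n := by exact_mod_cast hn
  rcases Nat.eq_zero_or_pos j with rfl | hj
  · simp only [sub_self, abs_zero]; positivity
  have hj0 : (0:ℝ) < j := by exact_mod_cast hj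
  have e : (j:ℝ) ^ (1 + δ) * (n:ℝ) ^ (-δ) = j * (j / n : ℝ) ^ δ := by
    rw [Real.rpow_add hj0, Real.rpow_one, Real.rpow_neg hn0.le, Real.div_rpow hj0.le hn0.le]
    ring
  rw [e]
  rcases le_total (j:ℝ) n with hle | hle
  · refine h2.trans ?_
    have hx : (j / n : ℝ) ≤ 1 := by rw [div_le_one hn0]; exact hle
    have : (j / n : ℝ) ≤ (j / n : ℝ) ^ δ := by
      conv_lhs => rw [← Real.rpow_one (j / n : ℝ)]
      exact Real.rpow_le_rpow_of_exponent_ge (by positivity) hx hδ1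
    have : (j:ℝ)^2 / n ≤ j * (j / n : ℝ)^δ := by
      rw [pow_two, mul_div_assoc]; gcongr
    gcongr
  · refine h1.trans ?_
    have hx : 1 ≤ (j / n : ℝ) := by rw [one_le_div hn0]; exact hle
    have := Real.one_le_rpow hx hδ0
    have : (j:ℝ) ≤ j * (j / n : ℝ)^δ := by nlinarith
    gcongr

theorem pp_le {α : ℝ} (hα0 : 0 < α) (hα1 : α < 1) (r : ℕ) :
    pp α (r + 1) ≤ α * ((r:ℝ) + 1) ^ (-(1 + α)) := by
  induction r with
  | zero => simp [pp_one]
  | succ r ih =>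
    have h := pp_succ α (r + 1)
    have hr : (0:ℝ) ≤ r := by positivity
    have e1 : pp α (r + 1 + 1) = pp α (r + 1) * (1 - (1 + α) / (r + 2)) := by
      push_cast at h
      field_simp
      linarith
    have hb := one_add_mul_self_le_rpow_one_add (s := -1 / ((r:ℝ) + 2)) (p := 1 + α)
      (by rw [le_div_iff₀ (by positivity)]; linarith) (by linarith)
    have e2 : 1 + -1 / ((r:ℝ) + 2) = (r + 1) / (r + 2) := by field_simp; ring
    rw [e2] at hb
    have e3 : (1 - (1 + α) / ((r:ℝ) + 2)) ≤ ((r + 1) / (r + 2) : ℝ) ^ (1 + α) := by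
      refine le_trans (le_of_eq ?_) hb; ring
    have hp := pp_pos hα0 hα1 r
    rw [e1]
    calc pp α (r+1) * (1 - (1 + α) / (r + 2)) ≤ pp α (r+1) * ((r + 1) / (r + 2) : ℝ) ^ (1 + α) := by
          gcongr
      _ ≤ α * ((r:ℝ) + 1) ^ (-(1 + α)) * ((r + 1) / (r + 2) : ℝ) ^ (1 + α) := by gcongr
      _ = _ := by
        rw [Real.div_rpow (by positivity) (by positivity), Real.rpow_neg (by positivity),
          Real.rpow_neg (by positivity)]
        have : ((r:ℝ) + 1) ^ (1 + α) ≠ 0 := by positivity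
        push_cast
        rw [show (r:ℝ) + 1 + 1 = r + 2 by ring]
        field_simp

theorem pp_psum (α : ℝ) (hα0 : 0 < α) (M : ℕ) :
    ∑ r ∈ Finset.range M, pp α (r + 1) = 1 - (M + 1) * pp α (M + 1) / α := by
  induction M with
  | zero => simp [pp_one, hα0.ne']
  | succ M ih =>
    rw [Finset.sum_range_succ, ih]
    have h := pp_succ α (M + 1)
    push_cast at h ⊢
    field_simp
    linear_combination h

theorem pp_hasSum {α : ℝ} (hα0 : 0 < α) (hα1 : α < 1) : HasSum (fun r => pp α (r + 1)) 1 := by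
  rw [hasSum_iff_tendsto_nat_of_nonneg fun r => (pp_pos hα0 hα1 r).le]
  simp_rw [pp_psum α hα0]
  have h : Tendsto (fun M : ℕ => ((M:ℝ) + 1) * pp α (M + 1) / α) atTop (𝓝 0) := by
    have h1 : Tendsto (fun M : ℕ => ((M:ℝ) + 1) ^ (-α)) atTop (𝓝 0) :=
      (tendsto_rpow_neg_atTop hα0).comp
        (tendsto_atTop_add_const_right _ _ tendsto_natCast_atTop_atTop)
    refine squeeze_zero (fun M => ?_) (fun M => ?_) h1
    · have := pp_pos hα0 hα1 M; positivity
    · have := pp_le hα0 hα1 M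
      have hM : (0:ℝ) < (M:ℝ) + 1 := by positivity
      rw [div_le_iff₀ hα0]
      calc ((M:ℝ) + 1) * pp α (M + 1) ≤ ((M:ℝ) + 1) * (α * ((M:ℝ) + 1) ^ (-(1 + α))) := by gcongr
        _ = _ := by
          rw [show -(1 + α) = -α - 1 by ring, Real.rpow_sub_one hM.ne']
          field_simp
  simpa using h.const_sub 1

theorem pp_sq_summable {α δ : ℝ} (hα0 : 0 < α) (hα1 : α < 1) (hδ : δ < 2 * α) :
    Summable fun r : ℕ => pp α (r + 1) ^ 2 * ((r:ℝ) + 1) ^ (1 + δ) := by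
  have h1 : Summable fun r : ℕ => α^2 * (((r + 1 : ℕ) : ℝ) ^ (-(1 + 2 * α - δ))) := by
    refine Summable.mul_left _ ?_
    exact (summable_nat_add_iff (f := fun n : ℕ => (n:ℝ) ^ (-(1 + 2 * α - δ))) 1).2
      (Real.summable_nat_rpow.2 (by linarith))
  refine Summable.of_nonneg_of_le (fun r => by positivity) (fun r => ?_) h1
  have hp := pp_pos hα0 hα1 r
  have hr : (0:ℝ) < (r:ℝ) + 1 := by positivity
  calc pp α (r + 1) ^ 2 * ((r:ℝ) + 1) ^ (1 + δ)
      ≤ (α * ((r:ℝ) + 1) ^ (-(1 + α))) ^ 2 * ((r:ℝ) + 1) ^ (1 + δ) := by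
        gcongr; exact pp_le hα0 hα1 r
    _ = _ := by
      push_cast
      rw [mul_pow, ← Real.rpow_natCast (((r:ℝ) + 1) ^ (-(1 + α))) 2, ← Real.rpow_mul hr.le, mul_assoc,
        ← Real.rpow_add hr]
      congr 2
      push_cast; ring

end EP

namespace EP

variable {α θ : ℝ} {m : ℕ → Measure (ℕ → ℝ)}

theorem Good.psum_le {n : ℕ} {b : ℕ → ℝ} (hg : Good α θ n b) (M : ℕ) :
    ∑ r ∈ Finset.range M, b (r + 1) ≤ -b 0 - θ / α := by
  obtain ⟨k, hk1, hk2, h0, hs⟩ := hg.k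
  rw [h0, show -(-((k:ℝ) + θ/α)) - θ/α = k by ring, ← hs]
  have h1 : ∑ r ∈ Finset.range M, b (r + 1) ≤ ∑ r ∈ Finset.range (max M n), b (r + 1) :=
    Finset.sum_le_sum_of_subset_of_nonneg (Finset.range_mono (le_max_left _ _))
      fun i _ _ => hg.nn _ (by omega)
  refine h1.trans (le_of_eq ?_)
  have h2 : ∑ r ∈ Finset.range (max M n), b (r + 1) = ∑ r ∈ Finset.range n, b (r + 1) := by
    symm
    refine Finset.sum_subset (Finset.range_mono (le_max_right _ _)) fun i _ hi => ?_
    exact hg.z _ (by simp at hi; omega)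
  rw [h2, Finset.range_eq_Ico, Finset.sum_Ico_add' (fun r => b r) 0 n 1]
  rfl

theorem Chain.L0 (h : Chain α θ m) (hα0 : 0 < α) (hα1 : α < 1) (hθ : 0 < α + θ) {δ : ℝ}
    (hδ0 : 0 ≤ δ) (hδ1 : δ ≤ 1) :
    ∃ C > 0, ∀ n : ℕ, 1 ≤ n → ∀ r : ℕ, ∫ b, DD α (r+1) b ^ 2 ∂ m n ≤
      C * (n:ℝ) ^ (2 * α - δ) * (pp α (r + 1) ^ 2 * ((r:ℝ) + 1) ^ (1 + δ)) + ∫ b, b (r + 1) ∂ m n := by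
  have ht : 0 < 1 + θ := by linarith
  obtain ⟨C1, hC1, h1⟩ := Tb_tau_delta (β := θ + 2 * α) ht (by linarith) hδ0 hδ1
  obtain ⟨C2, hC2, h2⟩ := Tb0_le (β := θ + 2 * α) ht (by linarith)
  refine ⟨(α + θ) / α ^ 2 * (C1 * 6 * C2), by positivity, fun n hn r => ?_⟩
  rw [h.momD hα0 hα1 hθ n hn r, h.mom1 hα0 hα1 hθ n hn (r + 1)]
  have hn0 : (0:ℝ) < n := by exact_mod_cast hn
  have a1 := (abs_le.1 (h1 n (2 * (r + 1)) hn)).2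
  have a2 := (abs_le.1 (h1 n (r + 1) hn)).1
  have a3 := h2 n hn
  have hT1 := (Tb0_pos (θ := θ) (β := θ + α) ht (by linarith) n).le
  have hT2 := (Tb0_pos (θ := θ) (β := θ + 2 * α) ht (by linarith) n).le
  have a4 : (((2 * (r + 1) : ℕ)) : ℝ) ^ (1 + δ) ≤ 4 * ((r + 1 : ℕ) : ℝ) ^ (1 + δ) := by
    rw [Nat.cast_mul, Real.mul_rpow (by positivity) (by positivity)]
    gcongr
    calc ((2:ℕ):ℝ) ^ (1 + δ) ≤ (2:ℝ) ^ (2:ℝ) := by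
          push_cast
          exact Real.rpow_le_rpow_of_exponent_le (by norm_num) (by linarith)
      _ = 4 := by norm_num
  have e : (n:ℝ) ^ (2 * α - δ) = (n:ℝ) ^ (-δ) * (n:ℝ) ^ (θ + 2 * α - θ) := by
    rw [← Real.rpow_add hn0]; congr 1; ring
  have key : Tb θ (θ + 2 * α) n (2 * (r + 1)) - 2 * Tb θ (θ + 2 * α) n (r + 1) + Tb θ (θ + 2 * α) n 0
      ≤ C1 * 6 * C2 * (n:ℝ) ^ (2 * α - δ) * ((r:ℝ) + 1) ^ (1 + δ) := by
    have e' : (((r + 1 : ℕ)) : ℝ) = (r:ℝ) + 1 := by push_cast; ring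
    rw [e'] at a2 a4
    set T0 := Tb θ (θ + 2 * α) n 0
    set X := ((r:ℝ) + 1) ^ (1 + δ) with hX
    have hX0 : 0 ≤ X := by positivity
    have hn1 : 0 ≤ (n:ℝ) ^ (-δ) := by positivity
    have a5 : C1 * ((((2 * (r + 1) : ℕ)) : ℝ) ^ (1 + δ) * (n:ℝ) ^ (-δ)) * T0 ≤
        C1 * ((4 * X) * (n:ℝ) ^ (-δ)) * T0 := by gcongr
    have a6 : C1 * (6 * X * (n:ℝ) ^ (-δ)) * T0 ≤ C1 * (6 * X * (n:ℝ) ^ (-δ)) * (C2 * (n:ℝ) ^ (θ + 2 * α - θ)) := by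
      gcongr
    rw [e]
    calc _ ≤ C1 * (6 * X * (n:ℝ) ^ (-δ)) * T0 := by nlinarith
      _ ≤ _ := a6
      _ = _ := by ring
  have hp := pp_pos hα0 hα1 r
  have : 0 ≤ pp α (r + 1) ^ 2 * Tb θ (θ + α) n 0 / α := by positivity
  have k2 : (α + θ) / α ^ 2 * pp α (r + 1) ^ 2 * (Tb θ (θ + 2 * α) n (2 * (r + 1)) - 2 * Tb θ (θ + 2 * α) n (r + 1) + Tb θ (θ + 2 * α) n 0)
     ≤ (α + θ) / α ^ 2 * pp α (r + 1) ^ 2 * (C1 * 6 * C2 * (n:ℝ) ^ (2 * α - δ) * ((r:ℝ) + 1) ^ (1 + δ)) := by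
    gcongr
  calc _ ≤ (α + θ) / α ^ 2 * pp α (r + 1) ^ 2 * (C1 * 6 * C2 * (n:ℝ) ^ (2 * α - δ) * ((r:ℝ) + 1) ^ (1 + δ))
        + pp α (r + 1) * Tb θ (θ + α) n (r + 1) / α := by linarith
    _ = _ := by ring

theorem one_le_npow (hα0 : 0 < α) {n : ℕ} (hn : 1 ≤ n) : 1 ≤ (n:ℝ) ^ α :=
  Real.one_le_rpow (by exact_mod_cast hn) hα0.le

theorem Chain.tailB (h : Chain α θ m) (hα0 : 0 < α) (hα1 : α < 1) (hθ : 0 < α + θ) :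
    ∃ C > 0, ∀ R n : ℕ, 1 ≤ n → ∀ M : ℕ, ∑ r ∈ Finset.Ico R M, ∫ b, b (r + 1) ∂ m n ≤
      C * (n:ℝ) ^ α * ((1 - ∑ r ∈ Finset.range R, pp α (r + 1)) +
        (∑ r ∈ Finset.range R, pp α (r + 1) * ((r:ℝ) + 1) ^ 2) / n) + |θ / α| := by
  have ht : 0 < 1 + θ := by linarith
  obtain ⟨C1, hC1, h1⟩ := Tb_tau (θ := θ) (β := θ + α) ht (by linarith)
  obtain ⟨C2, hC2, h2⟩ := Tb0_le (θ := θ) (β := θ + α) ht (by linarith)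
  refine ⟨C2 / α * (1 + C1), by positivity, fun R n hn M => ?_⟩
  have := h.prob n
  have hint : ∀ f : (ℕ → ℝ) → ℝ, Integrable f (m n) := fun f => h.intg hn f
  have hT := (Tb0_pos (θ := θ) (β := θ + α) ht (by linarith) n).le
  have hn0 : (0:ℝ) < n := by exact_mod_cast hn
  have s1 : ∑ r ∈ Finset.Ico R M, ∫ b, b (r + 1) ∂ m n ≤
      ∫ b, (-b 0 - θ / α - ∑ r ∈ Finset.range R, b (r + 1)) ∂ m n := by
    rw [← integral_finsetSum _ fun i _ => hint _]
    refine integral_mono_ae (hint _) (hint _) ?_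
    filter_upwards [h.good n hn] with b hg
    have := hg.psum_le (max R M)
    have e : ∑ r ∈ Finset.Ico R M, b (r + 1) ≤ ∑ r ∈ Finset.Ico R (max R M), b (r + 1) :=
      Finset.sum_le_sum_of_subset_of_nonneg (Finset.Ico_subset_Ico le_rfl (le_max_right _ _))
        fun i _ _ => hg.nn _ (by omega)
    have e2 := Finset.sum_range_add_sum_Ico (fun r => b (r + 1)) (le_max_left R M)
    linarith
  have s2 : ∫ b, (-b 0 - θ / α - ∑ r ∈ Finset.range R, b (r + 1)) ∂ m n =
      Tb θ (θ + α) n 0 / α - θ / α - ∑ r ∈ Finset.range R, pp α (r + 1) * Tb θ (θ + α) n (r + 1) / α := by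
    rw [integral_sub (hint _) (hint _), integral_sub (hint _) (hint _), integral_neg,
      integral_finsetSum _ fun i _ => hint _, h.mom1 hα0 hα1 hθ n hn 0, pp_zero]
    simp only [h.mom1 hα0 hα1 hθ n hn, integral_const, probReal_univ, one_smul]
    ring
  have s3 : ∀ r ∈ Finset.range R, pp α (r + 1) * (Tb θ (θ + α) n 0 / α) -
      C1 * (pp α (r + 1) * ((r:ℝ) + 1) ^ 2) / n * (Tb θ (θ + α) n 0 / α)
      ≤ pp α (r + 1) * Tb θ (θ + α) n (r + 1) / α := by
    intro r _
    have a2 := (abs_le.1 (h1 n (r + 1) hn).2).1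
    have hp := pp_pos hα0 hα1 r
    have : pp α (r + 1) / α * (Tb θ (θ + α) n 0 - (C1 * ((r + 1 : ℕ) ^ 2 / n) * Tb θ (θ + α) n 0)) ≤
      pp α (r + 1) / α * Tb θ (θ + α) n (r + 1) := by gcongr; linarith
    push_cast at this
    calc _ = _ := ?_
      _ ≤ _ := this
      _ = _ := by ring
    ring
  have s4 := Finset.sum_le_sum s3
  rw [Finset.sum_sub_distrib, ← Finset.sum_mul, ← Finset.sum_mul, ← Finset.sum_div, ← Finset.mul_sum] at s4
  set P := ∑ r ∈ Finset.range R, pp α (r + 1)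
  set P2 := ∑ r ∈ Finset.range R, pp α (r + 1) * ((r:ℝ) + 1) ^ 2 with hP2
  have hP : P ≤ 1 := by
    exact sum_le_hasSum _ (fun i _ => (pp_pos hα0 hα1 i).le) (pp_hasSum hα0 hα1)
  have hP2' : 0 ≤ P2 := Finset.sum_nonneg fun i _ => by have := pp_pos hα0 hα1 i; positivity
  have b1 := h2 n hn
  rw [show θ + α - θ = α by ring] at b1
  have b2 := neg_le_abs (θ / α)
  have hx : 0 ≤ P2 / n := by positivity
  have b3 : (1 - P) + C1 * P2 / n ≤ (1 + C1) * ((1 - P) + P2 / n) := by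
    have : 0 ≤ C1 * (1 - P) := mul_nonneg hC1.le (by linarith)
    rw [mul_div_assoc]; nlinarith
  have b4 : Tb θ (θ + α) n 0 / α * ((1 - P) + C1 * P2 / n) ≤
      (C2 * (n:ℝ)^α) / α * ((1 + C1) * ((1 - P) + P2 / n)) := by
    have : 0 ≤ (1 - P) + C1 * P2 / n := add_nonneg (by linarith) (by positivity)
    gcongr
  calc _ ≤ _ := s1
    _ = _ := s2
    _ ≤ Tb θ (θ + α) n 0 / α * ((1 - P) + C1 * P2 / n) + |θ / α| := by linarith
    _ ≤ (C2 * (n:ℝ)^α) / α * ((1 + C1) * ((1 - P) + P2 / n)) + |θ / α| := by linarith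
    _ = _ := by ring

theorem exists_delta (hα0 : 0 < α) (hα1 : α < 1) : ∃ δ, 0 ≤ δ ∧ δ ≤ 1 ∧ α < δ ∧ δ < 2 * α :=
  ⟨min 1 (3 * α / 2), by positivity, min_le_left _ _, lt_min hα1 (by linarith),
    (min_le_right _ _).trans_lt (by linarith)⟩

theorem Chain.L1 (h : Chain α θ m) (hα0 : 0 < α) (hα1 : α < 1) (hθ : 0 < α + θ) :
    ∃ C > 0, ∀ n : ℕ, 1 ≤ n → ∀ r : ℕ, ∫ b, DD α (r+1) b ^ 2 ∂ m n ≤ C * (n:ℝ) ^ α := by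
  obtain ⟨δ, d0, d1, d2, d3⟩ := exists_delta hα0 hα1
  obtain ⟨C, hC, h1⟩ := h.L0 hα0 hα1 hθ d0 d1
  obtain ⟨C', hC', h2⟩ := h.tailB hα0 hα1 hθ
  have hs := pp_sq_summable hα0 hα1 d3
  set S := ∑' r : ℕ, pp α (r + 1) ^ 2 * ((r:ℝ) + 1) ^ (1 + δ) with hS
  have hS0 : 0 ≤ S := tsum_nonneg fun r => by positivity
  refine ⟨C * S + C' + |θ / α|, by positivity, fun n hn r => ?_⟩
  have hn1 := one_le_npow hα0 hn
  have e1 := h1 n hn r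
  have e2 := h2 0 n hn (r + 1)
  have e3 : pp α (r + 1) ^ 2 * ((r:ℝ) + 1) ^ (1 + δ) ≤ S := hs.le_tsum r fun _ _ => by positivity
  have e4 : (n:ℝ) ^ (2 * α - δ) ≤ (n:ℝ) ^ α :=
    Real.rpow_le_rpow_of_exponent_le (by exact_mod_cast hn) (by linarith)
  have e5 : ∫ b, b (r + 1) ∂ m n ≤ ∑ r ∈ Finset.Ico 0 (r + 1), ∫ b, b (r + 1) ∂ m n := by
    refine Finset.single_le_sum (f := fun r => ∫ b, b (r + 1) ∂ m n) (fun i _ => ?_) (by simp)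
    refine integral_nonneg_of_ae ?_
    filter_upwards [h.good n hn] with b hg using hg.nn _ (by omega)
  simp only [Finset.range_zero, Finset.sum_empty, sub_zero, zero_div, add_zero, mul_one] at e2
  have e6 : C * (n:ℝ) ^ (2 * α - δ) * (pp α (r + 1) ^ 2 * ((r:ℝ) + 1) ^ (1 + δ)) ≤ C * (n:ℝ)^α * S := by
    gcongr
  have := abs_nonneg (θ / α)
  nlinarith

theorem Chain.L2 (h : Chain α θ m) (hα0 : 0 < α) (hα1 : α < 1) (hθ : 0 < α + θ) {ε : ℝ} (hε : 0 < ε) :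
    ∃ R : ℕ, ∀ᶠ n : ℕ in atTop, ∀ M : ℕ,
      ∑ r ∈ Finset.Ico R M, ∫ b, DD α (r+1) b ^ 2 ∂ m n ≤ ε * (n:ℝ) ^ α := by
  obtain ⟨δ, d0, d1, d2, d3⟩ := exists_delta hα0 hα1
  obtain ⟨C, hC, h1⟩ := h.L0 hα0 hα1 hθ d0 d1
  obtain ⟨C', hC', h2⟩ := h.tailB hα0 hα1 hθ
  have hs := pp_sq_summable hα0 hα1 d3
  set S := ∑' r : ℕ, pp α (r + 1) ^ 2 * ((r:ℝ) + 1) ^ (1 + δ) with hS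
  have hS0 : 0 ≤ S := tsum_nonneg fun r => by positivity
  obtain ⟨R, hR⟩ : ∃ R, C' * (1 - ∑ r ∈ Finset.range R, pp α (r + 1)) < ε := by
    have := ((pp_hasSum hα0 hα1).tendsto_sum_nat.const_sub 1).const_mul C'
    rw [sub_self, mul_zero] at this
    exact (this.eventually (gt_mem_nhds hε)).exists
  set P := ∑ r ∈ Finset.range R, pp α (r + 1)
  set P2 := ∑ r ∈ Finset.range R, pp α (r + 1) * ((r:ℝ) + 1) ^ 2 with hP2
  refine ⟨R, ?_⟩
  have lim : Tendsto (fun n : ℕ => C * S * (n:ℝ)^(-(δ - α)) + C' * ((1 - P) + P2 / n) + |θ / α| * (n:ℝ)^(-α))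
      atTop (𝓝 (C * S * 0 + C' * ((1 - P) + 0) + |θ / α| * 0)) := by
    have t1 : ∀ x : ℝ, 0 < x → Tendsto (fun n : ℕ => (n:ℝ)^(-x)) atTop (𝓝 0) := fun x hx =>
      (tendsto_rpow_neg_atTop hx).comp tendsto_natCast_atTop_atTop
    refine (((t1 _ (by linarith)).const_mul _).add (Tendsto.const_mul _
      (Tendsto.const_add _ (tendsto_const_div_atTop_nhds_zero_nat _)))).add ((t1 _ hα0).const_mul _)
  have lim' := lim.eventually_lt_const (u := ε) (by simpa using hR)
  filter_upwards [lim', eventually_ge_atTop 1] with n hlt hn M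
  have hn0 : (0:ℝ) < n := by exact_mod_cast hn
  have e0 : ∑ r ∈ Finset.Ico R M, ∫ b, DD α (r+1) b ^ 2 ∂ m n ≤
      ∑ r ∈ Finset.Ico R M, (C * (n:ℝ) ^ (2 * α - δ) * (pp α (r + 1) ^ 2 * ((r:ℝ) + 1) ^ (1 + δ)) + ∫ b, b (r + 1) ∂ m n) :=
    Finset.sum_le_sum fun r _ => h1 n hn r
  rw [Finset.sum_add_distrib, ← Finset.mul_sum] at e0
  have e1 := h2 R n hn M
  have e2 : ∑ r ∈ Finset.Ico R M, pp α (r + 1) ^ 2 * ((r:ℝ) + 1) ^ (1 + δ) ≤ S :=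
    hs.sum_le_tsum _ fun _ _ => by positivity
  have e3 : C * (n:ℝ) ^ (2 * α - δ) * ∑ r ∈ Finset.Ico R M, pp α (r + 1) ^ 2 * ((r:ℝ) + 1) ^ (1 + δ) ≤
    C * (n:ℝ) ^ (2 * α - δ) * S := by gcongr
  have e4 : (n:ℝ) ^ (2 * α - δ) = (n:ℝ)^(-(δ - α)) * (n:ℝ)^α := by
    rw [← Real.rpow_add hn0]; congr 1; ring
  have e5 : |θ / α| = |θ / α| * (n:ℝ)^(-α) * (n:ℝ)^α := by
    rw [mul_assoc, ← Real.rpow_add hn0]; simp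
  have hna : 0 < (n:ℝ)^α := by positivity
  calc _ ≤ C * (n:ℝ) ^ (2 * α - δ) * S + (C' * (n:ℝ)^α * ((1 - P) + P2 / n) + |θ / α|) := by linarith
    _ = (C * S * (n:ℝ)^(-(δ - α)) + C' * ((1 - P) + P2 / n) + |θ / α| * (n:ℝ)^(-α)) * (n:ℝ)^α := by
      rw [e4]; nth_rw 1 [e5]; ring
    _ ≤ _ := by gcongr

end EP

namespace EP

variable {α θ : ℝ} {m : ℕ → Measure (ℕ → ℝ)}

theorem c0_pos (hα0 : 0 < α) (hθ : 0 < α + θ) : 0 < 1 + θ / α := by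
  have : 0 < (α + θ) / α := by positivity
  rwa [add_div, div_self hα0.ne'] at this

theorem Good.N_ge {n : ℕ} {b : ℕ → ℝ} (hg : Good α θ n b) : 1 + θ / α ≤ -b 0 := by
  obtain ⟨k, hk1, hk2, h0, hs⟩ := hg.k
  have : (1:ℝ) ≤ k := by exact_mod_cast hk1
  rw [h0]; linarith

theorem Good.pw_nn {n : ℕ} {b : ℕ → ℝ} (hg : Good α θ n b) (hα0 : 0 < α) (hα1 : α < 1) (hθ : 0 < α + θ)
    (hn : 1 ≤ n) (r : ℕ) : 0 ≤ pw α θ n r b := by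
  have hn0 : (1:ℝ) ≤ n := by exact_mod_cast hn
  have : 0 < (n:ℝ) + θ := by linarith
  unfold pw
  rcases Nat.eq_zero_or_pos r with rfl | hr
  · have := hg.N_ge
    have := c0_pos hα0 hθ
    refine div_nonneg ?_ (by linarith)
    push_cast
    nlinarith
  · have h1 : (1:ℝ) ≤ r := by exact_mod_cast hr
    have := hg.nn r hr
    refine div_nonneg (mul_nonneg (by linarith) this) (by linarith)

theorem Good.hN {n : ℕ} {b : ℕ → ℝ} (hg : Good α θ n b) (hα0 : 0 < α) (hα1 : α < 1) (hθ : 0 < α + θ)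
    (hn : 1 ≤ n) : -b 0 / ((n:ℝ) + θ) ≤ 1 / α := by
  have h1 : pw α θ n 0 b ≤ 1 := by
    rw [← hg.tot]
    exact Finset.single_le_sum (f := fun r => pw α θ n r b) (fun i _ => hg.pw_nn hα0 hα1 hθ hn i) (by simp)
  unfold pw at h1
  rw [le_div_iff₀ hα0]
  push_cast at h1
  calc _ = _ := ?_
    _ ≤ _ := h1
  ring

theorem pp_le_one (hα0 : 0 < α) (hα1 : α < 1) (r : ℕ) : pp α (r + 1) ≤ 1 := by
  have := (pp_hasSum hα0 hα1).summable.le_tsum r fun i _ => (pp_pos hα0 hα1 i).le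
  rwa [(pp_hasSum hα0 hα1).tsum_eq] at this

theorem Good.D_le {n : ℕ} {b : ℕ → ℝ} (hg : Good α θ n b) (hα0 : 0 < α) (hα1 : α < 1) (hθ : 0 < α + θ)
    (r : ℕ) : |DD α (r + 1) b| ≤ (1 + |θ / α| / (1 + θ / α)) * (-b 0) := by
  have h1 := hg.psum_le (r + 1)
  have h2 : b (r + 1) ≤ ∑ i ∈ Finset.range (r + 1), b (i + 1) :=
    Finset.single_le_sum (f := fun i => b (i + 1)) (fun i _ => hg.nn _ (by omega)) (by simp)
  have h3 := hg.nn (r + 1) (by omega)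
  have h4 := hg.N_ge
  have h5 := c0_pos hα0 hθ
  have h6 := pp_pos hα0 hα1 r
  have h7 := pp_le_one hα0 hα1 r
  have h8 : |θ / α| ≤ |θ / α| / (1 + θ / α) * (-b 0) := by
    rw [div_mul_eq_mul_div, le_div_iff₀ h5]
    gcongr
  have := neg_le_abs (θ / α)
  unfold DD
  have hN0 : 0 < -b 0 := by linarith
  have h9 : pp α (r + 1) * (-b 0) ≤ 1 * (-b 0) := by gcongr
  have h10 : 0 ≤ pp α (r + 1) * (-b 0) := by positivity
  have := abs_nonneg (θ / α)
  rw [abs_le]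
  constructor <;> linarith

theorem gamma_lower {q N : ℝ} (hq0 : 0 < q) (hq1 : q < 1) (hN : q < N) :
    N ^ (-q) ≤ Real.Gamma (N - q) / Real.Gamma N := by
  have hN0 : 0 < N := by linarith
  have hx : 0 < N - q := by linarith
  have g1 := Real.Gamma_pos_of_pos hN0
  have g2 := Real.Gamma_pos_of_pos hx
  have h := Real.Gamma_mul_add_mul_le_rpow_Gamma_mul_rpow_Gamma (s := N - q) (t := N - q + 1)
    (a := 1 - q) (b := q) hx (by linarith) (by linarith) hq0 (by ring)
  rw [show (1 - q) * (N - q) + q * (N - q + 1) = N by ring, Real.Gamma_add_one hx.ne',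
    Real.mul_rpow hx.le g2.le, mul_left_comm, ← Real.rpow_add g2,
    show 1 - q + q = 1 by ring, Real.rpow_one] at h
  rw [le_div_iff₀ g1, Real.rpow_neg hN0.le, inv_mul_le_iff₀ (by positivity)]
  refine h.trans ?_
  gcongr
  linarith

theorem Chain.Nneg (h : Chain α θ m) (hα0 : 0 < α) (hα1 : α < 1) (hθ : 0 < α + θ) :
    ∃ q, 0 < q ∧ q ≤ 1 / 2 ∧ ∃ C > 0, ∀ n : ℕ, 1 ≤ n →
      ∫ b, (-b 0) ^ (-q) ∂ m n ≤ C * (n:ℝ) ^ (-(q * α)) := by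
  have hc := c0_pos hα0 hθ
  obtain ⟨q, hq0, hq1, hq2⟩ : ∃ q : ℝ, 0 < q ∧ q ≤ 1 / 2 ∧ q ≤ (1 + θ / α) / 2 :=
    ⟨min (1/2) ((1 + θ / α) / 2), by positivity, min_le_left _ _, min_le_right _ _⟩
  refine ⟨q, hq0, hq1, ?_⟩
  have hqa : q * α ≤ (α + θ) / 2 := by
    calc q * α ≤ (1 + θ / α) / 2 * α := by gcongr
      _ = _ := by field_simp
  set β := θ + 1 - q * α with hβ
  have hβ0 : 0 < β := by rw [hβ]; linarith
  set H : (ℕ → ℝ) → ℝ := fun b => Real.Gamma (-b 0 - q) / Real.Gamma (-b 0) with hH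
  have hrec : ∀ n : ℕ, 1 ≤ n → ∫ b, H b ∂ m (n + 1) = (1 - q * α / (n + θ)) * (∫ b, H b ∂ m n) := by
    intro n hn
    rw [h.driftR hn H]
    have : ∫ b, ∑ r ∈ Finset.range (n + 1), pw α θ n r b * (H (TT r b) - H b) ∂ m n =
        ∫ b, (-(q * α / (n + θ))) * H b ∂ m n := by
      refine integral_congr_ae ?_
      filter_upwards [h.good n hn] with b hg
      rw [Finset.sum_range_succ', Finset.sum_eq_zero]
      · have hN := hg.N_ge
        have hN0 : 0 < -b 0 := by linarith
        have hNq : 0 < -b 0 - q := by linarith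
        have e1 : TT 0 b 0 = b 0 - 1 := by simp [TT]
        have hn0 : (1:ℝ) ≤ n := by exact_mod_cast hn
        have hnt : (n:ℝ) + θ ≠ 0 := by linarith
        have g1 := (Real.Gamma_pos_of_pos hN0).ne'
        simp only [hH, e1]
        rw [show -(b 0 - 1) - q = (-b 0 - q) + 1 by ring, show -(b 0 - 1) = -b 0 + 1 by ring,
          Real.Gamma_add_one hNq.ne', Real.Gamma_add_one hN0.ne', pw]
        have hb0 : b 0 ≠ 0 := by linarith
        generalize Real.Gamma (-b 0) = x at *
        generalize Real.Gamma (-b 0 - q) = y at *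
        push_cast
        field_simp
        ring
      · intro r _
        have : TT (r + 1) b 0 = b 0 := by simp [TT]
        simp [hH, this]
    rw [this, integral_const_mul]; ring
  have hH0 : ∀ n, 1 ≤ n → ∀ᵐ b ∂ m n, (-b 0) ^ (-q) ≤ H b := by
    intro n hn
    filter_upwards [h.good n hn] with b hg
    exact gamma_lower hq0 (by linarith) (by linarith [hg.N_ge])
  set E1 := ∫ b, H b ∂ m 1 with hE1
  have hE10 : 0 ≤ E1 := by
    refine integral_nonneg_of_ae ?_
    filter_upwards [hH0 1 le_rfl, h.good 1 le_rfl] with b hb hg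
    refine le_trans ?_ hb
    have := hg.N_ge
    exact Real.rpow_nonneg (by linarith) _
  have form : ∀ k : ℕ, (∫ b, H b ∂ m (k + 1)) * risingFactorial (θ + 1) k = E1 * risingFactorial β k := by
    intro k
    induction k with
    | zero => simp [risingFactorial, hE1]
    | succ k ih =>
      rw [hrec (k + 1) (by omega), risingFactorial, risingFactorial]
      have : ((k + 1 : ℕ) : ℝ) + θ ≠ 0 := by push_cast; have : (0:ℝ) ≤ k := by positivity
                                             linarith
      have e : (1 - q * α / (((k + 1 : ℕ) : ℝ) + θ)) * (θ + 1 + k) = β + k := by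
        push_cast at this ⊢
        rw [show θ + 1 + (k:ℝ) = k + 1 + θ by ring, sub_mul, div_mul_cancel₀ _ this]
        rw [hβ]; ring
      calc _ = ((∫ b, H b ∂ m (k + 1)) * risingFactorial (θ + 1) k) * ((1 - q * α / (((k + 1 : ℕ) : ℝ) + θ)) * (θ + 1 + k)) := by ring
        _ = _ := by rw [ih, e]; ring
  obtain ⟨C, hC, hT⟩ := Tb0_le (θ := θ) (β := β) (by linarith) hβ0
  set c := min β 1 with hcdef
  have hcpos : 0 < c := lt_min hβ0 one_pos
  refine ⟨(E1 + 1) * C / c, by positivity, fun n hn => ?_⟩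
  have b1 : ∫ b, (-b 0) ^ (-q) ∂ m n ≤ ∫ b, H b ∂ m n :=
    integral_mono_ae (h.intg hn _) (h.intg hn _) (hH0 n hn)
  refine b1.trans ?_
  obtain ⟨k, rfl⟩ : ∃ k, n = k + 1 := ⟨n - 1, by omega⟩
  have b2 := form k
  have b3 := hT (k + 1) hn
  have r1 := rf_pos (a := θ + 1) (by linarith) k
  have r2 := rf_pos hβ0 k
  simp only [Tb, Nat.descFactorial_zero, Nat.add_sub_cancel, Nat.sub_zero, Nat.cast_one, one_mul] at b3
  rw [risingFactorial, div_le_iff₀ r1, show β - θ = -(q * α) + 1 by rw [hβ]; ring,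
    Real.rpow_add_one (by positivity)] at b3
  have hk : (0:ℝ) ≤ k := by positivity
  have b4 : c * ((k + 1 : ℕ) : ℝ) ≤ β + k := by
    push_cast
    have : c ≤ β := min_le_left _ _
    have : c ≤ 1 := min_le_right _ _
    nlinarith
  set X := ((k + 1 : ℕ) : ℝ) ^ (-(q * α)) with hX
  have hX0 : 0 ≤ X := by positivity
  have hy : (0:ℝ) < ((k + 1 : ℕ) : ℝ) := by positivity
  have b5 : risingFactorial β k * c ≤ C * X * risingFactorial (θ + 1) k := by
    have : risingFactorial β k * (c * ((k + 1 : ℕ) : ℝ)) ≤ C * (X * ((k + 1 : ℕ) : ℝ)) * risingFactorial (θ + 1) k :=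
      le_trans (by gcongr) b3
    refine le_of_mul_le_mul_right ?_ hy
    linarith
  have b6 : (∫ b, H b ∂ m (k + 1)) = E1 * risingFactorial β k / risingFactorial (θ + 1) k := by
    rw [← b2]; field_simp
  rw [b6, div_le_iff₀ r1]
  calc E1 * risingFactorial β k = E1 / c * (risingFactorial β k * c) := by field_simp
    _ ≤ (E1 + 1) / c * (C * X * risingFactorial (θ + 1) k) := by gcongr; linarith
    _ = _ := by ring

theorem npow_tendsto {x : ℝ} (hx : 0 < x) : Tendsto (fun n : ℕ => (n:ℝ)^(-x)) atTop (𝓝 0) :=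
  (tendsto_rpow_neg_atTop hx).comp tendsto_natCast_atTop_atTop

theorem Chain.tend_half (h : Chain α θ m) (hα0 : 0 < α) (hα1 : α < 1) (hθ : 0 < α + θ) :
    Tendsto (fun n => ∫ b, (√(-b 0))⁻¹ ∂ m n) atTop (𝓝 0) := by
  obtain ⟨q, hq0, hq1, C, hC, hb⟩ := h.Nneg hα0 hα1 hθ
  have hc := c0_pos hα0 hθ
  have lim := (npow_tendsto (mul_pos hq0 hα0)).const_mul ((1 + θ/α) ^ (-(1/2 - q)) * C)
  rw [mul_zero] at lim
  refine squeeze_zero' (Eventually.of_forall fun n => integral_nonneg fun b => by positivity) ?_ lim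
  filter_upwards [eventually_ge_atTop 1] with n hn
  have : ∫ b, (√(-b 0))⁻¹ ∂ m n ≤ ∫ b, (1 + θ/α) ^ (-(1/2 - q)) * (-b 0) ^ (-q) ∂ m n := by
    refine integral_mono_ae (h.intg hn _) (h.intg hn _) ?_
    filter_upwards [h.good n hn] with b hg
    have hN := hg.N_ge
    have hN0 : 0 < -b 0 := by linarith
    rw [Real.sqrt_eq_rpow, ← Real.rpow_neg hN0.le,
      show -(1/2 : ℝ) = -(1/2 - q) + -q by ring, Real.rpow_add hN0]
    gcongr ?_ * _
    exact Real.rpow_le_rpow_of_nonpos hc hN (by linarith)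
  rw [integral_const_mul] at this
  refine this.trans ?_
  rw [mul_assoc]
  gcongr
  exact hb n hn

theorem Chain.tend_D (h : Chain α θ m) (hα0 : 0 < α) (hα1 : α < 1) (hθ : 0 < α + θ) (r : ℕ) :
    Tendsto (fun n => ∫ b, |DD α (r + 1) b| / (-b 0) ∂ m n) atTop (𝓝 0) := by
  obtain ⟨q, hq0, hq1, C, hC, hb⟩ := h.Nneg hα0 hα1 hθ
  obtain ⟨C1, hC1, h1⟩ := h.L1 hα0 hα1 hθ
  have hc := c0_pos hα0 hθ
  set C2 := 1 + |θ / α| / (1 + θ / α) with hC2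
  have hC20 : 0 < C2 := by positivity
  have lim : Tendsto (fun n : ℕ => (C1 + 1) / 2 * (n:ℝ)^(-(α/4)) + C2 * C * (n:ℝ)^(-(q*α/4))) atTop (𝓝 0) := by
    have := ((npow_tendsto (x := α/4) (by positivity)).const_mul ((C1+1)/2)).add
      ((npow_tendsto (x := q * α/4) (by positivity)).const_mul (C2 * C))
    simpa using this
  refine squeeze_zero' ?_ ?_ lim
  · filter_upwards [eventually_ge_atTop 1] with n hn
    refine integral_nonneg_of_ae ?_
    filter_upwards [h.good n hn] with b hg
    have := hg.N_ge
    exact div_nonneg (abs_nonneg _) (by linarith)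
  filter_upwards [eventually_ge_atTop 1] with n hn
  have hn0 : (0:ℝ) < n := by exact_mod_cast hn
  have := h.prob n
  have b1 : ∫ b, |DD α (r + 1) b| / (-b 0) ∂ m n ≤
     ∫ b, ((DD α (r + 1) b ^ 2 * (n:ℝ)^(-(α/2)) + (n:ℝ)^(α/2)) / 2 * (n:ℝ)^(-(3*α/4)) +
       C2 * (n:ℝ)^(3*α/4*q) * (-b 0)^(-q)) ∂ m n := by
    refine integral_mono_ae (h.intg hn _) (h.intg hn _) ?_
    filter_upwards [h.good n hn] with b hg
    have hN := hg.N_ge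
    have hN0 : 0 < -b 0 := by linarith
    have hD := hg.D_le hα0 hα1 hθ r
    have hxx : 0 < (n:ℝ)^(α/2) := by positivity
    have am : |DD α (r + 1) b| ≤ (DD α (r + 1) b ^ 2 * (n:ℝ)^(-(α/2)) + (n:ℝ)^(α/2)) / 2 := by
      rw [Real.rpow_neg hn0.le, ← sq_abs (DD α (r + 1) b)]
      generalize (n:ℝ)^(α/2) = x at *
      generalize |DD α (r + 1) b| = y at *
      have : y^2 * x⁻¹ + x - 2 * y = (y - x)^2 * x⁻¹ := by field_simp; ring
      have : 0 ≤ (y - x)^2 * x⁻¹ := by positivity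
      linarith
    rcases le_total ((n:ℝ)^(3*α/4)) (-b 0) with hle | hle
    · have p1 : |DD α (r + 1) b| / (-b 0) ≤ (DD α (r + 1) b ^ 2 * (n:ℝ)^(-(α/2)) + (n:ℝ)^(α/2)) / 2 * (n:ℝ)^(-(3*α/4)) := by
        rw [Real.rpow_neg hn0.le (3*α/4), div_eq_mul_inv]
        gcongr
      have p2 : 0 ≤ C2 * (n:ℝ)^(3*α/4*q) * (-b 0)^(-q) := by positivity
      linarith
    · have p1 : |DD α (r + 1) b| / (-b 0) ≤ C2 * 1 := by
        rw [mul_one, div_le_iff₀ hN0]; exact hD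
      have p2 : 1 ≤ (n:ℝ)^(3*α/4*q) * (-b 0)^(-q) := by
        rw [Real.rpow_mul hn0.le, Real.rpow_neg hN0.le, ← div_eq_mul_inv, one_le_div (by positivity)]
        gcongr
      have p3 : C2 * 1 ≤ C2 * ((n:ℝ)^(3*α/4*q) * (-b 0)^(-q)) := by gcongr
      have p4 : 0 ≤ (DD α (r + 1) b ^ 2 * (n:ℝ)^(-(α/2)) + (n:ℝ)^(α/2)) / 2 * (n:ℝ)^(-(3*α/4)) := by positivity
      linarith
  refine b1.trans ?_
  rw [integral_add (h.intg hn _) (h.intg hn _), integral_mul_const, integral_div,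
    integral_add (h.intg hn _) (h.intg hn _), integral_mul_const, integral_const_mul]
  simp only [integral_const, probReal_univ, one_smul]
  have e1 := h1 n hn r
  have e2 := hb n hn
  have f1 : (n:ℝ)^α * (n:ℝ)^(-(α/2)) = (n:ℝ)^(α/2) := by
    rw [← Real.rpow_add hn0]; congr 1; ring
  have f2 : (n:ℝ)^(α/2) * (n:ℝ)^(-(3*α/4)) = (n:ℝ)^(-(α/4)) := by
    rw [← Real.rpow_add hn0]; congr 1; ring
  have f3 : (n:ℝ)^(3*α/4*q) * (n:ℝ)^(-(q*α)) = (n:ℝ)^(-(q*α/4)) := by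
    rw [← Real.rpow_add hn0]; congr 1; ring
  calc _ ≤ (C1 * (n:ℝ)^α * (n:ℝ)^(-(α/2)) + (n:ℝ)^(α/2)) / 2 * (n:ℝ)^(-(3*α/4)) +
        C2 * (n:ℝ)^(3*α/4*q) * (C * (n:ℝ)^(-(q*α))) := by gcongr
    _ = (C1 * ((n:ℝ)^α * (n:ℝ)^(-(α/2))) + (n:ℝ)^(α/2)) / 2 * (n:ℝ)^(-(3*α/4)) +
        C2 * C * ((n:ℝ)^(3*α/4*q) * (n:ℝ)^(-(q*α))) := by ring
    _ = (C1 + 1) / 2 * ((n:ℝ)^(α/2) * (n:ℝ)^(-(3*α/4))) + C2 * C * (n:ℝ)^(-(q*α/4)) := by rw [f1, f3]; ring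
    _ = _ := by rw [f2]

end EP

namespace EP

variable {α θ : ℝ} {m : ℕ → Measure (ℕ → ℝ)}

def YY (R : ℕ) (t b : ℕ → ℝ) : ℝ := ∑ r ∈ Finset.range (R + 1), t r * b r
def VV (α : ℝ) (R : ℕ) (t : ℕ → ℝ) : ℝ := ∑ r ∈ Finset.range (R + 1), pp α r * t r ^ 2
def WW (α : ℝ) (R : ℕ) (t : ℕ → ℝ) : ℝ :=
  ∑ r ∈ Finset.range (R + 1), ((r:ℝ) - α) * pp α r * (t (r + 1) - t r) ^ 2
def mv (α h : ℝ) (t : ℕ → ℝ) : ℕ → ℝ :=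
  fun r => h * (((r:ℝ) - α) * (t (r + 1) - t r) - α / 2 * t r)
def SS (α : ℝ) (R : ℕ) (b : ℕ → ℝ) : ℝ := ∑ r ∈ Finset.range R, |DD α (r + 1) b|

structure Adm (α : ℝ) (R : ℕ) (t : ℕ → ℝ) : Prop where
  z : ∀ r, R < r → t r = 0
  c : ∑ r ∈ Finset.range (R + 1), pp α r * t r = 0

theorem YY_TT {R : ℕ} {t : ℕ → ℝ} (hz : ∀ r, R < r → t r = 0) (r : ℕ) (b : ℕ → ℝ) :
    YY R t (TT r b) = YY R t b + (t (r + 1) - t r) := by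
  simp only [YY, TT, mul_sub, mul_add, Finset.sum_sub_distrib, Finset.sum_add_distrib, mul_ite, mul_one,
    mul_zero, Finset.sum_ite_eq', Finset.mem_range]
  have e1 : (if r + 1 < R + 1 then t (r + 1) else 0) = t (r + 1) := by
    split_ifs with h
    · rfl
    · exact (hz _ (by omega)).symm
  have e2 : (if r < R + 1 then t r else 0) = t r := by
    split_ifs with h
    · rfl
    · exact (hz _ (by omega)).symm
  rw [e1, e2]; ring

theorem Adm.YY_D {R : ℕ} {t : ℕ → ℝ} (h : Adm α R t) (b : ℕ → ℝ) :
    YY R t b = ∑ r ∈ Finset.range R, t (r + 1) * DD α (r + 1) b := by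
  have hc := h.c
  rw [Finset.sum_range_succ', pp_zero] at hc
  rw [YY, Finset.sum_range_succ']
  have : t 0 = ∑ r ∈ Finset.range R, pp α (r + 1) * t (r + 1) := by linarith
  rw [this, Finset.sum_mul, ← Finset.sum_add_distrib]
  refine Finset.sum_congr rfl fun r _ => ?_
  unfold DD; ring

theorem Adm.YY_le {R : ℕ} {t : ℕ → ℝ} (h : Adm α R t) (b : ℕ → ℝ) {A : ℝ} (hA : ∀ r, |t r| ≤ A) :
    |YY R t b| ≤ A * SS α R b := by
  rw [h.YY_D b, SS, Finset.mul_sum]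
  refine (Finset.abs_sum_le_sum_abs _ _).trans (Finset.sum_le_sum fun r _ => ?_)
  rw [abs_mul]
  gcongr
  exact hA _

theorem YY_add (R : ℕ) (t u b : ℕ → ℝ) : YY R (t + u) b = YY R t b + YY R u b := by
  simp [YY, add_mul, Finset.sum_add_distrib]

theorem shift_sum {R : ℕ} {f : ℕ → ℝ} (hf : f (R + 1) = 0) :
    ∑ r ∈ Finset.range (R + 1), ((r:ℝ) - α) * pp α r * (f (r + 1) - f r) =
      α * ∑ r ∈ Finset.range (R + 1), pp α r * f r := by
  have h1 : ∑ r ∈ Finset.range (R + 1), ((r:ℝ) - α) * pp α r * f (r + 1) =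
      ∑ r ∈ Finset.range (R + 1), (r:ℝ) * pp α r * f r := by
    have e : ∑ r ∈ Finset.range (R + 1), ((r:ℝ) - α) * pp α r * f (r + 1) =
        ∑ r ∈ Finset.range (R + 1), (((r + 1 : ℕ):ℝ)) * pp α (r + 1) * f (r + 1) := by
      refine Finset.sum_congr rfl fun r _ => ?_
      have := pp_succ α r
      push_cast
      rw [this]
    rw [e, Finset.sum_range_succ, hf, mul_zero, add_zero, Finset.sum_range_succ']
    simp
  simp only [mul_sub, Finset.sum_sub_distrib]
  rw [h1, ← Finset.sum_sub_distrib, Finset.mul_sum]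
  refine Finset.sum_congr rfl fun r _ => ?_
  ring

theorem Adm.mv {R : ℕ} {t : ℕ → ℝ} (ht : Adm α R t) (h : ℝ) : Adm α R (mv α h t) := by
  refine ⟨fun r hr => ?_, ?_⟩
  · simp [EP.mv, ht.z r hr, ht.z (r + 1) (by omega)]
  · have h1 := shift_sum (α := α) (ht.z (R + 1) (by omega))
    rw [ht.c, mul_zero] at h1
    have : ∀ r, pp α r * EP.mv α h t r = h * (((r:ℝ) - α) * pp α r * (t (r + 1) - t r)) - h * α / 2 * (pp α r * t r) := by
      intro r; unfold EP.mv; ring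
    simp only [this, Finset.sum_sub_distrib, ← Finset.mul_sum, h1, ht.c]
    ring

theorem Adm.add {R : ℕ} {t u : ℕ → ℝ} (ht : Adm α R t) (hu : Adm α R u) : Adm α R (t + u) := by
  refine ⟨fun r hr => by simp [ht.z r hr, hu.z r hr], ?_⟩
  simp only [Pi.add_apply, mul_add, Finset.sum_add_distrib, ht.c, hu.c, add_zero]

theorem Adm.VV_mv {R : ℕ} {t : ℕ → ℝ} (ht : Adm α R t) (h : ℝ) :
    VV α R (t + EP.mv α h t) = VV α R t - h * WW α R t +
      ∑ r ∈ Finset.range (R + 1), pp α r * EP.mv α h t r ^ 2 := by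
  have h1 := shift_sum (α := α) (f := fun r => t r ^ 2) (R := R) (by simp [ht.z (R + 1) (by omega)])
  have h2 : ∑ r ∈ Finset.range (R + 1), ((r:ℝ) - α) * pp α r * (t (r + 1) ^ 2 - t r ^ 2) =
     WW α R t + ∑ r ∈ Finset.range (R + 1), 2 * (((r:ℝ) - α) * pp α r * (t r * (t (r + 1) - t r))) := by
    rw [WW, ← Finset.sum_add_distrib]
    refine Finset.sum_congr rfl fun r _ => ?_
    ring
  have h3 : VV α R (t + EP.mv α h t) = VV α R t + ∑ r ∈ Finset.range (R + 1), pp α r * EP.mv α h t r ^ 2 +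
      (h * ∑ r ∈ Finset.range (R + 1), 2 * (((r:ℝ) - α) * pp α r * (t r * (t (r + 1) - t r)))
       - h * (α * VV α R t)) := by
    simp only [VV, Finset.mul_sum, ← Finset.sum_sub_distrib, ← Finset.sum_add_distrib]
    refine Finset.sum_congr rfl fun r _ => ?_
    simp only [Pi.add_apply, EP.mv]
    ring
  rw [h2] at h1
  rw [h3]
  have : α * VV α R t = α * ∑ r ∈ Finset.range (R + 1), pp α r * t r ^ 2 := rfl
  rw [this, ← h1]
  ring

theorem Adm.t0_le {R : ℕ} {t : ℕ → ℝ} (ht : Adm α R t) (hα0 : 0 < α) (hα1 : α < 1) {A : ℝ}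
    (hA : ∀ r, |t (r + 1)| ≤ A) : ∀ r, |t r| ≤ A := by
  have hA0 : 0 ≤ A := (abs_nonneg _).trans (hA 0)
  intro r
  rcases r with _ | r
  · have hc := ht.c
    rw [Finset.sum_range_succ', pp_zero] at hc
    have : t 0 = ∑ r ∈ Finset.range R, pp α (r + 1) * t (r + 1) := by linarith
    rw [this]
    calc _ ≤ ∑ r ∈ Finset.range R, pp α (r + 1) * A := by
          refine (Finset.abs_sum_le_sum_abs _ _).trans (Finset.sum_le_sum fun r _ => ?_)
          have := pp_pos hα0 hα1 r
          rw [abs_mul, abs_of_pos this]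
          gcongr
          exact hA r
      _ = (∑ r ∈ Finset.range R, pp α (r + 1)) * A := by rw [Finset.sum_mul]
      _ ≤ 1 * A := by
          gcongr
          exact sum_le_hasSum _ (fun i _ => (pp_pos hα0 hα1 i).le) (pp_hasSum hα0 hα1)
      _ = A := one_mul A
  · exact hA r

theorem Adm.contr {R : ℕ} {t : ℕ → ℝ} (ht : Adm α R t) (hα0 : 0 < α) (hα1 : α < 1) {A h : ℝ}
    (hA : ∀ r, |t r| ≤ A) (hh : 0 ≤ h) (hR : h * R ≤ 1) (hh1 : h ≤ 1) :
    ∀ r, |(t + EP.mv α h t) r| ≤ (1 - α / 2 * h) * A := by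
  have hA0 : 0 ≤ A := (abs_nonneg _).trans (hA 0)
  refine (ht.add (ht.mv h)).t0_le hα0 hα1 fun r => ?_
  have e0 : 0 ≤ (1 - α / 2 * h) * A := mul_nonneg (by nlinarith) hA0
  rcases le_or_gt (r + 1) R with hr | hr
  · have hr' : (r:ℝ) + 1 ≤ R := by exact_mod_cast hr
    have e : (t + EP.mv α h t) (r + 1) = (1 - h * ((r:ℝ) + 1 - α) - α / 2 * h) * t (r + 1) +
        h * ((r:ℝ) + 1 - α) * t (r + 1 + 1) := by
      simp only [Pi.add_apply, EP.mv]; push_cast; ring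
    have hr0 : (0:ℝ) ≤ r := by positivity
    have c1 : 0 ≤ h * ((r:ℝ) + 1 - α) := mul_nonneg hh (by linarith)
    have c2 : 0 ≤ 1 - h * ((r:ℝ) + 1 - α) - α / 2 * h := by nlinarith
    rw [e]
    refine (abs_add_le _ _).trans ?_
    rw [abs_mul, abs_mul, abs_of_nonneg c1, abs_of_nonneg c2]
    have := hA (r + 1)
    have := hA (r + 1 + 1)
    nlinarith
  · rw [(ht.add (ht.mv h)).z _ hr, abs_zero]; exact e0

theorem mv_le {R : ℕ} {t : ℕ → ℝ} (hz : ∀ r, R < r → t r = 0) (hα0 : 0 < α) (hα1 : α < 1) {A h : ℝ}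
    (hA : ∀ r, |t r| ≤ A) (hh : 0 ≤ h) (r : ℕ) : |EP.mv α h t r| ≤ (2 * R + 3) * (h * A) := by
  have hA0 : 0 ≤ A := (abs_nonneg _).trans (hA 0)
  rcases le_or_gt r R with hr | hr
  · have hr' : (r:ℝ) ≤ R := by exact_mod_cast hr
    have h1 : |t (r + 1) - t r| ≤ 2 * A := (abs_sub _ _).trans (by linarith [hA r, hA (r + 1)])
    have h2 : |(r:ℝ) - α| ≤ R + 1 := by
      rw [abs_le]; have : (0:ℝ) ≤ r := by positivity
      constructor <;> linarith
    have h3 : |((r:ℝ) - α) * (t (r + 1) - t r) - α / 2 * t r| ≤ (R + 1) * (2 * A) + 1 * A := by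
      refine (abs_sub _ _).trans ?_
      rw [abs_mul, abs_mul, abs_of_pos (show 0 < α / 2 by linarith)]
      gcongr
      · linarith
      · exact hA r
    rw [EP.mv, abs_mul, abs_of_nonneg hh]
    calc _ ≤ h * ((R + 1) * (2 * A) + 1 * A) := by gcongr
      _ = _ := by ring
  · have : EP.mv α h t r = 0 := by simp [EP.mv, hz r hr, hz (r + 1) (by omega)]
    rw [this, abs_zero]; positivity

theorem abs_pp_le (hα0 : 0 < α) (hα1 : α < 1) (r : ℕ) : |pp α r| ≤ 1 := by
  rcases r with _ | r
  · simp [pp_zero]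
  · rw [abs_of_pos (pp_pos hα0 hα1 r)]; exact pp_le_one hα0 hα1 r

theorem VV_le (hα0 : 0 < α) (hα1 : α < 1) (R : ℕ) {t : ℕ → ℝ} {A : ℝ} (hA : ∀ r, |t r| ≤ A) :
    |VV α R t| ≤ (R + 1) * A ^ 2 := by
  have hA0 : 0 ≤ A := (abs_nonneg _).trans (hA 0)
  unfold VV
  refine (Finset.abs_sum_le_sum_abs _ _).trans ?_
  calc _ ≤ ∑ r ∈ Finset.range (R + 1), 1 * A ^ 2 := by
        refine Finset.sum_le_sum fun r _ => ?_
        rw [abs_mul, abs_pow]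
        gcongr
        · exact abs_pp_le hα0 hα1 r
        · exact hA r
    _ = _ := by simp

theorem WW_le (hα0 : 0 < α) (hα1 : α < 1) (R : ℕ) {t : ℕ → ℝ} {A : ℝ} (hA : ∀ r, |t r| ≤ A) :
    |WW α R t| ≤ (R + 1) * ((R + 1) * (4 * A ^ 2)) := by
  have hA0 : 0 ≤ A := (abs_nonneg _).trans (hA 0)
  unfold WW
  refine (Finset.abs_sum_le_sum_abs _ _).trans ?_
  calc _ ≤ ∑ r ∈ Finset.range (R + 1), ((R:ℝ) + 1) * 1 * (2 * A) ^ 2 := by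
        refine Finset.sum_le_sum fun r hr => ?_
        have hr' : (r:ℝ) ≤ R := by
          have := Finset.mem_range.1 hr
          exact_mod_cast (by omega : r ≤ R)
        rw [abs_mul, abs_mul, abs_pow]
        gcongr
        · rw [abs_le]; have : (0:ℝ) ≤ r := by positivity
          constructor <;> linarith
        · exact abs_pp_le hα0 hα1 r
        · exact (abs_sub _ _).trans (by linarith [hA r, hA (r + 1)])
    _ = _ := by rw [Finset.sum_const, Finset.card_range, nsmul_eq_mul]; push_cast; ring

end EP

namespace EP

variable {α θ : ℝ} {m : ℕ → Measure (ℕ → ℝ)}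

theorem cexp_two (x : ℝ) :
    ‖Complex.exp (x * Complex.I) - 1 - x * Complex.I + (x:ℂ) ^ 2 / 2‖ ≤ 4 * |x| ^ 3 := by
  have hn : ‖(x:ℂ) * Complex.I‖ = |x| := by simp
  rcases le_total |x| 1 with h | h
  · have := Complex.exp_bound (x := x * Complex.I) (by rw [hn]; exact h) (n := 3) (by norm_num)
    rw [hn] at this
    simp only [Finset.sum_range_succ, Finset.sum_range_zero, Nat.factorial] at this
    have e : Complex.exp (x * Complex.I) - 1 - x * Complex.I + (x:ℂ) ^ 2 / 2 =
      Complex.exp (x * Complex.I) - (0 + (x * Complex.I) ^ 0 / ((1:ℕ):ℂ) + (x * Complex.I) ^ 1 / ((0+1)*1 : ℕ) +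
        (x * Complex.I) ^ 2 / ((1+1)*((0+1)*1) : ℕ)) := by
      push_cast
      linear_combination ((x:ℂ) ^ 2 / 2) * Complex.I_sq
    rw [e]
    refine this.trans ?_
    have : 0 ≤ |x| ^ 3 := by positivity
    norm_num
    linarith
  · have h1 : ‖Complex.exp (x * Complex.I)‖ = 1 := Complex.norm_exp_ofReal_mul_I x
    calc _ ≤ ‖Complex.exp (x * Complex.I)‖ + ‖(1:ℂ)‖ + ‖(x:ℂ) * Complex.I‖ + ‖(x:ℂ) ^ 2 / 2‖ := by
          refine (norm_add_le _ _).trans ?_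
          gcongr
          refine (norm_sub_le _ _).trans ?_
          gcongr
          exact norm_sub_le _ _
      _ = 2 + |x| + |x| ^ 2 / 2 := by rw [h1, hn]; simp; ring
      _ ≤ _ := by nlinarith [mul_nonneg (abs_nonneg x) (abs_nonneg x), mul_le_mul h h (by norm_num) (by linarith)]

theorem cexp_one (x : ℝ) :
    ‖Complex.exp (x * Complex.I) - 1 - x * Complex.I‖ ≤ 3 * x ^ 2 := by
  have hn : ‖(x:ℂ) * Complex.I‖ = |x| := by simp
  rw [← sq_abs]
  rcases le_total |x| 1 with h | h
  · have := Complex.norm_exp_sub_one_sub_id_le (x := x * Complex.I) (by rw [hn]; exact h)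
    rw [hn] at this
    nlinarith [sq_nonneg |x|]
  · have h1 : ‖Complex.exp (x * Complex.I)‖ = 1 := Complex.norm_exp_ofReal_mul_I x
    calc _ ≤ ‖Complex.exp (x * Complex.I)‖ + ‖(1:ℂ)‖ + ‖(x:ℂ) * Complex.I‖ := by
          refine (norm_sub_le _ _).trans ?_
          gcongr
          exact norm_sub_le _ _
      _ = 2 + |x| := by rw [h1, hn]; simp; ring
      _ ≤ _ := by nlinarith

theorem cexp_zero (x : ℝ) : ‖Complex.exp (x * Complex.I) - 1‖ ≤ |x| := by
  have := Real.norm_exp_I_mul_ofReal_sub_one_le (x := x)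
  rwa [mul_comm, Real.norm_eq_abs] at this

theorem cexp_mix (η v : ℝ) (hv : |v| ≤ 1) :
    ‖Complex.exp (η * Complex.I) * (Real.exp v : ℂ) - 1 - η * Complex.I - v‖ ≤ 4 * (η ^ 2 + v ^ 2) := by
  have h1 : ‖Complex.exp (η * Complex.I)‖ = 1 := Complex.norm_exp_ofReal_mul_I η
  have h2 := cexp_one η
  have h3 := cexp_zero η
  have h4 := Real.abs_exp_sub_one_sub_id_le hv
  have e : Complex.exp (η * Complex.I) * (Real.exp v : ℂ) - 1 - η * Complex.I - v =
     Complex.exp (η * Complex.I) * ((Real.exp v - 1 - v : ℝ) : ℂ) +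
      (Complex.exp (η * Complex.I) - 1 - η * Complex.I) + (v:ℂ) * (Complex.exp (η * Complex.I) - 1) := by
    push_cast; ring
  rw [e]
  calc _ ≤ ‖Complex.exp (η * Complex.I) * ((Real.exp v - 1 - v : ℝ) : ℂ)‖ +
      ‖Complex.exp (η * Complex.I) - 1 - η * Complex.I‖ + ‖(v:ℂ) * (Complex.exp (η * Complex.I) - 1)‖ :=
        norm_add₃_le
    _ ≤ v ^ 2 + 3 * η ^ 2 + |v| * |η| := by
      rw [norm_mul, norm_mul, h1, one_mul, Complex.norm_real, Complex.norm_real, Real.norm_eq_abs, Real.norm_eq_abs]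
      gcongr
    _ ≤ _ := by nlinarith [sq_nonneg (|v| - |η|), sq_abs v, sq_abs η]

theorem g_bounds {σ τ : ℝ} (hσ : 0 < σ) (hτ : 0 < τ) (h : τ ^ 2 = σ ^ 2 + 1) :
    |1 / τ - 1 / σ| ≤ 1 / (2 * σ ^ 3) ∧ |1 / τ - 1 / σ + 1 / (2 * σ ^ 3)| ≤ 1 / (2 * σ ^ 5) := by
  have hlt : σ < τ := by nlinarith
  have e1 : 1 / τ - 1 / σ = -(1 / (σ * τ * (τ + σ))) := by
    rw [div_sub_div _ _ hτ.ne' hσ.ne', ← neg_div, div_eq_div_iff (by positivity) (by positivity)]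
    linear_combination (-(σ * τ)) * h
  have e2 : 1 / (2 * σ ^ 3) - 1 / (σ * τ * (τ + σ)) = (τ + 2 * σ) / (2 * σ ^ 3 * τ * (τ + σ) ^ 2) := by
    rw [div_sub_div _ _ (by positivity) (by positivity), div_eq_div_iff (by positivity) (by positivity)]
    linear_combination (2 * σ ^ 4 * τ * (τ + 2 * σ) * (τ + σ)) * h
  have hb : 2 * σ ^ 3 ≤ σ * τ * (τ + σ) := by
    have : σ * σ * (σ + σ) ≤ σ * τ * (τ + σ) := by gcongr
    nlinarith
  constructor
  · rw [e1, abs_neg, abs_of_pos (by positivity)]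
    gcongr
  · rw [e1, show -(1 / (σ * τ * (τ + σ))) + 1 / (2 * σ ^ 3) = 1 / (2 * σ ^ 3) - 1 / (σ * τ * (τ + σ)) by ring,
      e2, abs_of_pos (by positivity), div_le_div_iff₀ (by positivity) (by positivity), one_mul]
    have : (τ + 2 * σ) * σ ^ 2 ≤ τ * (τ + σ) ^ 2 := by
      have : (τ + 2 * σ) * σ ^ 2 ≤ (2 * (τ + σ)) * σ ^ 2 := by gcongr; linarith
      have : σ * (σ + σ) ≤ τ * (τ + σ) := by gcongr
      nlinarith
    have h3 : 0 < 2 * σ ^ 3 := by positivity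
    nlinarith

theorem xi0_bounds {σ τ Y d A S K : ℝ} (hσ : 0 < σ) (hτ : 0 < τ) (h : τ ^ 2 = σ ^ 2 + 1)
    (hA : 0 ≤ A) (hS : 0 ≤ S) (hK : 1 ≤ K) (hY : |Y| ≤ A * S) (hd : |d| ≤ 2 * A) (hSK : S ≤ K * σ ^ 2)
    (hσK : 1 / σ ≤ K) :
    |σ ^ 2 * ((Y + d) / τ - Y / σ - d / σ) + Y / (2 * σ)| ≤ 2 * K * A / σ ∧
    |σ ^ 2 * ((Y + d) / τ - Y / σ) ^ 2 - d ^ 2| ≤ 6 * K ^ 3 * A ^ 2 * (1 / σ + S / σ ^ 2) ∧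
    σ ^ 2 * |(Y + d) / τ - Y / σ| ^ 3 ≤ 64 * K ^ 6 * A ^ 3 / σ := by
  obtain ⟨g1, g2⟩ := g_bounds hσ hτ h
  set g := 1 / τ - 1 / σ with hg
  have e0 : (Y + d) / τ - Y / σ = d / σ + (Y + d) * g := by rw [hg]; ring
  set e := (Y + d) * g with he
  have hee : |e| ≤ A * (S + 2) / (2 * σ ^ 3) := by
    rw [he, abs_mul]
    calc _ ≤ (A * S + 2 * A) * (1 / (2 * σ ^ 3)) := by
          gcongr
          exact (abs_add_le _ _).trans (by linarith)
      _ = _ := by ring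
  have hS2 : (S + 2) / σ ^ 2 ≤ 3 * K ^ 2 := by
    have : (S + 2) / σ ^ 2 = S / σ ^ 2 + 2 * (1 / σ) ^ 2 := by field_simp
    rw [this]
    have h1 : S / σ ^ 2 ≤ K := by rw [div_le_iff₀ (by positivity)]; exact hSK
    have h2 : (1 / σ) ^ 2 ≤ K ^ 2 := by gcongr
    nlinarith
  have hS3 : (S + 2) / σ ^ 2 ≤ 2 * K * (1 / σ + S / σ ^ 2) := by
    have : (S + 2) / σ ^ 2 = S / σ ^ 2 + 2 * ((1 / σ) * (1 / σ)) := by field_simp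
    rw [this]
    have h1 : 0 ≤ S / σ ^ 2 := by positivity
    have h2 : 0 < 1 / σ := by positivity
    nlinarith
  have hσe : σ * |e| ≤ A * ((S + 2) / σ ^ 2) / 2 := by
    calc σ * |e| ≤ σ * (A * (S + 2) / (2 * σ ^ 3)) := by gcongr
      _ = _ := by field_simp
  refine ⟨?_, ?_, ?_⟩
  · have : σ ^ 2 * ((Y + d) / τ - Y / σ - d / σ) + Y / (2 * σ) =
        σ ^ 2 * (Y * (g + 1 / (2 * σ ^ 3))) + σ ^ 2 * (d * g) := by
      rw [e0, he]; field_simp; ring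
    rw [this]
    calc _ ≤ σ ^ 2 * ((A * (K * σ ^ 2)) * (1 / (2 * σ ^ 5))) + σ ^ 2 * ((2 * A) * (1 / (2 * σ ^ 3))) := by
          refine (abs_add_le _ _).trans ?_
          rw [abs_mul, abs_mul, abs_mul, abs_mul, abs_of_pos (show 0 < σ ^ 2 by positivity)]
          gcongr
          exact hY.trans (by gcongr)
      _ = (A * K / 2 + A) / σ := by field_simp
      _ ≤ _ := by gcongr; nlinarith
  · have : σ ^ 2 * ((Y + d) / τ - Y / σ) ^ 2 - d ^ 2 = 2 * d * (σ * e) + (σ * e) ^ 2 := by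
      rw [e0]; field_simp; ring
    rw [this]
    have hse : |σ * e| = σ * |e| := by rw [abs_mul, abs_of_pos hσ]
    calc _ ≤ 2 * |d| * (σ * |e|) + (σ * |e|) * (σ * |e|) := by
          refine (abs_add_le _ _).trans ?_
          rw [abs_mul, abs_mul, abs_two, abs_pow, hse, pow_two]
      _ ≤ 2 * (2 * A) * (A * ((S + 2) / σ ^ 2) / 2) + (A * (3 * K ^ 2) / 2) * (A * ((S + 2) / σ ^ 2) / 2) := by
          gcongr
          exact hσe.trans (by gcongr)
      _ = A ^ 2 * (2 + 3 / 4 * K ^ 2) * ((S + 2) / σ ^ 2) := by ring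
      _ ≤ A ^ 2 * (3 * K ^ 2) * (2 * K * (1 / σ + S / σ ^ 2)) := by
          gcongr
          nlinarith
      _ = _ := by ring
  · have hx : |(Y + d) / τ - Y / σ| ≤ 4 * K ^ 2 * A / σ := by
      rw [e0]
      calc _ ≤ 2 * A / σ + |e| := by
            refine (abs_add_le _ _).trans ?_
            rw [abs_div, abs_of_pos hσ]
            gcongr
        _ ≤ 2 * A / σ + (A * (3 * K ^ 2) / 2) / σ := by
            gcongr
            rw [le_div_iff₀ hσ, mul_comm]
            exact hσe.trans (by gcongr)
        _ = (2 * A + (A * (3 * K ^ 2) / 2)) / σ := by ring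
        _ ≤ _ := by
            gcongr
            have : A * 1 ≤ A * K ^ 2 := by gcongr; nlinarith
            nlinarith
    calc _ ≤ σ ^ 2 * (4 * K ^ 2 * A / σ) ^ 3 := by gcongr
      _ = _ := by field_simp; ring

end EP

namespace EP

variable {α θ : ℝ} {m : ℕ → Measure (ℕ → ℝ)}

structure Pt (α θ K : ℝ) (R n : ℕ) (b : ℕ → ℝ) (h σ S : ℝ) : Prop where
  a0 : 0 < α
  a1 : α < 1
  good : Good α θ n b
  hK1 : 1 ≤ K
  hK : (R:ℝ) + 1 ≤ K
  hn : 1 ≤ n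
  hR : R ≤ n
  hh : h = 1 / ((n:ℝ) + θ)
  h0 : 0 < h
  h1 : h ≤ 1
  hσ : 0 < σ
  hb0 : b 0 = -σ ^ 2
  hS : S = SS α R b
  S0 : 0 ≤ S
  sK : 1 / σ ≤ K
  SK : S ≤ K * σ ^ 2
  hσK : h * σ ^ 2 ≤ K
  bK : ∀ r, b (r + 1) ≤ K * σ ^ 2

def XX (R : ℕ) (t b : ℕ → ℝ) : ℝ := YY R t b / √(-b 0)

variable {K : ℝ} {R n : ℕ} {b : ℕ → ℝ} {h σ S : ℝ} {t : ℕ → ℝ} {A : ℝ}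

theorem Pt.sq (p : Pt α θ K R n b h σ S) : √(-b 0) = σ := by
  rw [p.hb0, neg_neg, Real.sqrt_sq p.hσ.le]

theorem Pt.pw_eq (p : Pt α θ K R n b h σ S) (r : ℕ) : pw α θ n r b = h * (((r:ℝ) - α) * b r) := by
  rw [pw, p.hh]; ring

theorem Pt.pw0 (p : Pt α θ K R n b h σ S) : pw α θ n 0 b = α * h * σ ^ 2 := by
  rw [p.pw_eq, p.hb0]; push_cast; ring

theorem Pt.X0 (p : Pt α θ K R n b h σ S) (hz : ∀ r, R < r → t r = 0) :
    XX R t (TT 0 b) = (YY R t b + (t 1 - t 0)) / √(σ ^ 2 + 1) := by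
  rw [XX, YY_TT hz]
  have : TT 0 b 0 = b 0 - 1 := by simp [TT]
  rw [this, p.hb0]
  congr 2; ring

theorem Pt.Xs (p : Pt α θ K R n b h σ S) (hz : ∀ r, R < r → t r = 0) (r : ℕ) :
    XX R t (TT (r + 1) b) = XX R t b + (t (r + 1 + 1) - t (r + 1)) / σ := by
  rw [XX, XX, YY_TT hz]
  have : TT (r + 1) b 0 = b 0 := by simp [TT]
  rw [this, p.sq]; ring

theorem Pt.lin (p : Pt α θ K R n b h σ S) (ht : Adm α R t) (hA : ∀ r, |t r| ≤ A) :
    |∑ r ∈ Finset.range (R + 1), pw α θ n r b * (XX R t (TT r b) - XX R t b) - YY R (mv α h t) b / σ|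
      ≤ 2 * K * (h * A) * (1 / σ) := by
  have hA0 : 0 ≤ A := (abs_nonneg _).trans (hA 0)
  have hσ := p.hσ
  have x0 := (xi0_bounds (Y := YY R t b) (d := t 1 - t 0) hσ (Real.sqrt_pos.2 (by positivity : 0 < σ^2+1))
    (Real.sq_sqrt (by positivity)) hA0 p.S0 p.hK1 (by rw [p.hS]; exact ht.YY_le b hA)
    ((abs_sub _ _).trans (by linarith [hA 0, hA 1])) p.SK p.sK).1
  have e1 : YY R (mv α h t) b + h * α / 2 * YY R t b = ∑ r ∈ Finset.range (R + 1), pw α θ n r b * (t (r + 1) - t r) := by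
    simp only [YY, Finset.mul_sum, ← Finset.sum_add_distrib]
    refine Finset.sum_congr rfl fun r _ => ?_
    rw [p.pw_eq]; simp only [mv]; ring
  have e2 : ∑ r ∈ Finset.range (R + 1), pw α θ n r b * (XX R t (TT r b) - XX R t b) =
     (∑ r ∈ Finset.range (R + 1), pw α θ n r b * (t (r + 1) - t r)) / σ +
      pw α θ n 0 b * (XX R t (TT 0 b) - XX R t b - (t 1 - t 0) / σ) := by
    rw [Finset.sum_range_succ', Finset.sum_range_succ' (fun r => pw α θ n r b * (t (r + 1) - t r)), add_div, Finset.sum_div]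
    have : ∀ r ∈ Finset.range R, pw α θ n (r + 1) b * (XX R t (TT (r + 1) b) - XX R t b) =
        pw α θ n (r + 1) b * (t (r + 1 + 1) - t (r + 1)) / σ := by
      intro r _; rw [p.Xs ht.z]; ring
    rw [Finset.sum_congr rfl this]
    ring
  have e3 : ∑ r ∈ Finset.range (R + 1), pw α θ n r b * (XX R t (TT r b) - XX R t b) - YY R (mv α h t) b / σ =
     α * h * (σ ^ 2 * ((YY R t b + (t 1 - t 0)) / √(σ ^ 2 + 1) - YY R t b / σ - (t 1 - t 0) / σ) + YY R t b / (2 * σ)) := by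
    rw [e2, ← e1, p.pw0, p.X0 ht.z, XX, p.sq]
    field_simp
    ring
  rw [e3, abs_mul, abs_of_pos (mul_pos p.a0 p.h0)]
  have h0 := p.h0
  have hK1 := p.hK1
  calc _ ≤ 1 * h * (2 * K * A / σ) := by gcongr; exact p.a1.le
    _ = _ := by ring

theorem Pt.r_le {r : ℕ} (p : Pt α θ K R n b h σ S) (hr : r ∈ Finset.range R) :
    0 ≤ ((r + 1 : ℕ) : ℝ) - α ∧ ((r + 1 : ℕ) : ℝ) - α ≤ K := by
  have : r + 1 ≤ R := Finset.mem_range.1 hr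
  have h1 : ((r + 1 : ℕ) : ℝ) ≤ R := by exact_mod_cast this
  have := p.hK; have := p.a0; have := p.a1
  have h2 : (1:ℝ) ≤ ((r + 1 : ℕ) : ℝ) := by push_cast; have : (0:ℝ) ≤ r := by positivity
                                            linarith
  constructor <;> linarith

theorem Pt.quad (p : Pt α θ K R n b h σ S) (ht : Adm α R t) (hA : ∀ r, |t r| ≤ A) :
    |∑ r ∈ Finset.range (R + 1), pw α θ n r b * (XX R t (TT r b) - XX R t b) ^ 2 - h * WW α R t|
      ≤ 10 * K ^ 3 * (h * A ^ 2) * (1 / σ + S / σ ^ 2) := by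
  have hA0 : 0 ≤ A := (abs_nonneg _).trans (hA 0)
  have hσ := p.hσ
  have hK1 := p.hK1
  have S0 := p.S0
  have h0 := p.h0
  have x0 := (xi0_bounds (Y := YY R t b) (d := t 1 - t 0) hσ (Real.sqrt_pos.2 (by positivity : 0 < σ^2+1))
    (Real.sq_sqrt (by positivity)) hA0 p.S0 p.hK1 (by rw [p.hS]; exact ht.YY_le b hA)
    ((abs_sub _ _).trans (by linarith [hA 0, hA 1])) p.SK p.sK).2.1
  have e3 : ∑ r ∈ Finset.range (R + 1), pw α θ n r b * (XX R t (TT r b) - XX R t b) ^ 2 - h * WW α R t =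
     ∑ r ∈ Finset.range R, h * ((((r + 1 : ℕ):ℝ) - α) * (DD α (r + 1) b * (t (r + 1 + 1) - t (r + 1)) ^ 2)) / σ ^ 2 +
     α * h * (σ ^ 2 * ((YY R t b + (t 1 - t 0)) / √(σ ^ 2 + 1) - YY R t b / σ) ^ 2 - (t 1 - t 0) ^ 2) := by
    rw [WW, Finset.sum_range_succ', Finset.sum_range_succ' (fun r => ((r:ℝ) - α) * pp α r * (t (r + 1) - t r) ^ 2), mul_add,
      Finset.mul_sum, add_sub_add_comm, ← Finset.sum_sub_distrib]
    congr 1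
    · refine Finset.sum_congr rfl fun r _ => ?_
      rw [p.Xs ht.z, p.pw_eq, DD, p.hb0]
      field_simp
      ring
    · rw [p.pw0, p.X0 ht.z, XX, p.sq, pp_zero]
      push_cast
      ring
  rw [e3]
  have s1 : |∑ r ∈ Finset.range R, h * ((((r + 1 : ℕ):ℝ) - α) * (DD α (r + 1) b * (t (r + 1 + 1) - t (r + 1)) ^ 2)) / σ ^ 2|
      ≤ h * (K * (S * (2 * A) ^ 2)) / σ ^ 2 := by
    rw [p.hS, SS, Finset.sum_mul, Finset.mul_sum, Finset.mul_sum, Finset.sum_div]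
    refine (Finset.abs_sum_le_sum_abs _ _).trans (Finset.sum_le_sum fun r hr => ?_)
    obtain ⟨r1, r2⟩ := p.r_le hr
    rw [abs_div, abs_mul, abs_mul, abs_mul, abs_of_pos h0, abs_of_nonneg r1, abs_pow, abs_of_pos (show 0 < σ^2 by positivity)]
    gcongr
    exact (abs_sub _ _).trans (by linarith [hA (r + 1), hA (r + 1 + 1)])
  have hρ : 0 ≤ 1 / σ := by positivity
  have hρ' : 0 ≤ S / σ ^ 2 := by positivity
  calc _ ≤ h * (K * (S * (2 * A) ^ 2)) / σ ^ 2 + 1 * h * (6 * K ^ 3 * A ^ 2 * (1 / σ + S / σ ^ 2)) := by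
        refine (abs_add_le _ _).trans (add_le_add s1 ?_)
        rw [abs_mul, abs_of_pos (mul_pos p.a0 p.h0)]
        gcongr
        exact p.a1.le
    _ = (h * A ^ 2) * (4 * K * (S / σ ^ 2) + 6 * K ^ 3 * (1 / σ + S / σ ^ 2)) := by ring
    _ ≤ (h * A ^ 2) * (4 * K ^ 3 * (1 / σ + S / σ ^ 2) + 6 * K ^ 3 * (1 / σ + S / σ ^ 2)) := by
        have : K ≤ K ^ 3 := le_self_pow₀ hK1 (by norm_num)
        gcongr
        linarith
    _ = _ := by ring

theorem Pt.cub (p : Pt α θ K R n b h σ S) (ht : Adm α R t) (hA : ∀ r, |t r| ≤ A) :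
    ∑ r ∈ Finset.range (R + 1), pw α θ n r b * |XX R t (TT r b) - XX R t b| ^ 3
      ≤ 72 * K ^ 6 * (h * A ^ 3) * (1 / σ) := by
  have hA0 : 0 ≤ A := (abs_nonneg _).trans (hA 0)
  have hσ := p.hσ
  have hK1 := p.hK1
  have S0 := p.S0
  have h0 := p.h0
  have x0 := (xi0_bounds (Y := YY R t b) (d := t 1 - t 0) hσ (Real.sqrt_pos.2 (by positivity : 0 < σ^2+1))
    (Real.sq_sqrt (by positivity)) hA0 p.S0 p.hK1 (by rw [p.hS]; exact ht.YY_le b hA)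
    ((abs_sub _ _).trans (by linarith [hA 0, hA 1])) p.SK p.sK).2.2
  rw [Finset.sum_range_succ']
  have s1 : ∑ r ∈ Finset.range R, pw α θ n (r + 1) b * |XX R t (TT (r + 1) b) - XX R t b| ^ 3 ≤
      ∑ r ∈ Finset.range R, h * (K * (K * σ ^ 2)) * (2 * A / σ) ^ 3 := by
    refine Finset.sum_le_sum fun r hr => ?_
    obtain ⟨r1, r2⟩ := p.r_le hr
    have b0 := p.good.nn (r + 1) (by omega)
    have b1 := p.bK r
    rw [p.pw_eq, p.Xs ht.z, add_sub_cancel_left, abs_div, abs_of_pos hσ]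
    gcongr
    exact (abs_sub _ _).trans (by linarith [hA (r + 1), hA (r + 1 + 1)])
  rw [Finset.sum_const, Finset.card_range, nsmul_eq_mul] at s1
  have s2 : (R:ℝ) * (h * (K * (K * σ ^ 2)) * (2 * A / σ) ^ 3) ≤ 8 * K ^ 6 * (h * A ^ 3) * (1 / σ) := by
    calc _ ≤ K * (h * (K * (K * σ ^ 2)) * (2 * A / σ) ^ 3) := by gcongr; linarith [p.hK]
      _ = 8 * K ^ 3 * (h * A ^ 3) * (1 / σ) := by field_simp; ring
      _ ≤ _ := by
        have : K ^ 3 ≤ K ^ 6 := pow_le_pow_right₀ hK1 (by norm_num)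
        gcongr
  have s3 : pw α θ n 0 b * |XX R t (TT 0 b) - XX R t b| ^ 3 ≤ 64 * K ^ 6 * (h * A ^ 3) * (1 / σ) := by
    rw [p.pw0, p.X0 ht.z, XX, p.sq]
    calc _ = α * h * (σ ^ 2 * |(YY R t b + (t 1 - t 0)) / √(σ ^ 2 + 1) - YY R t b / σ| ^ 3) := by ring
      _ ≤ 1 * h * (64 * K ^ 6 * A ^ 3 / σ) := by gcongr; exact p.a1.le
      _ = _ := by ring
  linarith

theorem Pt.eta (p : Pt α θ K R n b h σ S) (ht : Adm α R t) (hA : ∀ r, |t r| ≤ A) :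
    (YY R (mv α h t) b / σ) ^ 2 ≤ 25 * K ^ 4 * (h * A ^ 2) * (S / σ ^ 2) := by
  have hA0 : 0 ≤ A := (abs_nonneg _).trans (hA 0)
  have hσ := p.hσ
  have hK1 := p.hK1
  have S0 := p.S0
  have h0 := p.h0
  have h1 := (ht.mv h).YY_le b (mv_le ht.z p.a0 p.a1 hA h0.le)
  rw [← p.hS] at h1
  have h2 : |YY R (mv α h t) b| ≤ 5 * K * (h * A) * S := by
    refine h1.trans ?_
    gcongr
    linarith [p.hK]
  rw [div_pow, ← sq_abs (YY _ _ _)]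
  calc _ ≤ (5 * K * (h * A) * S) ^ 2 / σ ^ 2 := by gcongr
    _ = 25 * K ^ 2 * (h * A ^ 2) * (S / σ ^ 2) * (h * S) := by ring
    _ ≤ 25 * K ^ 2 * (h * A ^ 2) * (S / σ ^ 2) * (K ^ 2) := by
        gcongr
        calc h * S ≤ h * (K * σ ^ 2) := by gcongr; exact p.SK
          _ = K * (h * σ ^ 2) := by ring
          _ ≤ K * K := by gcongr; exact p.hσK
          _ = _ := by ring
    _ = _ := by ring

theorem Pt.h_le (p : Pt α θ K R n b h σ S) : h ≤ K ^ 2 * (1 / σ) := by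
  have hσ := p.hσ
  have hK1 := p.hK1
  calc h = (h * σ ^ 2) * (1 / σ * (1 / σ)) := by field_simp
    _ ≤ K * (K * (1 / σ)) := by
      have := p.hσK; have := p.sK
      gcongr
    _ = _ := by ring

theorem Pt.vest (p : Pt α θ K R n b h σ S) (ht : Adm α R t) (hA : ∀ r, |t r| ≤ A) :
    |(VV α R (t + mv α h t) - VV α R t) + h * WW α R t| ≤ 25 * K ^ 5 * (h * A ^ 2) * (1 / σ) ∧
    |(VV α R (t + mv α h t) - VV α R t)| ≤ 29 * K ^ 3 * (h * A ^ 2) := by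
  have hA0 : 0 ≤ A := (abs_nonneg _).trans (hA 0)
  have hσ := p.hσ
  have hK1 := p.hK1
  have h0 := p.h0
  have hK := p.hK
  have e : (VV α R (t + mv α h t) - VV α R t) + h * WW α R t = VV α R (mv α h t) := by
    rw [ht.VV_mv]
    have : VV α R (mv α h t) = ∑ r ∈ Finset.range (R+1), pp α r * mv α h t r ^ 2 := rfl
    rw [this]; ring
  have b1 := VV_le p.a0 p.a1 R (mv_le ht.z p.a0 p.a1 hA h0.le)
  have b2 : |VV α R (mv α h t)| ≤ 25 * K ^ 3 * (h * A ^ 2) * h := by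
    refine b1.trans ?_
    calc _ ≤ K * ((5 * K) * (h * A)) ^ 2 := by gcongr; linarith
      _ = _ := by ring
  have b3 := WW_le p.a0 p.a1 R hA
  rw [e]
  constructor
  · refine b2.trans ?_
    calc _ ≤ 25 * K ^ 3 * (h * A ^ 2) * (K ^ 2 * (1 / σ)) := by gcongr; exact p.h_le
      _ = _ := by ring
  · have : VV α R (t + mv α h t) - VV α R t = VV α R (mv α h t) - h * WW α R t := by rw [← e]; ring
    rw [this]
    calc _ ≤ |VV α R (mv α h t)| + |h * WW α R t| := abs_sub _ _
      _ ≤ 25 * K ^ 3 * (h * A ^ 2) * 1 + h * (K * (K * (4 * A ^ 2))) := by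
        rw [abs_mul, abs_of_pos h0]
        refine add_le_add (b2.trans ?_) ?_
        · gcongr; exact p.h1
        · gcongr
          exact b3.trans (by gcongr)
      _ = (25 * K ^ 3 + 4 * K ^ 2) * (h * A ^ 2) := by ring
      _ ≤ (25 * K ^ 3 + 4 * K ^ 3) * (h * A ^ 2) := by
        have : K ^ 2 ≤ K ^ 3 := pow_le_pow_right₀ hK1 (by norm_num)
        gcongr
      _ = _ := by ring

end EP

namespace EP

variable {α θ : ℝ} {m : ℕ → Measure (ℕ → ℝ)}
variable {K : ℝ} {R n : ℕ} {b : ℕ → ℝ} {h σ S : ℝ} {t : ℕ → ℝ} {A : ℝ}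

theorem comb (n R : ℕ) (hR : R ≤ n) (w ξ : ℕ → ℝ) (hw : ∀ r, 0 ≤ w r)
    (htot : ∑ r ∈ Finset.range (n + 1), w r = 1) (hξ : ∀ r, R < r → ξ r = 0) (η v hW e1 e2 e3 e4 : ℝ)
    (h1 : |∑ r ∈ Finset.range (R + 1), w r * ξ r - η| ≤ e1)
    (h2 : |∑ r ∈ Finset.range (R + 1), w r * ξ r ^ 2 - hW| ≤ e2)
    (h3 : ∑ r ∈ Finset.range (R + 1), w r * |ξ r| ^ 3 ≤ e3)
    (h4 : |2 * v + hW| ≤ e4) (hv : |v| ≤ 1) :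
    ‖∑ r ∈ Finset.range (n + 1), (w r : ℂ) * Complex.exp (ξ r * Complex.I) -
      Complex.exp (η * Complex.I) * (Real.exp v : ℂ)‖ ≤ e1 + e2 / 2 + 4 * e3 + e4 / 2 + 4 * (η ^ 2 + v ^ 2) := by
  have s0 : ∑ r ∈ Finset.range (n + 1), (w r : ℂ) * Complex.exp (ξ r * Complex.I) =
      1 + ∑ r ∈ Finset.range (R + 1), (w r : ℂ) * (Complex.exp (ξ r * Complex.I) - 1) := by
    have : ∑ r ∈ Finset.range (R + 1), (w r : ℂ) * (Complex.exp (ξ r * Complex.I) - 1) =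
        ∑ r ∈ Finset.range (n + 1), (w r : ℂ) * (Complex.exp (ξ r * Complex.I) - 1) := by
      refine Finset.sum_subset (Finset.range_mono (by omega)) fun r _ hr => ?_
      rw [hξ r (by simpa using hr)]; simp
    rw [this]
    simp only [mul_sub, mul_one, Finset.sum_sub_distrib]
    have : ∑ r ∈ Finset.range (n + 1), (w r : ℂ) = 1 := by exact_mod_cast congrArg (fun x : ℝ => (x:ℂ)) htot
    rw [this]; ring
  have s1 : ∑ r ∈ Finset.range (n + 1), (w r : ℂ) * Complex.exp (ξ r * Complex.I) -
      Complex.exp (η * Complex.I) * (Real.exp v : ℂ) =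
      ∑ r ∈ Finset.range (R + 1), (w r : ℂ) * (Complex.exp (ξ r * Complex.I) - 1 - ξ r * Complex.I + (ξ r : ℂ) ^ 2 / 2)
      + (((∑ r ∈ Finset.range (R + 1), w r * ξ r - η : ℝ) : ℂ) * Complex.I
      + (-(((∑ r ∈ Finset.range (R + 1), w r * ξ r ^ 2 - hW) / 2 : ℝ) : ℂ)
      + (-(((2 * v + hW) / 2 : ℝ) : ℂ)
      + -(Complex.exp (η * Complex.I) * (Real.exp v : ℂ) - 1 - η * Complex.I - v)))) := by
    rw [s0]
    have : ∑ r ∈ Finset.range (R + 1), (w r : ℂ) * (Complex.exp (ξ r * Complex.I) - 1 - ξ r * Complex.I + (ξ r : ℂ) ^ 2 / 2) =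
       ∑ r ∈ Finset.range (R + 1), (w r : ℂ) * (Complex.exp (ξ r * Complex.I) - 1)
        - (∑ r ∈ Finset.range (R + 1), (w r : ℂ) * ξ r) * Complex.I + (∑ r ∈ Finset.range (R + 1), (w r : ℂ) * (ξ r:ℂ) ^ 2) / 2 := by
      rw [Finset.sum_mul, Finset.sum_div, ← Finset.sum_sub_distrib, ← Finset.sum_add_distrib]
      refine Finset.sum_congr rfl fun r _ => by ring
    rw [this]
    push_cast
    ring
  rw [s1]
  have n0 : ‖∑ r ∈ Finset.range (R + 1), (w r : ℂ) * (Complex.exp (ξ r * Complex.I) - 1 - ξ r * Complex.I + (ξ r : ℂ) ^ 2 / 2)‖ ≤ 4 * e3 := by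
    refine (norm_sum_le _ _).trans ((Finset.sum_le_sum fun r _ => ?_).trans
      ((Finset.mul_sum _ _ (4:ℝ)).symm.le.trans (mul_le_mul_of_nonneg_left h3 (by norm_num))))
    rw [norm_mul, Complex.norm_real, Real.norm_eq_abs, abs_of_nonneg (hw r)]
    have := mul_le_mul_of_nonneg_left (cexp_two (ξ r)) (hw r)
    linarith
  have n1 : ‖((∑ r ∈ Finset.range (R + 1), w r * ξ r - η : ℝ) : ℂ) * Complex.I‖ ≤ e1 := by
    rw [norm_mul, Complex.norm_I, mul_one, Complex.norm_real]; exact h1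
  have n2 : ‖-(((∑ r ∈ Finset.range (R + 1), w r * ξ r ^ 2 - hW) / 2 : ℝ) : ℂ)‖ ≤ e2 / 2 := by
    rw [norm_neg, Complex.norm_real, Real.norm_eq_abs, abs_div, abs_two]; linarith
  have n3 : ‖-(((2 * v + hW) / 2 : ℝ) : ℂ)‖ ≤ e4 / 2 := by
    rw [norm_neg, Complex.norm_real, Real.norm_eq_abs, abs_div, abs_two]; linarith
  have n4 : ‖-(Complex.exp (η * Complex.I) * (Real.exp v : ℂ) - 1 - η * Complex.I - v)‖ ≤ 4 * (η ^ 2 + v ^ 2) := by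
    rw [norm_neg]; exact cexp_mix η v hv
  have := norm_add_le_of_le n0 (norm_add_le_of_le n1 (norm_add_le_of_le n2 (norm_add_le_of_le n3 n4)))
  linarith

theorem Pt.main (p : Pt α θ K R n b h σ S) (ht : Adm α R t) (hA : ∀ r, |t r| ≤ A) (hAK : A ≤ K)
    (hsm : 29 * K ^ 5 * h ≤ 2) (hpw : ∀ r, 0 ≤ pw α θ n r b) :
    ‖∑ r ∈ Finset.range (n + 1), (pw α θ n r b : ℂ) * Complex.exp (XX R t (TT r b) * Complex.I) -
      Complex.exp (XX R (t + mv α h t) b * Complex.I) * (Real.exp ((VV α R (t + mv α h t) - VV α R t) / 2) : ℂ)‖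
      ≤ 1400 * K ^ 11 * (h * A) * (1 / σ + S / σ ^ 2) := by
  have hA0 : 0 ≤ A := (abs_nonneg _).trans (hA 0)
  have hσ := p.hσ
  have hK1 := p.hK1
  have h0 := p.h0
  have S0 := p.S0
  have e1 := p.lin ht hA
  have e2 := p.quad ht hA
  have e3 := p.cub ht hA
  have e4 := p.eta ht hA
  obtain ⟨e5, e6⟩ := p.vest ht hA
  set X := XX R t b with hX
  set η := YY R (mv α h t) b / σ with hη
  set v := (VV α R (t + mv α h t) - VV α R t) / 2 with hv
  have e5' : |2 * v + h * WW α R t| ≤ 25 * K ^ 5 * (h * A ^ 2) * (1 / σ) := by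
    rw [hv, mul_div_cancel₀ _ (two_ne_zero)]; exact e5
  have v1 : |v| ≤ 15 * K ^ 3 * (h * A ^ 2) := by
    rw [hv, abs_div, abs_two]
    have : 0 ≤ K ^ 3 * (h * A ^ 2) := by positivity
    linarith
  have v2 : |v| ≤ 1 := by
    rw [hv, abs_div, abs_two]
    have : 29 * K ^ 3 * (h * A ^ 2) ≤ 29 * K ^ 5 * h := by
      calc _ ≤ 29 * K ^ 3 * (h * K ^ 2) := by gcongr
        _ = _ := by ring
    linarith
  have v3 : v ^ 2 ≤ 225 * K ^ 8 * (h * A ^ 4) * (1 / σ) := by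
    rw [← sq_abs]
    calc _ ≤ (15 * K ^ 3 * (h * A ^ 2)) ^ 2 := by gcongr
      _ = 225 * K ^ 6 * (h * A ^ 4) * h := by ring
      _ ≤ 225 * K ^ 6 * (h * A ^ 4) * (K ^ 2 * (1 / σ)) := by gcongr; exact p.h_le
      _ = _ := by ring
  have hξ : ∀ r, R < r → XX R t (TT r b) - X = 0 := by
    intro r hr
    obtain ⟨s, rfl⟩ : ∃ s, r = s + 1 := ⟨r - 1, by omega⟩
    rw [p.Xs ht.z, ht.z _ hr, ht.z _ (by omega : R < s + 1 + 1)]; simp [hX]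
  have c := comb n R p.hR (fun r => pw α θ n r b) (fun r => XX R t (TT r b) - X) hpw p.good.tot hξ η v _ _ _ _ _ e1 e2 e3 e5' v2
  have eq : ∑ r ∈ Finset.range (n + 1), (pw α θ n r b : ℂ) * Complex.exp (XX R t (TT r b) * Complex.I) -
      Complex.exp (XX R (t + mv α h t) b * Complex.I) * (Real.exp v : ℂ) =
      Complex.exp (X * Complex.I) * (∑ r ∈ Finset.range (n + 1), (pw α θ n r b : ℂ) * Complex.exp (((XX R t (TT r b) - X : ℝ) : ℂ) * Complex.I) -
      Complex.exp (η * Complex.I) * (Real.exp v : ℂ)) := by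
    have : XX R (t + mv α h t) b = X + η := by
      rw [hX, hη, XX, XX, YY_add, p.sq]; ring
    rw [this, mul_sub, Finset.mul_sum]
    congr 1
    · refine Finset.sum_congr rfl fun r _ => ?_
      have : (XX R t (TT r b) : ℂ) * Complex.I = X * Complex.I + ((XX R t (TT r b) - X : ℝ) : ℂ) * Complex.I := by push_cast; ring
      rw [this, Complex.exp_add]; ring
    · push_cast; rw [add_mul, Complex.exp_add]; ring
  rw [eq, norm_mul, Complex.norm_exp_ofReal_mul_I, one_mul]
  refine c.trans ?_
  have hρ : 0 ≤ 1 / σ := by positivity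
  have hρ' : 0 ≤ S / σ ^ 2 := by positivity
  set ρ := 1 / σ
  set ρ' := S / σ ^ 2
  have hh : 0 ≤ h * A := by positivity
  have q1 : 2 * K * (h * A) * ρ ≤ 2 * K ^ 11 * (h * A) * (ρ + ρ') := by
    have : K ≤ K ^ 11 := le_self_pow₀ hK1 (by norm_num)
    gcongr; linarith
  have q2 : 10 * K ^ 3 * (h * A ^ 2) * (ρ + ρ') ≤ 10 * K ^ 11 * (h * A) * (ρ + ρ') := by
    calc _ = 10 * K ^ 3 * (h * A * A) * (ρ + ρ') := by ring
      _ ≤ 10 * K ^ 3 * (h * A * K) * (ρ + ρ') := by gcongr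
      _ = 10 * K ^ 4 * (h * A) * (ρ + ρ') := by ring
      _ ≤ _ := by gcongr; norm_num
  have q3 : 72 * K ^ 6 * (h * A ^ 3) * ρ ≤ 72 * K ^ 11 * (h * A) * (ρ + ρ') := by
    calc _ = 72 * K ^ 6 * (h * A * A ^ 2) * ρ := by ring
      _ ≤ 72 * K ^ 6 * (h * A * K ^ 2) * (ρ + ρ') := by gcongr; linarith
      _ = 72 * K ^ 8 * (h * A) * (ρ + ρ') := by ring
      _ ≤ _ := by gcongr; norm_num
  have q4 : 25 * K ^ 5 * (h * A ^ 2) * ρ ≤ 25 * K ^ 11 * (h * A) * (ρ + ρ') := by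
    calc _ = 25 * K ^ 5 * (h * A * A) * ρ := by ring
      _ ≤ 25 * K ^ 5 * (h * A * K) * (ρ + ρ') := by gcongr; linarith
      _ = 25 * K ^ 6 * (h * A) * (ρ + ρ') := by ring
      _ ≤ _ := by gcongr; norm_num
  have q5 : 25 * K ^ 4 * (h * A ^ 2) * ρ' ≤ 25 * K ^ 11 * (h * A) * (ρ + ρ') := by
    calc _ = 25 * K ^ 4 * (h * A * A) * ρ' := by ring
      _ ≤ 25 * K ^ 4 * (h * A * K) * (ρ + ρ') := by gcongr; linarith
      _ = 25 * K ^ 5 * (h * A) * (ρ + ρ') := by ring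
      _ ≤ _ := by gcongr; norm_num
  have q6 : 225 * K ^ 8 * (h * A ^ 4) * ρ ≤ 225 * K ^ 11 * (h * A) * (ρ + ρ') := by
    calc _ = 225 * K ^ 8 * (h * A * A ^ 3) * ρ := by ring
      _ ≤ 225 * K ^ 8 * (h * A * K ^ 3) * (ρ + ρ') := by gcongr; linarith
      _ = _ := by ring
  have : 0 ≤ K ^ 11 * (h * A) * (ρ + ρ') := by positivity
  linarith

end EP

namespace EP

variable {α θ : ℝ} {m : ℕ → Measure (ℕ → ℝ)}
theorem dis {c δ h : ℕ → ℝ} {a : ℝ} (ha : 0 < a) (h0 : ∀ n, 0 ≤ h n) (h1 : ∀ n, a * h n ≤ 1)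
    (hs : Tendsto (fun n => ∑ i ∈ Finset.range n, h i) atTop atTop) (hδ : Tendsto δ atTop (𝓝 0))
    (hc0 : ∀ n, 0 ≤ c n) (hc : ∀ n, c (n + 1) ≤ (1 - a * h n) * c n + a * h n * δ n) :
    Tendsto c atTop (𝓝 0) := by
  rw [Metric.tendsto_atTop]
  intro ε hε
  obtain ⟨N, hN⟩ := (Metric.tendsto_atTop.1 hδ) (ε / 2) (by positivity)
  have key : ∀ k, c (N + k) - ε / 2 ≤ Real.exp (-(a * ∑ i ∈ Finset.range k, h (N + i))) * |c N - ε / 2| := by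
    intro k
    induction k with
    | zero => simpa using le_abs_self (c N - ε / 2)
    | succ k ih =>
      have d := hN (N + k) (by omega)
      rw [Real.dist_eq, sub_zero] at d
      have d' := (le_abs_self _).trans d.le
      have e := hc (N + k)
      have p0 : 0 ≤ a * h (N + k) := mul_nonneg ha.le (h0 _)
      have p1 := h1 (N + k)
      rw [Finset.sum_range_succ, mul_add, neg_add_rev, Real.exp_add, mul_assoc]
      calc c (N + (k + 1)) - ε / 2 ≤ (1 - a * h (N + k)) * (c (N + k) - ε / 2) := by
            rw [← add_assoc]; nlinarith
        _ ≤ (1 - a * h (N + k)) * (Real.exp (-(a * ∑ i ∈ Finset.range k, h (N + i))) * |c N - ε / 2|) := by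
            gcongr
        _ ≤ _ := by
            gcongr
            linarith [Real.add_one_le_exp (-(a * h (N + k)))]
  have hs2 : Tendsto (fun k => a * ∑ i ∈ Finset.range k, h (N + i)) atTop atTop := by
    refine Tendsto.const_mul_atTop ha ?_
    have := (tendsto_add_atTop_iff_nat N).2 hs
    have e : ∀ k, ∑ i ∈ Finset.range k, h (N + i) = -(∑ i ∈ Finset.range N, h i) + ∑ i ∈ Finset.range (k + N), h i := by
      intro k; rw [add_comm k N, Finset.sum_range_add]; ring
    simp only [e]
    exact tendsto_atTop_add_const_left _ _ this
  have lim := ((Real.tendsto_exp_atBot.comp (tendsto_neg_atTop_atBot.comp hs2)).mul_const (|c N - ε / 2|))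
  rw [zero_mul] at lim
  obtain ⟨M, hM⟩ := (Metric.tendsto_atTop.1 lim) (ε / 2) (by positivity)
  refine ⟨N + M, fun n hn => ?_⟩
  obtain ⟨k, rfl⟩ : ∃ k, n = N + k := ⟨n - N, by omega⟩
  have m := hM k (by omega)
  rw [Real.dist_eq, sub_zero] at m ⊢
  have m' := (le_abs_self _).trans_lt m
  have kk := key k
  simp only [Function.comp] at m'
  rw [abs_of_nonneg (hc0 _)]
  linarith

theorem harm (N : ℕ) (θ : ℝ) (hN : 0 < (N:ℝ) + θ) :
    Tendsto (fun n => ∑ i ∈ Finset.range n, 1 / (((N + i : ℕ) : ℝ) + θ)) atTop atTop := by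
  have hC : 0 < (N:ℝ) + |θ| + 1 := by positivity
  refine tendsto_atTop_mono (fun n => ?_)
    ((Real.tendsto_sum_range_one_div_nat_succ_atTop).const_mul_atTop (inv_pos.2 hC))
  rw [Finset.mul_sum]
  refine Finset.sum_le_sum fun i _ => ?_
  have hi : (0:ℝ) ≤ i := by positivity
  have hN' : (0:ℝ) ≤ N := by positivity
  rw [inv_mul_eq_div, div_div]
  apply one_div_le_one_div_of_le
  · push_cast; linarith
  · push_cast
    have := le_abs_self θ
    have := abs_nonneg θ
    nlinarith

theorem exists_Pt (hα0 : 0 < α) (hα1 : α < 1) (hθ : 0 < α + θ) (R : ℕ) (A0 : ℝ) :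
    ∃ K : ℝ, 1 ≤ K ∧ (R:ℝ) + 1 ≤ K ∧ A0 ≤ K ∧ ∃ n0 : ℕ, 1 ≤ n0 ∧ ∀ n : ℕ, n0 ≤ n →
      0 < (n:ℝ) + θ ∧ 29 * K ^ 5 * (1 / ((n:ℝ) + θ)) ≤ 2 ∧ (1 / ((n:ℝ) + θ)) * R ≤ 1 ∧ 1 / ((n:ℝ) + θ) ≤ 1 ∧
      ∀ b, Good α θ n b → Pt α θ K R n b (1 / ((n:ℝ) + θ)) (√(-b 0)) (SS α R b) := by
  have hc := c0_pos hα0 hθ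
  set C2 := 1 + |θ / α| / (1 + θ / α) with hC2
  have hC20 : 0 < C2 := by positivity
  clear_value C2
  have p1 : 0 < 1 / √(1 + θ / α) := by positivity
  have p2 : 0 < 1 / α := by positivity
  have p3 : (0:ℝ) ≤ R := by positivity
  have p4 : 0 ≤ (R:ℝ) * C2 := by positivity
  have p5 := abs_nonneg A0
  have p6 := le_abs_self A0
  set K := (R:ℝ) + 1 + |A0| + 1 / √(1 + θ / α) + R * C2 + C2 + 1 / α with hK
  have K1 : 1 ≤ K := by linarith
  have K2 : (R:ℝ) + 1 ≤ K := by linarith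
  have K3 : (R:ℝ) * C2 ≤ K := by linarith
  have K4 : C2 + 1 ≤ K := by linarith
  have K6 : 1 / √(1 + θ / α) ≤ K := by linarith
  have K7 : 1 / α ≤ K := by linarith
  have K8 : A0 ≤ K := by linarith
  clear_value K
  clear hK p1 p2 p4 p6
  have K5 : 1 ≤ K ^ 5 := one_le_pow₀ K1
  have KK : K ≤ K ^ 5 := le_self_pow₀ K1 (by norm_num)
  refine ⟨K, K1, K2, K8, max 1 (max R ⌈29 * K ^ 5 + |θ|⌉₊), le_max_left _ _, fun n hn => ?_⟩
  have hn1 : 1 ≤ n := (le_max_left _ _).trans hn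
  have hnR : R ≤ n := ((le_max_left _ _).trans (le_max_right _ _)).trans hn
  have hnK : 29 * K ^ 5 + |θ| ≤ n := (Nat.le_ceil _).trans (by exact_mod_cast ((le_max_right _ _).trans (le_max_right _ _)).trans hn)
  have hθ' := neg_abs_le θ
  have hnn : 29 * K ^ 5 ≤ n + θ := by linarith
  have hpos : 0 < (n:ℝ) + θ := by linarith
  have hh1 : 1 / ((n:ℝ) + θ) ≤ 1 := by rw [div_le_one hpos]; linarith
  refine ⟨hpos, ?_, ?_, hh1, fun b hg => ?_⟩
  · rw [mul_one_div, div_le_iff₀ hpos]; linarith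
  · rw [one_div_mul_eq_div, div_le_one hpos]; linarith
  · have hN := hg.N_ge
    have hN0 : 0 < -b 0 := by linarith
    have hσ : √(-b 0) ^ 2 = -b 0 := Real.sq_sqrt hN0.le
    have hD := fun r => hg.D_le hα0 hα1 hθ r
    rw [← hC2] at hD
    refine ⟨hα0, hα1, hg, K1, K2, hn1, hnR, rfl, by positivity, hh1, Real.sqrt_pos.2 hN0, by rw [hσ]; ring, rfl,
      Finset.sum_nonneg fun _ _ => abs_nonneg _, ?_, ?_, ?_, fun r => ?_⟩
    · refine (one_div_le_one_div_of_le (Real.sqrt_pos.2 hc) (Real.sqrt_le_sqrt hN)).trans K6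
    · rw [hσ]
      calc SS α R b ≤ ∑ r ∈ Finset.range R, C2 * (-b 0) := Finset.sum_le_sum fun r _ => hD r
        _ = (R * C2) * (-b 0) := by rw [Finset.sum_const, Finset.card_range, nsmul_eq_mul]; ring
        _ ≤ _ := mul_le_mul_of_nonneg_right K3 hN0.le
    · rw [hσ, one_div_mul_eq_div]
      exact (hg.hN hα0 hα1 hθ hn1).trans K7
    · rw [hσ]
      have h1 := (le_abs_self _).trans (hD r)
      have h2 := pp_le_one hα0 hα1 r
      rw [DD] at h1
      calc b (r + 1) ≤ C2 * (-b 0) + pp α (r + 1) * (-b 0) := by linarith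
        _ ≤ C2 * (-b 0) + 1 * (-b 0) := add_le_add le_rfl (mul_le_mul_of_nonneg_right h2 hN0.le)
        _ = (C2 + 1) * (-b 0) := by ring
        _ ≤ _ := mul_le_mul_of_nonneg_right K4 hN0.le

def PH (m : ℕ → Measure (ℕ → ℝ)) (R n : ℕ) (t : ℕ → ℝ) : ℂ := ∫ b, Complex.exp (XX R t b * Complex.I) ∂ m n

def del (α : ℝ) (m : ℕ → Measure (ℕ → ℝ)) (R n : ℕ) : ℝ := ∫ b, (1 / √(-b 0) + SS α R b / √(-b 0) ^ 2) ∂ m n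

theorem Chain.tend_del (h : Chain α θ m) (hα0 : 0 < α) (hα1 : α < 1) (hθ : 0 < α + θ) (R : ℕ) :
    Tendsto (del α m R) atTop (𝓝 0) := by
  have h1 := (h.tend_half hα0 hα1 hθ).add (tendsto_finsetSum (Finset.range R) fun r _ => h.tend_D hα0 hα1 hθ r)
  simp only [Finset.sum_const_zero, add_zero] at h1
  refine h1.congr' ?_
  filter_upwards [eventually_ge_atTop 1] with n hn
  rw [← integral_finsetSum _ fun r _ => h.intg hn _, ← integral_add (h.intg hn _) (h.intg hn _), del]
  refine integral_congr_ae ?_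
  filter_upwards [h.good n hn] with b hg
  have hc := c0_pos hα0 hθ
  have hN := hg.N_ge
  rw [Real.sq_sqrt (by linarith), one_div, SS, Finset.sum_div]

theorem Chain.PH_step (h : Chain α θ m) (hα0 : 0 < α) (hα1 : α < 1) (hθ : 0 < α + θ) {R n : ℕ} {K : ℝ} {t : ℕ → ℝ} {A : ℝ}
    (hn : 1 ≤ n) (hsm : 29 * K ^ 5 * (1 / ((n:ℝ) + θ)) ≤ 2)
    (hP : ∀ b, Good α θ n b → Pt α θ K R n b (1 / ((n:ℝ) + θ)) (√(-b 0)) (SS α R b))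
    (ht : Adm α R t) (hA : ∀ r, |t r| ≤ A) (hAK : A ≤ K) :
    ‖PH m R (n + 1) t - PH m R n (t + mv α (1 / ((n:ℝ) + θ)) t) *
      (Real.exp ((VV α R (t + mv α (1 / ((n:ℝ) + θ)) t) - VV α R t) / 2) : ℂ)‖
      ≤ 1400 * K ^ 11 * ((1 / ((n:ℝ) + θ)) * A) * del α m R n := by
  have := h.prob n
  rw [PH, PH, h.stepC hn, ← integral_mul_const, ← integral_sub (h.intg hn _) (h.intg hn _), del, ← integral_const_mul]
  refine (norm_integral_le_integral_norm _).trans (integral_mono_ae (h.intg hn _) (h.intg hn _) ?_)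
  filter_upwards [h.good n hn] with b hg
  exact (hP b hg).main ht hA hAK hsm (hg.pw_nn hα0 hα1 hθ hn)

end EP

namespace EP

variable {α θ : ℝ} {m : ℕ → Measure (ℕ → ℝ)}
theorem abs_exp_sub_one_bd (x B : ℝ) (hx : |x| ≤ B) : |Real.exp x - 1| ≤ Real.exp B * |x| := by
  have hB : 0 ≤ B := (abs_nonneg _).trans hx
  rcases le_total 0 x with h | h
  · rw [abs_of_nonneg h, abs_of_nonneg (by linarith [Real.add_one_le_exp x])]
    rw [abs_of_nonneg h] at hx
    have h1 : Real.exp x ≤ Real.exp B := Real.exp_le_exp.2 hx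
    have h2 := Real.add_one_le_exp (-x)
    have h3 : Real.exp x * Real.exp (-x) = 1 := by rw [← Real.exp_add]; simp
    have h4 := Real.exp_pos x
    nlinarith
  · have h1 := Real.add_one_le_exp x
    have h2 : Real.exp x ≤ 1 := Real.exp_le_one_iff.2 h
    have h3 : 1 ≤ Real.exp B := Real.one_le_exp hB
    rw [abs_of_nonpos h, abs_of_nonpos (by linarith)]
    nlinarith

theorem Chain.fdd (h : Chain α θ m) (hα0 : 0 < α) (hα1 : α < 1) (hθ : 0 < α + θ) {R : ℕ} {t : ℕ → ℝ} (ht : Adm α R t) :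
    Tendsto (fun n => ∫ b, Complex.exp (XX R t b * Complex.I) ∂ m n) atTop (𝓝 ((Real.exp (-(VV α R t) / 2) : ℝ) : ℂ)) := by
  obtain ⟨A0, hA0⟩ : ∃ A0, ∀ r, |t r| ≤ A0 := by
    refine ⟨∑ r ∈ Finset.range (R + 1), |t r|, fun r => ?_⟩
    by_cases hr : r ≤ R
    · exact Finset.single_le_sum (f := fun r => |t r|) (fun _ _ => abs_nonneg _) (Finset.mem_range.2 (by omega))
    · rw [ht.z r (by omega), abs_zero]; exact Finset.sum_nonneg fun _ _ => abs_nonneg _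
  have hA00 : 0 ≤ A0 := (abs_nonneg _).trans (hA0 0)
  obtain ⟨K, K1, KR, KA, n0, hn0, hP⟩ := exists_Pt hα0 hα1 hθ R A0
  set E := Real.exp (K * K ^ 2 / 2) with hE
  have E1 : 1 ≤ E := Real.one_le_exp (by positivity)
  have V_le : ∀ (A : ℝ) (u : ℕ → ℝ), (∀ r, |u r| ≤ A) → A ≤ A0 → |VV α R u / 2| ≤ K * A ^ 2 / 2 ∧ |VV α R u / 2| ≤ K * K ^ 2 / 2 := by
    intro A u hu hA
    have hA' : 0 ≤ A := (abs_nonneg _).trans (hu 0)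
    have h1 := VV_le hα0 hα1 R hu
    have h2 : ((R:ℝ) + 1) * A ^ 2 ≤ K * A ^ 2 := by gcongr
    have h3 : K * A ^ 2 ≤ K * K ^ 2 := by gcongr; linarith
    rw [abs_div, abs_two]
    constructor <;> linarith
  -- base
  have base : ∃ c0 : ℝ, 0 ≤ c0 ∧ ∀ (A : ℝ) (u : ℕ → ℝ), Adm α R u → (∀ r, |u r| ≤ A) → A ≤ A0 →
      ‖PH m R n0 u * (Real.exp (VV α R u / 2) : ℂ) - 1‖ ≤ c0 * A := by
    refine ⟨(∫ b, SS α R b / √(-b 0) ∂ m n0) * E + E * (K ^ 2 / 2), ?_, fun A u hu huA hA => ?_⟩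
    · have Jnn : 0 ≤ ∫ b, SS α R b / √(-b 0) ∂ m n0 := integral_nonneg fun b => div_nonneg (Finset.sum_nonneg fun _ _ => abs_nonneg _) (Real.sqrt_nonneg _)
      positivity
    have hA' : 0 ≤ A := (abs_nonneg _).trans (huA 0)
    have Jnn : 0 ≤ ∫ b, SS α R b / √(-b 0) ∂ m n0 := integral_nonneg fun b => div_nonneg (Finset.sum_nonneg fun _ _ => abs_nonneg _) (Real.sqrt_nonneg _)
    have := h.prob n0
    have b1 : ‖PH m R n0 u - 1‖ ≤ A * ∫ b, SS α R b / √(-b 0) ∂ m n0 := by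
      have : PH m R n0 u - 1 = ∫ b, (Complex.exp (XX R u b * Complex.I) - 1) ∂ m n0 := by
        rw [integral_sub (h.intg hn0 _) (h.intg hn0 _)]; simp [PH]
      rw [this, ← integral_const_mul]
      refine (norm_integral_le_integral_norm _).trans (integral_mono (h.intg hn0 _) (h.intg hn0 _) fun b => ?_)
      refine (cexp_zero _).trans ?_
      rw [XX, abs_div, abs_of_nonneg (Real.sqrt_nonneg _), ← mul_div_assoc]
      gcongr
      exact hu.YY_le b huA
    obtain ⟨v1, v2⟩ := V_le A u huA hA
    have b2 := abs_exp_sub_one_bd _ _ v2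
    have b3 : Real.exp (VV α R u / 2) ≤ E := Real.exp_le_exp.2 ((le_abs_self _).trans v2)
    have e : PH m R n0 u * (Real.exp (VV α R u / 2) : ℂ) - 1 =
        (PH m R n0 u - 1) * (Real.exp (VV α R u / 2) : ℂ) + ((Real.exp (VV α R u / 2) - 1 : ℝ) : ℂ) := by push_cast; ring
    rw [e]
    refine (norm_add_le _ _).trans ?_
    rw [norm_mul, Complex.norm_real, Complex.norm_real, Real.norm_eq_abs, Real.norm_eq_abs, abs_of_pos (Real.exp_pos _)]
    calc _ ≤ (A * ∫ b, SS α R b / √(-b 0) ∂ m n0) * E + E * (K * A ^ 2 / 2) := by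
          gcongr
          exact b2.trans (by gcongr)
      _ = (A * ∫ b, SS α R b / √(-b 0) ∂ m n0) * E + E * (K * (A * A) / 2) := by ring
      _ ≤ (A * ∫ b, SS α R b / √(-b 0) ∂ m n0) * E + E * (K * (K * A) / 2) := by
          gcongr; linarith
      _ = _ := by ring
  obtain ⟨c0, hc0, hbase⟩ := base
  have hd0 : ∀ n, 0 ≤ del α m R n := fun n => integral_nonneg fun b =>
    add_nonneg (by positivity) (div_nonneg (Finset.sum_nonneg fun _ _ => abs_nonneg _) (by positivity))
  let hh : ℕ → ℝ := fun k => 1 / (((n0 + k : ℕ) : ℝ) + θ)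
  let c : ℕ → ℝ := fun k => Nat.rec c0 (fun k ck => (1 - α / 2 * hh k) * ck +
    α / 2 * hh k * (2 / α * (E * (1400 * K ^ 11)) * del α m R (n0 + k))) k
  have c_succ : ∀ k, c (k + 1) = (1 - α / 2 * hh k) * c k +
    α / 2 * hh k * (2 / α * (E * (1400 * K ^ 11)) * del α m R (n0 + k)) := fun k => rfl
  have hh0 : ∀ k, 0 < hh k := fun k => one_div_pos.2 (hP (n0 + k) (by omega)).1
  have hh1 : ∀ k, hh k ≤ 1 := fun k => (hP (n0 + k) (by omega)).2.2.2.1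
  have hah : ∀ k, α / 2 * hh k ≤ 1 := fun k => by nlinarith [hh0 k, hh1 k]
  have c_nn : ∀ k, 0 ≤ c k := by
    intro k
    induction k with
    | zero => exact hc0
    | succ k ih =>
      rw [c_succ]
      have := hah k; have := hd0 (n0 + k); have := hh0 k
      have : 0 ≤ 1 - α / 2 * hh k := by linarith
      positivity
  have clim : Tendsto c atTop (𝓝 0) := by
    refine dis (a := α / 2) (by positivity) (fun k => (hh0 k).le) hah (harm n0 θ (hP n0 le_rfl).1) ?_ c_nn (fun k => (c_succ k).le)
    have := (((tendsto_add_atTop_iff_nat n0).2 (h.tend_del hα0 hα1 hθ R))).const_mul (2 / α * (E * (1400 * K ^ 11)))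
    rw [mul_zero] at this
    refine this.congr fun k => by rw [add_comm k n0]
  have main : ∀ k, ∀ (A : ℝ) (u : ℕ → ℝ), Adm α R u → (∀ r, |u r| ≤ A) → A ≤ A0 →
      ‖PH m R (n0 + k) u * (Real.exp (VV α R u / 2) : ℂ) - 1‖ ≤ c k * A := by
    intro k
    induction k with
    | zero => exact hbase
    | succ k ih =>
      intro A u hu huA hA
      have hA' : 0 ≤ A := (abs_nonneg _).trans (huA 0)
      obtain ⟨q1, q2, q3, q4, q5⟩ := hP (n0 + k) (by omega)
      have st := h.PH_step hα0 hα1 hθ (by omega) q2 q5 hu huA (hA.trans KA)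
      have ct := hu.contr hα0 hα1 huA (hh0 k).le q3 q4
      have i := ih _ _ (hu.add (hu.mv (hh k))) ct (by nlinarith [mul_nonneg (mul_nonneg hα0.le (hh0 k).le) hA'])
      change ‖_ - PH m R (n0 + k) (u + mv α (hh k) u) * (Real.exp ((VV α R (u + mv α (hh k) u) - VV α R u) / 2) : ℂ)‖
        ≤ 1400 * K ^ 11 * (hh k * A) * _ at st
      generalize u + mv α (hh k) u = u' at *
      obtain ⟨v1, v2⟩ := V_le A u huA hA
      have b3 : Real.exp (VV α R u / 2) ≤ E := Real.exp_le_exp.2 ((le_abs_self _).trans v2)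
      have ex : Real.exp ((VV α R u' - VV α R u) / 2) * Real.exp (VV α R u / 2) = Real.exp (VV α R u' / 2) := by
        rw [← Real.exp_add]; ring_nf
      have e : PH m R (n0 + (k + 1)) u * (Real.exp (VV α R u / 2) : ℂ) - 1 =
        (PH m R (n0 + k + 1) u - PH m R (n0 + k) u' * (Real.exp ((VV α R u' - VV α R u) / 2) : ℂ)) * (Real.exp (VV α R u / 2) : ℂ)
        + (PH m R (n0 + k) u' * (Real.exp (VV α R u' / 2) : ℂ) - 1) := by
        rw [← ex, ← add_assoc]; push_cast; ring
      rw [e]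
      refine (norm_add_le _ _).trans ?_
      rw [norm_mul, Complex.norm_real, Real.norm_eq_abs, abs_of_pos (Real.exp_pos _)]
      have hd := hd0 (n0 + k)
      have hk := hh0 k
      calc _ ≤ (1400 * K ^ 11 * (hh k * A) * del α m R (n0 + k)) * E + c k * ((1 - α / 2 * hh k) * A) := by gcongr
        _ = _ := by rw [c_succ]; field_simp; ring
  have lim1 : Tendsto (fun k => PH m R (n0 + k) t * (Real.exp (VV α R t / 2) : ℂ)) atTop (𝓝 1) := by
    rw [tendsto_iff_norm_sub_tendsto_zero]
    have := clim.mul_const A0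
    rw [zero_mul] at this
    exact squeeze_zero (fun _ => norm_nonneg _) (fun k => main k A0 t ht hA0 le_rfl) this
  have lim2 := lim1.mul_const ((Real.exp (-(VV α R t) / 2) : ℝ) : ℂ)
  have ex : (Real.exp (VV α R t / 2) : ℂ) * ((Real.exp (-(VV α R t) / 2) : ℝ) : ℂ) = 1 := by
    rw [← Complex.ofReal_mul, ← Real.exp_add]; ring_nf; simp
  simp only [mul_assoc, ex, mul_one, one_mul] at lim2
  refine (tendsto_add_atTop_iff_nat n0).1 (lim2.congr fun k => by rw [PH, add_comm n0 k])

end EP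

namespace EP

variable {α θ : ℝ} {m : ℕ → Measure (ℕ → ℝ)}
theorem sct : SecondCountableTopology ellTwo := by
  have hsep : TopologicalSpace.IsSeparable
      (Submodule.span ℝ (Set.range fun r : ℕ => (lp.single 2 r (1:ℝ) : ellTwo)) : Set ellTwo) :=
    TopologicalSpace.IsSeparable.span (Set.countable_range _).isSeparable
  have hs2 := hsep.closure
  have : closure (Submodule.span ℝ (Set.range fun r : ℕ => (lp.single 2 r (1:ℝ) : ellTwo)) :
      Set ellTwo) = Set.univ := by
    refine Set.eq_univ_of_forall fun x => ?_
    have h := (lp.hasSum_single (p := 2) (by norm_num) x).tendsto_sum_nat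
    refine mem_closure_of_tendsto h (Eventually.of_forall fun n => ?_)
    refine Submodule.sum_mem _ fun r _ => ?_
    have : (lp.single 2 r (x r) : ellTwo) = x r • (lp.single 2 r (1:ℝ) : ellTwo) := by
      rw [← lp.single_smul]; simp
    rw [this]
    exact Submodule.smul_mem _ _ (Submodule.subset_span ⟨r, rfl⟩)
  rw [this, TopologicalSpace.isSeparable_univ_iff] at hs2
  exact UniformSpace.secondCountable_of_separable ellTwo

theorem tight_seq (ρ : ℕ → ProbabilityMeasure ellTwo)
    (h : ∀ ε : ENNReal, 0 < ε → ∀ δ : ℝ, 0 < δ → ∃ C : Set ellTwo, IsCompact C ∧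
      ∀ᶠ n in atTop, (ρ n : Measure ellTwo) (Metric.cthickening δ C)ᶜ ≤ ε) :
    IsTightMeasureSet (Set.range fun n => (ρ n : Measure ellTwo)) := by
  have := sct
  have h' : ∀ ε : ENNReal, 0 < ε → ∀ δ : ℝ, 0 < δ → ∃ C : Set ellTwo, IsCompact C ∧
      ∀ n, (ρ n : Measure ellTwo) (Metric.cthickening δ C)ᶜ ≤ ε := by
    intro ε hε δ hδ
    obtain ⟨C, hC, hn⟩ := h ε hε δ hδ
    obtain ⟨N, hN⟩ := eventually_atTop.1 hn
    have hsing : ∀ n, ∃ D : Set ellTwo, IsCompact D ∧ (ρ n : Measure ellTwo) Dᶜ ≤ ε := by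
      intro n
      have := isTightMeasureSet_iff_exists_isCompact_measure_compl_le.1
        (isTightMeasureSet_singleton (μ := (ρ n : Measure ellTwo))) ε hε
      obtain ⟨D, hD, hD2⟩ := this
      exact ⟨D, hD, hD2 _ rfl⟩
    choose D hD hD2 using hsing
    refine ⟨C ∪ ⋃ n ∈ Finset.range N, D n,
      hC.union ((Finset.range N).isCompact_biUnion fun n _ => hD n), fun n => ?_⟩
    by_cases hnN : N ≤ n
    · refine (measure_mono ?_).trans (hN n hnN)
      exact Set.compl_subset_compl.2 (Metric.cthickening_subset_of_subset _ Set.subset_union_left)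
    · refine (measure_mono ?_).trans (hD2 n)
      refine Set.compl_subset_compl.2 (Set.Subset.trans ?_ (Metric.self_subset_cthickening _))
      refine Set.Subset.trans ?_ Set.subset_union_right
      exact Set.subset_biUnion_of_mem (u := fun n => D n)
        (Finset.mem_coe.2 (Finset.mem_range.2 (not_le.1 hnN)))
  rw [isTightMeasureSet_iff_exists_isCompact_measure_compl_le]
  intro ε hε
  obtain ⟨e, he, hes⟩ := ENNReal.exists_pos_sum_of_countable' hε.ne' ℕ
  choose C hC hCn using fun j : ℕ => h' (e j) (he j) (1 / ((j:ℝ) + 1)) (by positivity)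
  refine ⟨⋂ j : ℕ, Metric.cthickening (1 / ((j:ℝ) + 1)) (C j), ?_, ?_⟩
  · refine TotallyBounded.isCompact_of_isClosed ?_
      (isClosed_iInter fun j => Metric.isClosed_cthickening)
    rw [Metric.totallyBounded_iff]
    intro δ hδ
    obtain ⟨j, hj⟩ := exists_nat_one_div_lt (show 0 < δ/2 by positivity)
    obtain ⟨t, ht, hCt⟩ := Metric.totallyBounded_iff.1 (hC j).totallyBounded (δ/2) (by positivity)
    refine ⟨t, ht, fun x hx => ?_⟩
    have hx := Set.mem_iInter.1 hx j
    rw [(hC j).cthickening_eq_biUnion_closedBall (by positivity)] at hx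
    obtain ⟨c, hc, hxc⟩ := Set.mem_iUnion₂.1 hx
    obtain ⟨y, hy, hcy⟩ := Set.mem_iUnion₂.1 (hCt hc)
    refine Set.mem_iUnion₂.2 ⟨y, hy, ?_⟩
    rw [Metric.mem_closedBall] at hxc
    rw [Metric.mem_ball] at hcy ⊢
    linarith [dist_triangle x c y]
  · rintro _ ⟨n, rfl⟩
    rw [Set.compl_iInter]
    exact (measure_iUnion_le _).trans ((ENNReal.tsum_le_tsum fun j => hCn j n).trans hes.le)
end EP

namespace EP

variable {α θ : ℝ} {m : ℕ → Measure (ℕ → ℝ)}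
theorem lim_exists (ρ : ℕ → ProbabilityMeasure ellTwo) (V : ellTwo → ℝ)
    (hT : IsTightMeasureSet (Set.range fun n => (ρ n : Measure ellTwo)))
    (hc : ∀ (x : ellTwo) (R : ℕ), (∀ r, R ≤ r → x r = 0) →
      Tendsto (fun n => charFun (ρ n : Measure ellTwo) x) atTop
        (𝓝 ((Real.exp (-(V x)/2) : ℝ) : ℂ)))
    (hV : ∀ x : ellTwo, Tendsto (fun R : ℕ =>
      V (∑ r ∈ Finset.range R, (lp.single 2 r (x r) : ellTwo))) atTop (𝓝 (V x))) :
    ∃ ν : ProbabilityMeasure ellTwo, (∀ x, charFun (ν : Measure ellTwo) x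
      = ((Real.exp (-(V x)/2) : ℝ) : ℂ)) ∧ Tendsto ρ atTop (𝓝 ν) := by
  have := sct
  have h_compact : IsCompact (closure (Set.range ρ)) := by
    refine isCompact_closure_of_isTightMeasureSet ?_
    convert! hT using 1
    ext x; simp
  have key : ∀ U : Ultrafilter ℕ, (U : Filter ℕ) ≤ atTop → ∃ ν : ProbabilityMeasure ellTwo,
      Tendsto ρ U (𝓝 ν) ∧ (∀ x, charFun (ν : Measure ellTwo) x
      = ((Real.exp (-(V x)/2) : ℝ) : ℂ)) := by
    intro U hU
    obtain ⟨ν, -, hν⟩ := h_compact.ultrafilter_le_nhds (U.map ρ)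
      (.trans (by simp) (monotone_principal subset_closure))
    have hν : Tendsto ρ U (𝓝 ν) := hν
    refine ⟨ν, hν, ?_⟩
    have hfin : ∀ (x : ellTwo) (R : ℕ), (∀ r, R ≤ r → x r = 0) →
        charFun (ν : Measure ellTwo) x = ((Real.exp (-(V x)/2) : ℝ) : ℂ) := by
      intro x R hx
      refine tendsto_nhds_unique (f := fun n => charFun (ρ n : Measure ellTwo) x) ?_
        ((hc x R hx).mono_left hU)
      have h2 := (ProbabilityMeasure.tendsto_iff_forall_integral_rclike_tendsto ℂ).1 hν
        (BoundedContinuousFunction.innerProbChar x)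
      simpa only [charFun_eq_integral_innerProbChar] using h2
    intro x
    have hx := (lp.hasSum_single (p := 2) (by norm_num) x).tendsto_sum_nat
    refine tendsto_nhds_unique (((continuous_charFun (μ := (ν : Measure ellTwo))).tendsto x).comp hx) ?_
    have h3 : Tendsto (fun R : ℕ => ((Real.exp (-(V (∑ r ∈ Finset.range R,
        (lp.single 2 r (x r) : ellTwo)))/2) : ℝ) : ℂ)) atTop (𝓝 ((Real.exp (-(V x)/2) : ℝ) : ℂ)) := by
      refine (Complex.continuous_ofReal.tendsto _).comp ?_
      exact (Real.continuous_exp.tendsto _).comp ((hV x).neg.div_const 2)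
    refine h3.congr fun R => ?_
    refine (hfin _ R fun r hr => ?_).symm
    simp only [lp.coeFn_sum, Finset.sum_apply, lp.single_apply]
    refine Finset.sum_eq_zero fun i hi => ?_
    rw [Pi.single_eq_of_ne]
    have := Finset.mem_range.1 hi
    omega
  obtain ⟨ν, -, hν⟩ := key (Ultrafilter.of atTop) (Ultrafilter.of_le _)
  refine ⟨ν, hν, ?_⟩
  refine (Filter.tendsto_iff_ultrafilter _ _ _).2 fun U hU => ?_
  obtain ⟨ν', h1, h2⟩ := key U hU
  have : ν' = ν := by
    have e : (ν' : Measure ellTwo) = (ν : Measure ellTwo) :=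
      Measure.ext_of_charFun (funext fun x => (h2 x).trans (hν x).symm)
    exact Subtype.ext e
  rw [← this]; exact h1

variable {p : ℕ → ℝ}

def VV2 (p : ℕ → ℝ) (x : ellTwo) : ℝ := ∑' r, p r * x r * x r - (∑' r, p r * x r) ^ 2

def Gam (p : ℕ → ℝ) (x y : ellTwo) : ℝ :=
  ∑' r, p r * x r * y r - (∑' r, p r * x r) * (∑' r, p r * y r)

theorem ell_bdd (x : ellTwo) (r : ℕ) : |x r| ≤ ‖x‖ := by
  simpa using lp.norm_apply_le_norm (p := 2) (by norm_num) x r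

theorem sum1 (hp : ∀ r, 0 ≤ p r) (hs : Summable p) (x : ellTwo) : Summable fun r => p r * x r := by
  refine Summable.of_norm_bounded (hs.mul_right ‖x‖) fun r => ?_
  rw [norm_mul, Real.norm_eq_abs, Real.norm_eq_abs, abs_of_nonneg (hp r)]
  exact mul_le_mul_of_nonneg_left (ell_bdd x r) (hp r)

theorem sum2 (hp : ∀ r, 0 ≤ p r) (hs : Summable p) (x y : ellTwo) :
    Summable fun r => p r * x r * y r := by
  refine Summable.of_norm_bounded (hs.mul_right (‖x‖*‖y‖)) fun r => ?_
  rw [norm_mul, norm_mul, Real.norm_eq_abs, Real.norm_eq_abs, Real.norm_eq_abs,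
    abs_of_nonneg (hp r), mul_assoc]
  exact mul_le_mul_of_nonneg_left (mul_le_mul (ell_bdd x r) (ell_bdd y r) (abs_nonneg _)
    (norm_nonneg _)) (hp r)

theorem VV2_smul (s : ℝ) (x : ellTwo) : VV2 p (s • x) = s^2 * VV2 p x := by
  unfold VV2
  have e1 : ∀ r, p r * (s • x) r * (s • x) r = s^2 * (p r * x r * x r) := by
    intro r; simp only [lp.coeFn_smul, Pi.smul_apply, smul_eq_mul]; ring
  have e2 : ∀ r, p r * (s • x) r = s * (p r * x r) := by
    intro r; simp only [lp.coeFn_smul, Pi.smul_apply, smul_eq_mul]; ring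
  rw [tsum_congr e1, tsum_congr e2, tsum_mul_left, tsum_mul_left]; ring

theorem VV2_add (hp : ∀ r, 0 ≤ p r) (hs : Summable p) (x y : ellTwo) :
    VV2 p (x + y) = VV2 p x + 2 * Gam p x y + VV2 p y := by
  unfold VV2 Gam
  have e1 : ∀ r, p r * (x+y) r * (x+y) r
      = p r * x r * x r + 2 * (p r * x r * y r) + p r * y r * y r := by
    intro r; simp only [lp.coeFn_add, Pi.add_apply]; ring
  have e2 : ∀ r, p r * (x+y) r = p r * x r + p r * y r := by
    intro r; simp only [lp.coeFn_add, Pi.add_apply]; ring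
  rw [tsum_congr e1, tsum_congr e2, Summable.tsum_add (((sum2 hp hs x x)).add ((sum2 hp hs x y).mul_left 2)) (sum2 hp hs y y),
    Summable.tsum_add (sum2 hp hs x x) ((sum2 hp hs x y).mul_left 2),
    Summable.tsum_add (sum1 hp hs x) (sum1 hp hs y), tsum_mul_left]
  ring

theorem trunc_apply (x : ellTwo) (R r : ℕ) :
    (∑ i ∈ Finset.range R, (lp.single 2 i (x i) : ellTwo)) r = if r < R then x r else 0 := by
  simp only [lp.coeFn_sum, Finset.sum_apply, lp.single_apply]
  simp [Pi.single_apply]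

theorem VV2_trunc (hp : ∀ r, 0 ≤ p r) (hs : Summable p) (x : ellTwo) :
    Tendsto (fun R : ℕ => VV2 p (∑ r ∈ Finset.range R, (lp.single 2 r (x r) : ellTwo)))
      atTop (𝓝 (VV2 p x)) := by
  unfold VV2
  simp only [trunc_apply]
  have e1 : ∀ R : ℕ, ∑' r, p r * (if r < R then x r else 0) * (if r < R then x r else 0)
      = ∑ r ∈ Finset.range R, p r * x r * x r := by
    intro R
    rw [tsum_eq_sum (s := Finset.range R)]
    · exact Finset.sum_congr rfl fun r hr => by simp [Finset.mem_range.1 hr]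
    · intro r hr; simp [show ¬ r < R by simpa using hr]
  have e2 : ∀ R : ℕ, ∑' r, p r * (if r < R then x r else 0)
      = ∑ r ∈ Finset.range R, p r * x r := by
    intro R
    rw [tsum_eq_sum (s := Finset.range R)]
    · exact Finset.sum_congr rfl fun r hr => by simp [Finset.mem_range.1 hr]
    · intro r hr; simp [show ¬ r < R by simpa using hr]
  simp only [e1, e2]
  exact ((sum2 hp hs x x).hasSum.tendsto_sum_nat).sub ((sum1 hp hs x).hasSum.tendsto_sum_nat.pow 2)

theorem gauss_of (hp : ∀ r, 0 ≤ p r) (hs : Summable p) (ν : Measure ellTwo) [IsProbabilityMeasure ν]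
    (h : ∀ x, charFun ν x = ((Real.exp (-(VV2 p x)/2) : ℝ) : ℂ)) :
    (∀ x : ellTwo, ν.map (fun g => ⟪x, g⟫) = gaussianReal 0 (Real.toNNReal (VV2 p x))) ∧
    (∀ x y : ellTwo, ∫ g, ⟪x, g⟫ * ⟪y, g⟫ ∂ν = Gam p x y) := by
  have := sct
  have hm : ∀ x : ellTwo, Measurable fun g : ellTwo => ⟪x, g⟫ := fun x =>
    (continuous_const.inner continuous_id).measurable
  have hV0 : ∀ x, 0 ≤ VV2 p x := by
    intro x
    have h1 := norm_charFun_le_one (μ := ν) x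
    rw [h x, Complex.norm_real, Real.norm_eq_abs, abs_of_pos (Real.exp_pos _),
      Real.exp_le_one_iff] at h1
    linarith
  have hmap : ∀ x : ellTwo,
      ν.map (fun g => ⟪x, g⟫) = gaussianReal 0 (Real.toNNReal (VV2 p x)) := by
    intro x
    have := Measure.isProbabilityMeasure_map (μ := ν) (hm x).aemeasurable
    refine Measure.ext_of_charFun (funext fun s => ?_)
    rw [charFun_gaussianReal, charFun_apply_real, integral_map (hm x).aemeasurable (by fun_prop)]
    have h2 := h (s • x)
    rw [charFun_apply, VV2_smul] at h2
    have e : ∀ g : ellTwo, Complex.exp (s * (⟪x, g⟫ : ℝ) * Complex.I)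
        = Complex.exp ((⟪g, s • x⟫ : ℝ) * Complex.I) := by
      intro g; rw [inner_smul_right, real_inner_comm]; push_cast; rfl
    simp only [e]
    rw [h2, Real.coe_toNNReal _ (hV0 x), Complex.ofReal_exp]
    push_cast; congr 1; ring
  refine ⟨hmap, ?_⟩
  have hL : ∀ x : ellTwo, MemLp (fun g => ⟪x, g⟫) 2 ν := by
    intro x
    have h1 : MemLp id 2 (ν.map (fun g => ⟪x, g⟫)) := by
      rw [hmap x]; exact memLp_id_gaussianReal 2
    exact (memLp_map_measure_iff (by fun_prop) (hm x).aemeasurable).1 h1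
  have hsq : ∀ x : ellTwo, ∫ g, ⟪x, g⟫^2 ∂ν = VV2 p x := by
    intro x
    have h1 : ∫ s, s^2 ∂(ν.map (fun g => ⟪x, g⟫)) = VV2 p x := by
      rw [hmap x]
      have h2 := variance_fun_id_gaussianReal (μ := 0) (v := Real.toNNReal (VV2 p x))
      rw [variance_eq_integral measurable_id'.aemeasurable] at h2
      simpa [integral_id_gaussianReal, Real.coe_toNNReal _ (hV0 x)] using h2
    rw [integral_map (hm x).aemeasurable (by fun_prop)] at h1
    exact h1
  intro x y
  have h1 := hsq (x+y)
  rw [VV2_add hp hs] at h1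
  have e : ∀ g : ellTwo, ⟪x + y, g⟫^2 = ⟪x, g⟫^2 + 2 * (⟪x, g⟫ * ⟪y, g⟫) + ⟪y, g⟫^2 := by
    intro g; rw [inner_add_left]; ring
  simp only [e] at h1
  have i1 := (hL x).integrable_sq
  have i2 := (hL y).integrable_sq
  have i3 : Integrable (fun g : ellTwo => ⟪x, g⟫ * ⟪y, g⟫) ν := (hL x).integrable_mul (hL y)
  have i4 : Integrable (fun g : ellTwo => ⟪x, g⟫^2 + 2 * (⟪x, g⟫ * ⟪y, g⟫)) ν :=
    i1.add (i3.const_mul 2)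
  rw [integral_add i4 i2, integral_add i1 (i3.const_mul 2),
    integral_const_mul, hsq, hsq] at h1
  linarith
end EP

namespace EP

variable {α θ : ℝ} {m : ℕ → Measure (ℕ → ℝ)}
theorem pvec_mem (hα0 : 0 < α) (hα1 : α < 1) :
    Memℓp (fun r : ℕ => pp α (r + 1)) 2 := by
  refine memℓp_gen ?_
  have h := (pp_hasSum hα0 hα1).summable
  refine Summable.of_nonneg_of_le (fun r => by positivity) (fun r => ?_) h
  have h0 := pp_pos hα0 hα1 r
  have h1 := pp_le_one hα0 hα1 r
  rw [Real.norm_eq_abs, abs_of_pos h0]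
  norm_num
  nlinarith

def pvec (hα0 : 0 < α) (hα1 : α < 1) : ellTwo := ⟨fun r : ℕ => pp α (r + 1), pvec_mem hα0 hα1⟩

def qq (θ : ℝ) (hα0 : 0 < α) (hα1 : α < 1) (n : ℕ) (b : ℕ → ℝ) : ellTwo :=
  (∑ r ∈ Finset.range n, (b (r+1) / √(-b 0 - θ / α)) • (lp.single 2 r (1:ℝ) : ellTwo))
    - √(-b 0 - θ / α) • pvec hα0 hα1

theorem qq_meas (hα0 : 0 < α) (hα1 : α < 1) (n : ℕ) : Measurable (qq θ hα0 hα1 n) := by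
  have := sct
  unfold qq
  have hb : ∀ r : ℕ, Measurable fun b : ℕ → ℝ => b r := fun r => measurable_pi_apply r
  refine Measurable.sub (Finset.measurable_fun_sum _ fun r _ => ?_) ?_
  · exact ((hb _).div ((hb 0).neg.sub_const _).sqrt).smul_const _
  · exact ((hb 0).neg.sub_const _).sqrt.smul_const _

theorem qq_apply (hα0 : 0 < α) (hα1 : α < 1) (n : ℕ) (b : ℕ → ℝ) (r : ℕ) :
    qq θ hα0 hα1 n b r = (if r < n then b (r+1) / √(-b 0 - θ / α) else 0)
      - √(-b 0 - θ / α) * pp α (r+1) := by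
  unfold qq
  rw [lp.coeFn_sub, Pi.sub_apply]
  congr 1
  rw [lp.coeFn_sum, Finset.sum_apply]
  simp only [lp.coeFn_smul, Pi.smul_apply, lp.single_apply, smul_eq_mul]
  simp [Pi.single_apply]

theorem Good.k1 {n : ℕ} {b : ℕ → ℝ} (hg : Good α θ n b) : 1 ≤ -b 0 - θ / α := by
  linarith [hg.N_ge]

theorem Good.qq {n : ℕ} {b : ℕ → ℝ} (hg : Good α θ n b) (hα0 : 0 < α) (hα1 : α < 1) (r : ℕ) :
    qq θ hα0 hα1 n b r = (DD α (r+1) b + θ / α * pp α (r+1)) / √(-b 0 - θ / α) := by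
  rw [qq_apply]
  have h1 := hg.k1
  have hs : 0 < √(-b 0 - θ / α) := Real.sqrt_pos.2 (by linarith)
  have h2 : √(-b 0 - θ / α) ^ 2 = -b 0 - θ / α := Real.sq_sqrt (by linarith)
  have h3 : (if r < n then b (r+1) / √(-b 0 - θ / α) else 0) = b (r+1) / √(-b 0 - θ / α) := by
    split_ifs with h
    · rfl
    · rw [hg.z (r+1) (by omega), zero_div]
  rw [h3, DD]
  generalize √(-b 0 - θ / α) = s at *
  rw [eq_div_iff hs.ne', sub_mul, div_mul_cancel₀ _ hs.ne']
  linear_combination - pp α (r+1) * h2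

theorem inner_fin (x y : ellTwo) (R : ℕ) (hx : ∀ r, R ≤ r → x r = 0) :
    ⟪y, x⟫ = ∑ r ∈ Finset.range R, x r * y r := by
  rw [lp.inner_eq_tsum, tsum_eq_sum (s := Finset.range R)]
  · rfl
  · intro r hr
    rw [hx r (by simpa using hr)]; simp

theorem sqrt_cmp {N k c c1 Y P : ℝ} (hk : 1 ≤ k) (hN : 0 < N) (hNk : N = k + c) (hY : |Y| ≤ c1 * N) :
    |(Y + c * P) / √k - Y / √N| ≤ (c1 * |c| + |c| * |P|) * √(1 + |c|) * (√N)⁻¹ := by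
  obtain ⟨s, hs, rfl⟩ : ∃ s, 0 < s ∧ k = s^2 := ⟨√k, Real.sqrt_pos.2 (by linarith), (Real.sq_sqrt (by linarith)).symm⟩
  obtain ⟨u, hu, rfl⟩ : ∃ u, 0 < u ∧ N = u^2 := ⟨√N, Real.sqrt_pos.2 hN, (Real.sq_sqrt hN.le).symm⟩
  rw [Real.sqrt_sq hs.le, Real.sqrt_sq hu.le]
  have hc1 : 0 ≤ c1 * u^2 := (abs_nonneg _).trans hY
  have hc1 : 0 ≤ c1 := nonneg_of_mul_nonneg_left hc1 (by positivity)
  have hus : u / s ≤ √(1 + |c|) := by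
    refine Real.le_sqrt_of_sq_le ?_
    rw [div_pow, div_le_iff₀ (by positivity), hNk]
    nlinarith [abs_nonneg c, le_abs_self c]
  have hs1 : 1 / s ≤ √(1 + |c|) * u⁻¹ := by
    rw [← div_eq_mul_inv, le_div_iff₀ hu]; rw [one_div, mul_comm, ← div_eq_mul_inv]; exact hus
  have e : (Y + c * P) / s - Y / u = (Y / u^2) * c * (u / (s + u)) * (1/s) + c * P * (1/s) := by
    have : c = u^2 - s^2 := by linarith
    rw [this]; field_simp; ring
  have h1 : |Y / u^2| ≤ c1 := by
    rw [abs_div, abs_of_pos (show 0 < u^2 by positivity), div_le_iff₀ (by positivity)]; exact hY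
  have h2 : u / (s + u) ≤ 1 := by rw [div_le_one (by positivity)]; linarith
  have h20 : 0 ≤ u / (s + u) := by positivity
  rw [e]
  calc _ ≤ |(Y / u^2) * c * (u / (s + u)) * (1/s)| + |c * P * (1/s)| := abs_add_le _ _
    _ = |Y / u^2| * |c| * (u / (s+u)) * (1/s) + |c| * |P| * (1/s) := by
        rw [abs_mul, abs_mul, abs_mul, abs_mul, abs_mul, abs_of_nonneg h20,
          abs_of_pos (show 0 < 1/s by positivity)]
    _ ≤ c1 * |c| * 1 * (1/s) + |c| * |P| * (1/s) := by gcongr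
    _ = (c1 * |c| + |c| * |P|) * (1/s) := by ring
    _ ≤ (c1 * |c| + |c| * |P|) * (√(1 + |c|) * u⁻¹) := by gcongr
    _ = _ := by ring

theorem cexp_lip (x y : ℝ) :
    ‖Complex.exp (x * Complex.I) - Complex.exp (y * Complex.I)‖ ≤ |x - y| := by
  have h := cexp_zero (x - y)
  have e : Complex.exp (x * Complex.I) - Complex.exp (y * Complex.I)
      = Complex.exp (y * Complex.I) * (Complex.exp ((x - y : ℝ) * Complex.I) - 1) := by
    rw [mul_sub, ← Complex.exp_add, mul_one]; congr 2; push_cast; ring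
  rw [e, norm_mul, Complex.norm_exp_ofReal_mul_I, one_mul]; exact h

theorem Chain.char (h : Chain α θ m) (hα0 : 0 < α) (hα1 : α < 1) (hθ : 0 < α + θ)
    (x : ellTwo) (R : ℕ) (hx : ∀ r, R ≤ r → x r = 0) :
    Tendsto (fun n => ∫ b, Complex.exp ((⟪qq θ hα0 hα1 n b, x⟫ : ℝ) * Complex.I) ∂ m n) atTop
      (𝓝 ((Real.exp (-(VV2 (fun r => pp α (r+1)) x)/2) : ℝ) : ℂ)) := by
  set P := ∑ r ∈ Finset.range R, pp α (r+1) * x r with hP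
  set t : ℕ → ℝ := fun r => if r = 0 then P else x (r-1) with ht
  have t0 : t 0 = P := by simp [ht]
  have ts : ∀ r, t (r+1) = x r := fun r => by simp [ht]
  have hA : Adm α R t := by
    refine ⟨fun r hr => ?_, ?_⟩
    · obtain ⟨s, rfl⟩ : ∃ s, r = s + 1 := ⟨r - 1, by omega⟩
      rw [ts]; exact hx s (by omega)
    · rw [Finset.sum_range_succ']
      simp only [ts, t0, pp_zero, hP]; ring
  have hVV : VV α R t = VV2 (fun r => pp α (r+1)) x := by
    unfold VV VV2
    rw [Finset.sum_range_succ', tsum_eq_sum (s := Finset.range R), tsum_eq_sum (s := Finset.range R)]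
    · simp only [ts, t0, pp_zero]
      rw [← hP]
      have : ∀ r, pp α (r+1) * x r^2 = pp α (r+1) * x r * x r := fun r => by ring
      simp only [this]; ring
    · intro r hr; rw [hx r (by simpa using hr)]; simp
    · intro r hr; rw [hx r (by simpa using hr)]; simp
  rw [← hVV]
  have hlim := h.fdd hα0 hα1 hθ hA
  have hc := c0_pos hα0 hθ
  set c := θ / α with hcdef
  set c1 := ∑ r ∈ Finset.range R, |x r| * (1 + |c| / (1 + c)) with hc1
  set A := (c1 * |c| + |c| * |P|) * √(1 + |c|) with hAdef
  have hdiff : Tendsto (fun n => (∫ b, Complex.exp ((⟪EP.qq θ hα0 hα1 n b, x⟫ : ℝ) * Complex.I) ∂ m n)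
      - ∫ b, Complex.exp (XX R t b * Complex.I) ∂ m n) atTop (𝓝 0) := by
    have hz := (h.tend_half hα0 hα1 hθ).const_mul A
    rw [mul_zero] at hz
    refine squeeze_zero_norm' ?_ hz
    filter_upwards [eventually_ge_atTop 1] with n hn
    rw [← integral_sub (h.intg hn _) (h.intg hn _), ← integral_const_mul]
    refine norm_integral_le_of_norm_le (h.intg hn _) ?_
    filter_upwards [h.good n hn] with b hg
    refine (cexp_lip _ _).trans ?_
    rw [inner_fin x _ R hx]
    have e1 : ∑ r ∈ Finset.range R, x r * EP.qq θ hα0 hα1 n b r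
        = (YY R t b + c * P) / √(-b 0 - c) := by
      rw [hA.YY_D, hP, Finset.mul_sum, ← Finset.sum_add_distrib, Finset.sum_div]
      refine Finset.sum_congr rfl fun r _ => ?_
      rw [hg.qq hα0 hα1, ts, ← hcdef]; ring
    rw [e1, XX]
    refine sqrt_cmp hg.k1 (by linarith [hg.N_ge]) (by ring) ?_
    rw [hA.YY_D, hc1, Finset.sum_mul]
    refine (Finset.abs_sum_le_sum_abs _ _).trans (Finset.sum_le_sum fun r _ => ?_)
    rw [ts, abs_mul, mul_assoc]
    exact mul_le_mul_of_nonneg_left (hg.D_le hα0 hα1 hθ r) (abs_nonneg _)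
  have := hdiff.add hlim
  simpa using this
end EP

namespace EP

variable {α θ : ℝ} {m : ℕ → Measure (ℕ → ℝ)}
theorem Chain.small (h : Chain α θ m) (hα0 : 0 < α) (hα1 : α < 1) (hθ : 0 < α + θ) {ε : ℝ} (hε : 0 < ε) :
    ∃ K > 0, ∀ n : ℕ, 1 ≤ n → ∀ f : (ℕ → ℝ) → ℝ, (∀ b, 0 ≤ f b) → ∀ c,
      ∫ b, f b ∂ m n ≤ c * (n:ℝ)^α → ∀ η > 0,
        m n {b | η * (-b 0) < f b} ≤ ENNReal.ofReal (ε + K * c / η) := by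
  obtain ⟨q, hq0, hq1, C, hC, hN⟩ := h.Nneg hα0 hα1 hθ
  obtain ⟨e, he, hCe⟩ : ∃ e > 0, C * e ^ q = ε := by
    refine ⟨(ε / C) ^ (q⁻¹), by positivity, ?_⟩
    rw [← Real.rpow_mul (by positivity), inv_mul_cancel₀ hq0.ne', Real.rpow_one]; field_simp
  refine ⟨1 / e, by positivity, fun n hn f hf c hfc η hη => ?_⟩
  have := h.prob n
  have hc := c0_pos hα0 hθ
  have hn0 : (0:ℝ) < n := by exact_mod_cast hn
  have hx : 0 < (n:ℝ)^α := by positivity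
  set x := (n:ℝ)^α with hxd
  have hxq : (n:ℝ)^(-(q*α)) = x ^ (-q) := by
    rw [hxd, ← Real.rpow_mul hn0.le]; congr 1; ring
  have hN := hN n hn
  rw [hxq] at hN
  clear_value x
  have hA1 : (m n).real {b | (e * x)^(-q) ≤ (-b 0)^(-q)} ≤ ε := by
    have h1 := mul_meas_ge_le_integral_of_nonneg (μ := m n) (f := fun b => (-b 0)^(-q)) (by
      filter_upwards [h.good n hn] with b hg
      exact Real.rpow_nonneg (by linarith [hg.N_ge]) _) (h.intg hn _) ((e * x)^(-q))
    have h2 := h1.trans hN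
    rw [Real.mul_rpow he.le hx.le] at h2 ⊢
    have hxp : 0 < x^(-q) := by positivity
    have hep : 0 < e^(-q) := by positivity
    generalize (m n).real {b | e^(-q) * x^(-q) ≤ (-b 0)^(-q)} = A at *
    have h3 : e^(-q) * A ≤ C := by
      refine le_of_mul_le_mul_right ?_ hxp
      linarith
    rw [← hCe]
    have : e^q * e^(-q) = 1 := by rw [← Real.rpow_add he]; simp
    have := mul_le_mul_of_nonneg_left h3 (show 0 ≤ e^q by positivity)
    rw [← mul_assoc, ‹e^q * e^(-q) = 1›, one_mul] at this
    linarith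
  have hA2 : (m n).real {b | η * (e * x) ≤ f b} ≤ 1 / e * c / η := by
    have h1 := mul_meas_ge_le_integral_of_nonneg (μ := m n) (f := f)
      (Eventually.of_forall hf) (h.intg hn _) (η * (e * x))
    have h2 := h1.trans hfc
    generalize (m n).real {b | η * (e * x) ≤ f b} = A at *
    have h3 : η * e * A ≤ c := by
      refine le_of_mul_le_mul_right ?_ hx
      linarith
    rw [le_div_iff₀ hη, one_div, ← div_eq_inv_mul, le_div_iff₀ he]; linarith
  have hsub : {b : ℕ → ℝ | η * (-b 0) < f b} ≤ᵐ[m n]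
      ({b | (e * x)^(-q) ≤ (-b 0)^(-q)} ∪ {b | η * (e * x) ≤ f b} : Set (ℕ → ℝ)) := by
    filter_upwards [h.good n hn] with b hg hb
    have hN := hg.N_ge
    rcases le_total (-b 0) (e * x) with h1 | h1
    · left
      exact Real.rpow_le_rpow_of_nonpos (by linarith) h1 (by linarith)
    · right
      exact (mul_le_mul_of_nonneg_left h1 hη.le).trans (le_of_lt hb)
  refine (measure_mono_ae hsub).trans ?_
  rw [← ofReal_measureReal]
  exact ENNReal.ofReal_le_ofReal ((measureReal_union_le _ _).trans (add_le_add hA1 hA2))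

def EE (α θ : ℝ) (r : ℕ) (b : ℕ → ℝ) : ℝ := DD α (r+1) b + θ / α * pp α (r+1)

theorem EE_sq (hα0 : 0 < α) (hα1 : α < 1) (r : ℕ) (b : ℕ → ℝ) :
    EE α θ r b ^ 2 ≤ 2 * DD α (r+1) b ^ 2 + 2 * (θ/α)^2 * pp α (r+1) := by
  have h0 := pp_pos hα0 hα1 r
  have h1 := pp_le_one hα0 hα1 r
  have : EE α θ r b ^ 2 ≤ 2 * DD α (r+1) b ^ 2 + 2 * (θ/α * pp α (r+1)) ^ 2 := by
    unfold EE; nlinarith [sq_nonneg (DD α (r+1) b - θ / α * pp α (r+1))]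
  have h2 : pp α (r+1) ^ 2 ≤ pp α (r+1) := by nlinarith
  have h3 := mul_le_mul_of_nonneg_left h2 (show 0 ≤ 2 * (θ/α)^2 by positivity)
  nlinarith

theorem Chain.intE (h : Chain α θ m) (hα0 : 0 < α) (hα1 : α < 1) {n : ℕ} (hn : 1 ≤ n) (s : Finset ℕ) :
    ∫ b, ∑ r ∈ s, EE α θ r b ^ 2 ∂ m n ≤ 2 * ∑ r ∈ s, ∫ b, DD α (r+1) b ^ 2 ∂ m n + 2 * (θ/α)^2 := by
  have := h.prob n
  have h1 : ∑ r ∈ s, pp α (r+1) ≤ 1 := by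
    have := (pp_hasSum hα0 hα1).summable.sum_le_tsum s fun i _ => (pp_pos hα0 hα1 i).le
    rwa [(pp_hasSum hα0 hα1).tsum_eq] at this
  rw [integral_finsetSum _ fun i _ => h.intg hn _]
  have h2 : ∀ r ∈ s, ∫ b, EE α θ r b ^ 2 ∂ m n
      ≤ 2 * (∫ b, DD α (r+1) b ^ 2 ∂ m n) + 2 * (θ/α)^2 * pp α (r+1) := by
    intro r _
    have := integral_mono (h.intg hn _) (h.intg hn _) (EE_sq (θ := θ) hα0 hα1 r)
      (μ := m n)
    rw [integral_add (h.intg hn _) (h.intg hn _), integral_const_mul] at this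
    simpa using this
  refine (Finset.sum_le_sum h2).trans ?_
  rw [Finset.sum_add_distrib, ← Finset.mul_sum, ← Finset.mul_sum]
  have := mul_le_mul_of_nonneg_left h1 (show 0 ≤ 2 * (θ/α)^2 by positivity)
  linarith

theorem npow_top (hα0 : 0 < α) : Tendsto (fun n : ℕ => (n:ℝ)^α) atTop atTop :=
  (tendsto_rpow_atTop hα0).comp tendsto_natCast_atTop_atTop

theorem Good.qsq {n : ℕ} {b : ℕ → ℝ} (hg : Good α θ n b) (hα0 : 0 < α) (hα1 : α < 1) (hθ : 0 < α + θ)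
    (s : Finset ℕ) {η : ℝ} (hs : ∑ r ∈ s, EE α θ r b ^ 2 ≤ η * (-b 0)) :
    ∑ r ∈ s, (EP.qq θ hα0 hα1 n b r) ^ 2 ≤ (1 + |θ/α|) * η := by
  have hc := c0_pos hα0 hθ
  have h1 := hg.k1
  have h2 := hg.N_ge
  have hη : 0 ≤ η := by
    have : 0 ≤ ∑ r ∈ s, EE α θ r b ^ 2 := Finset.sum_nonneg fun r _ => sq_nonneg _
    exact nonneg_of_mul_nonneg_left (this.trans hs) (by linarith)
  have e : ∑ r ∈ s, (EP.qq θ hα0 hα1 n b r) ^ 2 = (∑ r ∈ s, EE α θ r b ^ 2) / (-b 0 - θ/α) := by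
    rw [Finset.sum_div]
    refine Finset.sum_congr rfl fun r _ => ?_
    rw [hg.qq hα0 hα1, div_pow, Real.sq_sqrt (by linarith)]; rfl
  rw [e, div_le_iff₀ (by linarith)]
  refine hs.trans ?_
  generalize θ / α = c at *
  have : -b 0 ≤ (1 + |c|) * (-b 0 - c) := by
    nlinarith [abs_nonneg c, le_abs_self c]
  nlinarith

def box (R : ℕ) (M : ℝ) : Set ellTwo :=
  (fun c : ℕ → ℝ => ∑ r ∈ Finset.range R, (lp.single 2 r (c r) : ellTwo)) ''
    (Set.univ.pi fun _ => Set.Icc (-M) M)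

theorem box_compact (R : ℕ) (M : ℝ) : IsCompact (box R M) := by
  refine (isCompact_univ_pi fun _ => isCompact_Icc).image ?_
  refine continuous_finsetSum _ fun r _ => ?_
  exact (lp.singleContinuousLinearMap ℝ (fun _ : ℕ => ℝ) 2 r).continuous.comp (continuous_apply r)

theorem mem_thick {R : ℕ} {M δ : ℝ} (hδ : 0 < δ) (hM : 0 ≤ M) (y : ellTwo)
    (h1 : ∑ r ∈ Finset.range R, y r ^ 2 ≤ M ^ 2) (h2 : ∀ L, ∑ r ∈ Finset.Ico R L, y r ^ 2 ≤ δ ^ 2) :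
    y ∈ Metric.cthickening δ (box R M) := by
  have hmem : (∑ r ∈ Finset.range R, (lp.single 2 r (y r) : ellTwo)) ∈ box R M := by
    refine ⟨fun r => if r < R then y r else 0, fun r _ => ?_, ?_⟩
    · dsimp only
      split_ifs with hr
      · have := (Finset.single_le_sum (f := fun r => y r ^ 2) (fun i _ => sq_nonneg _)
          (Finset.mem_range.2 hr)).trans h1
        exact abs_le.1 (abs_le_of_sq_le_sq this hM)
      · exact ⟨by linarith, hM⟩
    · refine Finset.sum_congr rfl fun r hr => ?_
      simp [Finset.mem_range.1 hr]
  refine Metric.mem_cthickening_of_dist_le _ _ _ _ hmem ?_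
  rw [dist_eq_norm]
  refine lp.norm_le_of_forall_sum_le (p := 2) (by norm_num) hδ.le fun s => ?_
  obtain ⟨L, hL⟩ : ∃ L, s ⊆ Finset.range L := ⟨s.sup id + 1, fun i hi => by
    have := Finset.le_sup (f := id) hi
    simp only [id, Finset.mem_range] at *; omega⟩
  have e : ∀ r, ‖(y - ∑ i ∈ Finset.range R, (lp.single 2 i (y i) : ellTwo)) r‖ ^ (2:ENNReal).toReal
      = if r < R then 0 else y r ^ 2 := by
    intro r
    rw [lp.coeFn_sub, Pi.sub_apply, trunc_apply]
    split_ifs <;> simp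
  simp only [e]
  have h3 : (δ:ℝ) ^ (2:ENNReal).toReal = δ^2 := by simp
  rw [h3]
  refine le_trans ?_ (h2 L)
  refine (Finset.sum_le_sum_of_subset_of_nonneg hL fun i _ _ => by split_ifs <;> positivity).trans ?_
  rw [← Finset.sum_filter_add_sum_filter_not _ (fun r => r < R)]
  rw [Finset.sum_eq_zero (fun r hr => by simp [(Finset.mem_filter.1 hr).2]), zero_add]
  have : (Finset.range L).filter (fun r => ¬ r < R) = Finset.Ico R L := by
    ext r; simp only [Finset.mem_filter, Finset.mem_range, Finset.mem_Ico]; omega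
  rw [this]
  refine (Finset.sum_congr rfl fun r hr => ?_).le
  rw [if_neg (by have := Finset.mem_Ico.1 hr; omega)]

theorem Chain.tight (h : Chain α θ m) (hα0 : 0 < α) (hα1 : α < 1) (hθ : 0 < α + θ)
    {ε : ENNReal} (hε : 0 < ε) {δ : ℝ} (hδ : 0 < δ) :
    ∃ C : Set ellTwo, IsCompact C ∧ ∀ᶠ n in atTop,
      m n {b | EP.qq θ hα0 hα1 n b ∉ Metric.cthickening δ C} ≤ ε := by
  obtain ⟨ε1, hε1, hε1'⟩ := ENNReal.lt_iff_exists_nnreal_btwn.1 hε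
  have hε1 : (0:ℝ) < ε1 := by exact_mod_cast hε1
  obtain ⟨K, hK, hsm⟩ := h.small hα0 hα1 hθ (show (0:ℝ) < ε1 / 4 by positivity)
  set a := 1 + |θ/α| with ha
  have ha0 : 0 < a := by positivity
  set η := δ^2 / a with hη
  have hη0 : 0 < η := by positivity
  set c := (ε1 / 4) * η / K with hc
  have hc0 : 0 < c := by positivity
  obtain ⟨R, hR⟩ := h.L2 hα0 hα1 hθ (show (0:ℝ) < c / 4 by positivity)
  obtain ⟨C1, hC1, hL1⟩ := h.L1 hα0 hα1 hθ
  set c2 := 2 * (R * C1) + 2 * (θ/α)^2 + 1 with hc2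
  have hc20 : 0 < c2 := by positivity
  set η2 := K * c2 / (ε1 / 4) with hη2
  have hη20 : 0 < η2 := by positivity
  refine ⟨box R (√(a * η2)), box_compact _ _, ?_⟩
  filter_upwards [hR, eventually_ge_atTop 1, (npow_top hα0).eventually_ge_atTop (2 * (θ/α)^2 / (c/2))]
    with n hn1 hn hn2
  have hx := one_le_npow hα0 hn
  have hp := h.prob n
  have ev1 : m n {b | η2 * (-b 0) < ∑ r ∈ Finset.range R, EE α θ r b ^ 2}
      ≤ ENNReal.ofReal (ε1 / 2) := by
    refine (hsm n hn _ (fun b => Finset.sum_nonneg fun r _ => sq_nonneg _) c2 ?_ η2 hη20).trans ?_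
    · refine (h.intE hα0 hα1 hn _).trans ?_
      have : ∑ r ∈ Finset.range R, ∫ b, DD α (r+1) b ^ 2 ∂ m n ≤ R * (C1 * (n:ℝ)^α) := by
        refine (Finset.sum_le_sum fun r _ => hL1 n hn r).trans ?_
        simp
      generalize (n:ℝ)^α = x at *
      rw [hc2]
      nlinarith [sq_nonneg (θ/α)]
    · refine ENNReal.ofReal_le_ofReal (le_of_eq ?_)
      rw [hη2]; field_simp; norm_num
  have ev2 : m n {b | ∃ L, η * (-b 0) < ∑ r ∈ Finset.Ico R L, EE α θ r b ^ 2}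
      ≤ ENNReal.ofReal (ε1 / 2) := by
    have hmono : Monotone fun L : ℕ => {b : ℕ → ℝ | η * (-b 0) < ∑ r ∈ Finset.Ico R L, EE α θ r b ^ 2} := by
      intro L L' hLL b hb
      have hb : η * (-b 0) < ∑ r ∈ Finset.Ico R L, EE α θ r b ^ 2 := hb
      exact lt_of_lt_of_le hb (Finset.sum_le_sum_of_subset_of_nonneg
        (Finset.Ico_subset_Ico le_rfl hLL) fun i _ _ => sq_nonneg _)
    have e : {b : ℕ → ℝ | ∃ L, η * (-b 0) < ∑ r ∈ Finset.Ico R L, EE α θ r b ^ 2}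
        = ⋃ L : ℕ, {b : ℕ → ℝ | η * (-b 0) < ∑ r ∈ Finset.Ico R L, EE α θ r b ^ 2} := by
      ext b; simp
    rw [e, hmono.measure_iUnion]
    refine iSup_le fun L => ?_
    refine (hsm n hn _ (fun b => Finset.sum_nonneg fun r _ => sq_nonneg _) c ?_ η hη0).trans ?_
    · refine (h.intE hα0 hα1 hn _).trans ?_
      have := hn1 L
      rw [div_le_iff₀ (by positivity)] at hn2
      generalize (n:ℝ)^α = x at *
      nlinarith
    · refine ENNReal.ofReal_le_ofReal (le_of_eq ?_)
      rw [hc]; field_simp; norm_num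
  have hsub : {b | EP.qq θ hα0 hα1 n b ∉ Metric.cthickening δ (box R (√(a * η2)))} ≤ᵐ[m n]
      ({b | η2 * (-b 0) < ∑ r ∈ Finset.range R, EE α θ r b ^ 2} ∪
        {b | ∃ L, η * (-b 0) < ∑ r ∈ Finset.Ico R L, EE α θ r b ^ 2} : Set (ℕ → ℝ)) := by
    filter_upwards [h.good n hn] with b hg hb
    by_contra hcon
    refine hb ?_
    have hcon1 := fun h => hcon (Or.inl h)
    have hcon2 := fun h => hcon (Or.inr h)
    have hcon1 : ∑ r ∈ Finset.range R, EE α θ r b ^ 2 ≤ η2 * (-b 0) := not_lt.1 hcon1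
    have hcon2 : ∀ L, ∑ r ∈ Finset.Ico R L, EE α θ r b ^ 2 ≤ η * (-b 0) := fun L =>
      not_lt.1 fun h => hcon2 ⟨L, h⟩
    refine mem_thick hδ (Real.sqrt_nonneg _) _ ?_ fun L => ?_
    · rw [Real.sq_sqrt (by positivity)]
      exact hg.qsq hα0 hα1 hθ _ hcon1
    · refine (hg.qsq hα0 hα1 hθ _ (hcon2 L)).trans (le_of_eq ?_)
      rw [hη, ← ha]; exact mul_div_cancel₀ _ ha0.ne'
  refine (measure_mono_ae hsub).trans ((measure_union_le _ _).trans ((add_le_add ev1 ev2).trans ?_))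
  rw [← ENNReal.ofReal_add (by positivity) (by positivity), add_halves, ENNReal.ofReal_coe_nnreal]
  exact hε1'.le
end EP

/-- Gaussian process limit for the self-normalized Ewens–Pitman process: for each `n ≥ 1`
the sequence `(√(K_n)(P_{r,n} - p_α(r)))_{r≥1}` is a random element `Q n` of `ℓ²(ℕ)`
(coordinate `r - 1` of `Q n` is the `r`-th component), and `Q n` converges in distribution,
in the norm topology of `ℓ²`, to a centered Gaussian random element with covariance
`Γ_α = diag(p_α) - p_α p_αᵀ`, i.e. to a probability measure `ν` on `ℓ²` such that for every
`x ∈ ℓ²` the functional `g ↦ ⟪x, g⟫` is a centered real Gaussian under `ν`, with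
`E[⟪x, G⟫ ⟪y, G⟫] = ∑_r p_α(r) x_r y_r - (∑_r p_α(r) x_r)(∑_r p_α(r) y_r)`. -/
theorem gaussian_process_limit (α θ : ℝ) (hα0 : 0 < α) (hα1 : α < 1) (hθ : 0 < α + θ)
    {Ω : Type*} [mΩ : MeasurableSpace Ω] (μ : Measure Ω) (F : Filtration ℕ mΩ)
    (K : ℕ → Ω → ℕ) (B : ℕ → ℕ → Ω → ℕ) (hEP : IsEwensPitman α θ μ F K B) :
    ∃ Q : ℕ → Ω → ellTwo,
      (∀ n, 1 ≤ n → AEStronglyMeasurable (Q n) μ) ∧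
      (∀ n, 1 ≤ n → ∀ᵐ ω ∂μ, ∀ r, 1 ≤ r →
        Q n ω (r - 1) =
          Real.sqrt (K n ω : ℝ) * ((B r n ω : ℝ) / (K n ω : ℝ) - sibuya α r)) ∧
      ∃ ν : Measure ellTwo, IsProbabilityMeasure ν ∧
        (∀ x : ellTwo,
          ν.map (fun g => ⟪x, g⟫) =
            gaussianReal 0 (Real.toNNReal
              (∑' r : ℕ, sibuya α (r + 1) * x r * x r -
                (∑' r : ℕ, sibuya α (r + 1) * x r) ^ 2))) ∧
        (∀ x y : ellTwo,
          ∫ g, ⟪x, g⟫ * ⟪y, g⟫ ∂ν =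
            ∑' r : ℕ, sibuya α (r + 1) * x r * y r -
              (∑' r : ℕ, sibuya α (r + 1) * x r) * (∑' r : ℕ, sibuya α (r + 1) * y r)) ∧
        (∀ f : BoundedContinuousFunction ellTwo ℝ,
          Tendsto (fun n => ∫ ω, f (Q n ω) ∂μ) atTop (𝓝 (∫ g, f g ∂ν))) := by
  have hprob := hEP.prob
  have hsct := EP.sct
  have hch := EP.chain_of hα0 hα1 hθ hEP
  have hmb := fun n => EP.meas_bb' hEP (α := α) (θ := θ) n
  have hmq := fun n => EP.qq_meas (θ := θ) hα0 hα1 n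
  have hp0 : ∀ r, 0 ≤ EP.pp α (r + 1) := fun r => (EP.pp_pos hα0 hα1 r).le
  have hps := (EP.pp_hasSum hα0 hα1).summable
  have hsib : ∀ r, sibuya α (r + 1) = EP.pp α (r + 1) := fun r =>
    (EP.pp_sib α (show 1 ≤ r + 1 by omega)).symm
  let ρ : ℕ → ProbabilityMeasure ellTwo := fun n =>
    ⟨(μ.map (EP.bb α θ K B n)).map (EP.qq θ hα0 hα1 n), by
      have := hch.prob n
      exact Measure.isProbabilityMeasure_map (hmq n).aemeasurable⟩
  have hρ : ∀ n, (ρ n : Measure ellTwo) = (μ.map (EP.bb α θ K B n)).map (EP.qq θ hα0 hα1 n) :=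
    fun n => rfl
  have hT : IsTightMeasureSet (Set.range fun n => (ρ n : Measure ellTwo)) := by
    refine EP.tight_seq ρ fun ε hε δ hδ => ?_
    obtain ⟨C, hC, hn⟩ := hch.tight hα0 hα1 hθ hε hδ
    refine ⟨C, hC, ?_⟩
    filter_upwards [hn] with n hn
    rw [hρ, Measure.map_apply (hmq n) Metric.isClosed_cthickening.measurableSet.compl]
    exact hn
  have hcf : ∀ (x : ellTwo) (R : ℕ), (∀ r, R ≤ r → x r = 0) →
      Tendsto (fun n => charFun (ρ n : Measure ellTwo) x) atTop
        (𝓝 ((Real.exp (-(EP.VV2 (fun r => EP.pp α (r+1)) x)/2) : ℝ) : ℂ)) := by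
    intro x R hx
    refine (hch.char hα0 hα1 hθ x R hx).congr fun n => ?_
    rw [hρ, charFun_apply, integral_map (hmq n).aemeasurable]
    exact Continuous.aestronglyMeasurable (by fun_prop)
  obtain ⟨ν, hν1, hν2⟩ := EP.lim_exists ρ _ hT hcf (EP.VV2_trunc hp0 hps)
  obtain ⟨g1, g2⟩ := EP.gauss_of hp0 hps (ν : Measure ellTwo) hν1
  refine ⟨fun n ω => EP.qq θ hα0 hα1 n (EP.bb α θ K B n ω), fun n _ =>
    ((hmq n).comp (hmb n)).aestronglyMeasurable, fun n hn => ?_, (ν : Measure ellTwo),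
    inferInstance, fun x => ?_, fun x y => ?_, fun f => ?_⟩
  · filter_upwards [EP.good_bb hα0 hα1 hθ hEP n hn] with ω hg r hr
    obtain ⟨s, rfl⟩ : ∃ s, r = s + 1 := ⟨r - 1, by omega⟩
    have hk := hg.k1
    rw [Nat.add_sub_cancel, hg.qq hα0 hα1, EP.DD, hsib, EP.bb_pos hr]
    rw [EP.bb_zero] at hk ⊢
    rw [show -(-((K n ω : ℝ) + θ / α)) - θ / α = (K n ω : ℝ) by ring] at hk ⊢
    have hs : 0 < √(K n ω : ℝ) := Real.sqrt_pos.2 (by linarith)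
    have h2 : (K n ω : ℝ) = √(K n ω : ℝ) ^ 2 := (Real.sq_sqrt (by linarith)).symm
    generalize √(K n ω : ℝ) = u at *
    rw [h2]
    generalize θ / α = c
    field_simp
    ring
  · simp only [hsib]; exact g1 x
  · simp only [hsib]; exact g2 x y
  · have h3 := (ProbabilityMeasure.tendsto_iff_forall_integral_tendsto.1 hν2) f
    refine h3.congr fun n => ?_
    rw [hρ, integral_map (hmq n).aemeasurable f.continuous.aestronglyMeasurable, integral_map (hmb n).aemeasurable]
    exact (f.continuous.measurable.comp (hmq n)).aestronglyMeasurable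

end
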